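/- Theorem (Rogers–Selberg-type identity for principal subspaces of A₂^{(1)}). Let a,b,k be integers with 0 ≤ a,b ≤ k and let ν := (a+b+2, b+1, 0). Then, as an identity of formal power series in q with coefficients in ℚ(x_1,x_2,x_3) (equivalently for |q| < 1 and generic x_i): Σ over λ_1 ≥ ⋯ ≥ λ_k ≥ 0 and μ_1 ≥ ⋯ ≥ μ_k ≥ 0 of (1 − (x_1/x_3) q^{λ_a+μ_b−1}) · ∏_{i=1}^k (x_1/x_2)^{λ_i} (x_2/x_3)^{μ_i} q^{λ_i²−λ_iμ_i+μ_i² − χ(i≤a)λ_i − χ(i≤b)μ_i} / [(q;q)_{λ_i−λ_{i+1}} (q;q)_{μ_i−μ_{i+1}}] = Σ_{y ∈ Q_+} det_{1≤i,j≤3}((x_i q^{y_i})^{ν_i−ν_j}) / ∏_{1≤i<j≤3} (x_i/x_j;q)_∞ · ∏_{i=1}^3 x_i^{(k+2)y_i} q^{(k+2)·C(y_i,2) − ν_i y_i} (x_i/x_3;q)_{y_i} / (q x_i/x_1;q)_{y_i}, where λ_{k+1} = μ_{k+1} := 0, C(y,2) := y(y−1)/2, χ(P) = 1 if P holds and 0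 otherwise, and the convention q^{λ_0} = q^{μ_0} := 0 is used (so the factor 1 − (x_1/x_3)q^{λ_a+μ_b−1} equals 1 when a = 0 or b = 0). -/

import Mathlib

noncomputable section

namespace Stmt3

/-- `(a; q)_n`, the finite q-Pochhammer symbol. -/
def qPoch (a q : ℂ) (n : ℕ) : ℂ := ∏ j ∈ Finset.range n, (1 - a * q ^ j)

/-- `(a; q)_∞`. -/
def qPochInf (a q : ℂ) : ℂ := ∏' j : ℕ, (1 - a * q ^ j)

/-- `(a;q)_n` for `n : ℤ`:  the usual product for `n ≥ 0` and
`(a;q)_{-m} = 1/∏_{j=1}^m (1 - a q^{-j})` for `n = -m < 0`. -/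
def qPochZ (a q : ℂ) (n : ℤ) : ℂ :=
  if 0 ≤ n then qPoch a q n.toNat
  else (∏ j ∈ Finset.range (-n).toNat, (1 - a * q ^ (-(j : ℤ) - 1)))⁻¹

/-- `1/(q;q)_n` for `n : ℤ`, with the convention that it vanishes for `n < 0`. -/
def qFacInv (q : ℂ) (n : ℤ) : ℂ := if 0 ≤ n then (qPoch q q n.toNat)⁻¹ else 0

/-- `f₁, …, f_k` read as a sequence indexed by `1, …, k` and extended by zero
(in particular `λ_{k+1} = 0`). -/
def nth {k : ℕ} (f : Fin k → ℕ) (i : ℕ) : ℕ :=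
  if h : 1 ≤ i ∧ i ≤ k then f ⟨i - 1, by omega⟩ else 0

/-- Decreasing sequences `λ_1 ≥ λ_2 ≥ ⋯ ≥ λ_k ≥ 0` of nonnegative integers. -/
def Decr (k : ℕ) : Type := {f : Fin k → ℕ // ∀ i j : Fin k, i ≤ j → f j ≤ f i}

/-- The set `Q₊ = {y ∈ ℤ³ : y₁+y₂+y₃ = 0, y₁ ≥ 0, y₁+y₂ ≥ 0}`. -/
def Qplus : Type := {y : Fin 3 → ℤ // y 0 + y 1 + y 2 = 0 ∧ 0 ≤ y 0 ∧ 0 ≤ y 0 + y 1}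

/-- `ν = (a+b+2, b+1, 0)`. -/
def nu (a b : ℕ) : Fin 3 → ℤ := ![(a : ℤ) + b + 2, (b : ℤ) + 1, 0]

section InfiniteProduct

open Filter Topology

theorem qPoch_zero (a q : ℂ) : qPoch a q 0 = 1 := by simp [qPoch]

theorem qPoch_succ (a q : ℂ) (n : ℕ) : qPoch a q (n + 1) = qPoch a q n * (1 - a * q ^ n) := by
  simp [qPoch, Finset.prod_range_succ]

theorem qPoch_add (a q : ℂ) (m n : ℕ) :
    qPoch a q (m + n) = qPoch a q m * qPoch (a * q ^ m) q n := by
  simp only [qPoch, Finset.prod_range_add]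
  congr 1
  exact Finset.prod_congr rfl fun j _ => by rw [pow_add]; ring

theorem qPoch_succ' (a q : ℂ) (n : ℕ) :
    qPoch a q (n + 1) = (1 - a) * qPoch (a * q) q n := by
  rw [add_comm, qPoch_add]
  simp [qPoch]

theorem qPoch_ne_zero {a q : ℂ} (h : ∀ j : ℕ, a * q ^ j ≠ 1) (n : ℕ) : qPoch a q n ≠ 0 :=
  Finset.prod_ne_zero_iff.2 fun j _ => sub_ne_zero.2 (h j).symm

theorem summable_norm_mul_pow {q : ℂ} (hq : ‖q‖ < 1) (a : ℂ) :
    Summable fun j : ℕ => ‖-(a * q ^ j)‖ := by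
  simpa [norm_mul, norm_pow] using
    (summable_geometric_of_lt_one (norm_nonneg q) hq).mul_left ‖a‖

theorem multipliable_qPochInf {q : ℂ} (hq : ‖q‖ < 1) (a : ℂ) :
    Multipliable fun j : ℕ => 1 - a * q ^ j := by
  simpa [sub_eq_add_neg] using multipliable_one_add_of_summable (summable_norm_mul_pow hq a)

theorem qPochInf_eq_mul {q : ℂ} (hq : ‖q‖ < 1) (a : ℂ) (n : ℕ) :
    qPochInf a q = qPoch a q n * qPochInf (a * q ^ n) q := by
  have h : Multipliable fun j : ℕ => 1 - a * q ^ (j + n) :=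
    (multipliable_qPochInf hq (a * q ^ n)).congr fun j => by rw [pow_add]; ring
  have h2 := Multipliable.prod_mul_tprod_nat_mul' (f := fun j : ℕ => 1 - a * q ^ j) (k := n) h
  rw [qPochInf, ← h2, qPoch, qPochInf]
  congr 1
  exact tprod_congr fun j => by rw [pow_add]; ring

theorem qPochInf_step {q : ℂ} (hq : ‖q‖ < 1) (a : ℂ) :
    qPochInf a q = (1 - a) * qPochInf (q * a) q := by
  rw [qPochInf_eq_mul hq a 1, qPoch_succ, qPoch_zero]
  simp [mul_comm]

theorem qPochInf_ne_zero {q : ℂ} (hq : ‖q‖ < 1) {a : ℂ} (h : ∀ j : ℕ, a * q ^ j ≠ 1) :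
    qPochInf a q ≠ 0 := by
  have := tprod_one_add_ne_zero_of_summable (f := fun j : ℕ => -(a * q ^ j))
    (fun j => by simpa [← sub_eq_add_neg, sub_ne_zero] using (h j).symm)
    (summable_norm_mul_pow hq a)
  simpa [qPochInf, sub_eq_add_neg] using this

theorem qPochInf_eq_zero {q : ℂ} (hq : ‖q‖ < 1) {a : ℂ} (j : ℕ) (h : a * q ^ j = 1) :
    qPochInf a q = 0 := by
  rw [qPochInf_eq_mul hq a (j + 1), qPoch_succ, h]
  simp

theorem norm_qPochInf_sub_one_le {q : ℂ} (hq : ‖q‖ < 1) (a : ℂ) :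
    ‖qPochInf a q - 1‖ ≤ Real.exp (‖a‖ * (1 - ‖q‖)⁻¹) - 1 := by
  have h := (multipliable_qPochInf hq a).hasProd.tendsto_prod_nat
  refine le_of_tendsto ((h.sub_const 1).norm) (Eventually.of_forall fun n => ?_)
  have h2 := Finset.norm_prod_one_add_sub_one_le (Finset.range n) (fun j => -(a * q ^ j))
  simp only [← sub_eq_add_neg] at h2
  refine h2.trans (sub_le_sub_right (Real.exp_le_exp.2 ?_) 1)
  refine ((summable_norm_mul_pow hq a).sum_le_tsum _ (fun _ _ => norm_nonneg _)).trans_eq ?_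
  simp [norm_pow, tsum_mul_left, tsum_geometric_of_lt_one (norm_nonneg q) hq]

theorem norm_qPochInf_le {q : ℂ} (hq : ‖q‖ < 1) {a : ℂ} {C : ℝ} (ha : ‖a‖ ≤ C) :
    ‖qPochInf a q‖ ≤ Real.exp (C * (1 - ‖q‖)⁻¹) := by
  have h := norm_qPochInf_sub_one_le hq a
  have h1 : ‖qPochInf a q‖ ≤ ‖qPochInf a q - 1‖ + 1 := by
    simpa using norm_add_le (qPochInf a q - 1) 1
  have h2 : Real.exp (‖a‖ * (1 - ‖q‖)⁻¹) ≤ Real.exp (C * (1 - ‖q‖)⁻¹) :=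
    Real.exp_le_exp.2 (mul_le_mul_of_nonneg_right ha (inv_nonneg.2 (by linarith)))
  linarith

theorem tendsto_qPochInf {ι : Type*} {l : Filter ι} {q : ℂ} (hq : ‖q‖ < 1) {f : ι → ℂ}
    (hf : Tendsto f l (𝓝 0)) : Tendsto (fun i => qPochInf (f i) q) l (𝓝 1) := by
  rw [tendsto_iff_norm_sub_tendsto_zero]
  have h : Tendsto (fun i => Real.exp (‖f i‖ * (1 - ‖q‖)⁻¹) - 1) l (𝓝 0) := by
    have h1 : Tendsto (fun i => ‖f i‖ * (1 - ‖q‖)⁻¹) l (𝓝 0) := by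
      simpa using hf.norm.mul_const (1 - ‖q‖)⁻¹
    simpa using ((Real.continuous_exp.tendsto 0).comp h1).sub_const 1
  exact squeeze_zero (fun _ => norm_nonneg _) (fun i => norm_qPochInf_sub_one_le hq (f i)) h

theorem self_mul_pow_ne_one {q : ℂ} (hq : ‖q‖ < 1) (j : ℕ) : q * q ^ j ≠ 1 := by
  intro h
  have : ‖q ^ (j + 1)‖ < 1 := by
    rw [norm_pow]; exact pow_lt_one₀ (norm_nonneg q) hq (by omega)
  rw [pow_succ', h] at this
  simp at this

theorem zpow_eq_one_iff {q : ℂ} (hq : ‖q‖ < 1) (hq0 : q ≠ 0) (n : ℤ) : q ^ n = 1 ↔ n = 0 := by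
  refine ⟨fun h => ?_, fun h => by simp [h]⟩
  have h1 : ‖q‖ ^ n = ‖q‖ ^ (0 : ℤ) := by rw [← norm_zpow, h]; simp
  exact zpow_right_injective₀ (norm_pos_iff.2 hq0) hq.ne h1

end InfiniteProduct

section FactorialInverse

theorem qFacInv_zero (q : ℂ) : qFacInv q 0 = 1 := by simp [qFacInv, qPoch]

theorem qFacInv_of_neg (q : ℂ) {n : ℤ} (h : n < 0) : qFacInv q n = 0 := by
  simp [qFacInv, not_le.2 h]

theorem qFacInv_natCast (q : ℂ) (n : ℕ) : qFacInv q n = (qPoch q q n)⁻¹ := by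
  simp [qFacInv]

theorem qFacInv_pred {q : ℂ} (hq : ‖q‖ < 1) (n : ℤ) :
    qFacInv q (n - 1) = (1 - q ^ n) * qFacInv q n := by
  rcases lt_trichotomy n 0 with h | rfl | h
  · rw [qFacInv_of_neg q h, qFacInv_of_neg q (by omega)]; simp
  · rw [qFacInv_of_neg q (by omega)]; simp
  · obtain ⟨m, rfl⟩ : ∃ m : ℕ, n = m + 1 := ⟨(n - 1).toNat, by omega⟩
    have e : ((m : ℤ) + 1) = ((m + 1 : ℕ) : ℤ) := by push_cast; ring
    rw [add_sub_cancel_right, e, qFacInv_natCast, qFacInv_natCast, qPoch_succ, zpow_natCast,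
      pow_succ']
    have h2 : 1 - q * q ^ m ≠ 0 := sub_ne_zero.2 (self_mul_pow_ne_one hq m).symm
    field_simp

theorem qFacInv_eq_qPochInf {q : ℂ} (hq : ‖q‖ < 1) (hq0 : q ≠ 0) (n : ℤ) :
    qPochInf (q * q ^ n) q = qPochInf q q * qFacInv q n := by
  rcases lt_or_ge n 0 with h | h
  · rw [qFacInv_of_neg q h, mul_zero]
    refine qPochInf_eq_zero hq (-n - 1).toNat ?_
    rw [← zpow_natCast, ← zpow_one_add₀ hq0, ← zpow_add₀ hq0, zpow_eq_one_iff hq hq0]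
    omega
  · lift n to ℕ using h
    rw [qFacInv_natCast, qPochInf_eq_mul hq q n, zpow_natCast]
    have := qPoch_ne_zero (self_mul_pow_ne_one hq) n
    field_simp

theorem exists_norm_qFacInv_le {q : ℂ} (hq : ‖q‖ < 1) (hq0 : q ≠ 0) :
    ∃ C : ℝ, 0 < C ∧ ∀ n : ℤ, ‖qFacInv q n‖ ≤ C := by
  have h0 : qPochInf q q ≠ 0 := qPochInf_ne_zero hq (self_mul_pow_ne_one hq)
  refine ⟨Real.exp (1 * (1 - ‖q‖)⁻¹) * ‖qPochInf q q‖⁻¹, by positivity, fun n => ?_⟩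
  rcases lt_or_ge n 0 with h | h
  · rw [qFacInv_of_neg q h, norm_zero]; positivity
  · have h1 : qFacInv q n = qPochInf (q * q ^ n) q * (qPochInf q q)⁻¹ := by
      rw [qFacInv_eq_qPochInf hq hq0]; field_simp
    rw [h1, norm_mul, norm_inv]
    refine mul_le_mul_of_nonneg_right (norm_qPochInf_le hq ?_) (by positivity)
    lift n to ℕ using h
    rw [zpow_natCast, ← pow_succ', norm_pow]
    exact pow_le_one₀ (norm_nonneg q) hq.le

end FactorialInverse

section Vandermonde

/-- The unnormalised `q`-binomial transform `∑_j g(j) / ((q;q)_{r-j} (q;q)_j)`. -/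
def binomSum (q : ℂ) (r : ℕ) (g : ℕ → ℂ) : ℂ :=
  ∑ j ∈ Finset.range (r + 1), qFacInv q ((r : ℤ) - j) * qFacInv q j * g j

theorem binomSum_zero (q : ℂ) (g : ℕ → ℂ) : binomSum q 0 g = g 0 := by
  simp [binomSum, qFacInv_zero]

theorem binomSum_congr (q : ℂ) (r : ℕ) {g g' : ℕ → ℂ} (h : ∀ j, g j = g' j) :
    binomSum q r g = binomSum q r g' := by
  simp only [binomSum, h]

theorem binomSum_mul_left (q : ℂ) (r : ℕ) (c : ℂ) (g : ℕ → ℂ) :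
    binomSum q r (fun j => c * g j) = c * binomSum q r g := by
  simp only [binomSum, Finset.mul_sum]
  exact Finset.sum_congr rfl fun j _ => by ring

theorem binomSum_extend {q : ℂ} {r R : ℕ} (h : r ≤ R) (g : ℕ → ℂ) :
    ∑ j ∈ Finset.range (R + 1), qFacInv q ((r : ℤ) - j) * qFacInv q j * g j = binomSum q r g := by
  symm
  refine Finset.sum_subset (Finset.range_mono (by omega)) fun j _ hj => ?_
  simp only [Finset.mem_range, not_lt] at hj
  rw [qFacInv_of_neg q (by omega)]
  simp

theorem binomSum_succ {q : ℂ} (hq : ‖q‖ < 1) (hq0 : q ≠ 0) (r : ℕ) (g : ℕ → ℂ) :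
    (1 - q ^ (r + 1)) * binomSum q (r + 1) g =
      binomSum q r g + binomSum q r (fun i => q ^ ((r : ℤ) - i) * g (i + 1)) := by
  have h : ∀ j : ℕ, (1 - q ^ (r + 1)) *
      (qFacInv q (((r + 1 : ℕ) : ℤ) - j) * qFacInv q j * g j) =
      qFacInv q ((r : ℤ) - j) * qFacInv q j * g j +
      q ^ ((r : ℤ) + 1 - j) * qFacInv q ((r : ℤ) + 1 - j) * qFacInv q ((j : ℤ) - 1) * g j := by
    intro j
    have e1 : (r : ℤ) - j = (r + 1 - j) - 1 := by ring
    have e2 : (q : ℂ) ^ (r + 1) = q ^ ((r : ℤ) + 1 - j) * q ^ (j : ℤ) := by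
      rw [← zpow_add₀ hq0, ← zpow_natCast]; congr 1; push_cast; ring
    rw [e1, qFacInv_pred hq, qFacInv_pred hq (j : ℤ), e2]
    push_cast
    ring
  rw [binomSum, Finset.mul_sum, Finset.sum_congr rfl fun j _ => h j, Finset.sum_add_distrib,
    binomSum_extend (by omega)]
  congr 1
  rw [Finset.sum_range_succ', binomSum]
  simp only [Nat.cast_zero, zero_sub, qFacInv_of_neg q (show (-1 : ℤ) < 0 by omega), mul_zero,
    zero_mul, add_zero]
  refine Finset.sum_congr rfl fun i _ => ?_
  have e1 : (r : ℤ) + 1 - ((i + 1 : ℕ) : ℤ) = r - i := by push_cast; ring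
  have e2 : ((i + 1 : ℕ) : ℤ) - 1 = i := by push_cast; ring
  rw [e1, e2]
  ring

theorem binomSum_succ' {q : ℂ} (hq : ‖q‖ < 1) (hq0 : q ≠ 0) (r : ℕ) (g : ℕ → ℂ) :
    (1 - q ^ (r + 1)) * binomSum q (r + 1) g =
      binomSum q r (fun j => q ^ (j : ℤ) * g j) + binomSum q r (fun i => g (i + 1)) := by
  have h : ∀ j : ℕ, (1 - q ^ (r + 1)) *
      (qFacInv q (((r + 1 : ℕ) : ℤ) - j) * qFacInv q j * g j) =
      qFacInv q ((r : ℤ) - j) * qFacInv q j * (q ^ (j : ℤ) * g j) +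
      qFacInv q ((r : ℤ) + 1 - j) * qFacInv q ((j : ℤ) - 1) * g j := by
    intro j
    have e1 : (r : ℤ) - j = (r + 1 - j) - 1 := by ring
    have e2 : (q : ℂ) ^ (r + 1) = q ^ ((r : ℤ) + 1 - j) * q ^ (j : ℤ) := by
      rw [← zpow_add₀ hq0, ← zpow_natCast]; congr 1; push_cast; ring
    rw [e1, qFacInv_pred hq, qFacInv_pred hq (j : ℤ), e2]
    push_cast
    ring
  rw [binomSum, Finset.mul_sum, Finset.sum_congr rfl fun j _ => h j, Finset.sum_add_distrib,
    binomSum_extend (by omega)]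
  congr 1
  rw [Finset.sum_range_succ', binomSum]
  simp only [Nat.cast_zero, zero_sub, qFacInv_of_neg q (show (-1 : ℤ) < 0 by omega), mul_zero,
    zero_mul, add_zero]
  refine Finset.sum_congr rfl fun i _ => ?_
  have e1 : (r : ℤ) + 1 - ((i + 1 : ℕ) : ℤ) = r - i := by push_cast; ring
  have e2 : ((i + 1 : ℕ) : ℤ) - 1 = i := by push_cast; ring
  rw [e1, e2]

theorem mul_self_mul_pow_ne_one {q c : ℂ} (h : ∀ j : ℕ, c * q ^ j ≠ 1) (j : ℕ) :
    c * q * q ^ j ≠ 1 := by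
  rw [mul_assoc, ← pow_succ']; exact h (j + 1)

theorem one_sub_pow_succ_ne_zero {q : ℂ} (hq : ‖q‖ < 1) (r : ℕ) : 1 - q ^ (r + 1) ≠ 0 := by
  rw [pow_succ']; exact sub_ne_zero.2 (self_mul_pow_ne_one hq r).symm

theorem qFacInv_natCast_succ {q : ℂ} (hq : ‖q‖ < 1) (r : ℕ) :
    qFacInv q r = (1 - q ^ (r + 1)) * qFacInv q ((r + 1 : ℕ) : ℤ) := by
  have := qFacInv_pred hq ((r + 1 : ℕ) : ℤ)
  rw [zpow_natCast] at this
  rw [← this]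
  push_cast
  congr 1
  ring

/-- The limiting case `∑_t c^t q^{t(t-1)} / ((q)_{r-t} (q)_t (c)_t) = 1/((q)_r (c)_r)` of the
`q`-Chu–Vandermonde sum. -/
theorem binomSum_cauchy {q : ℂ} (hq : ‖q‖ < 1) (hq0 : q ≠ 0) (r : ℕ) :
    ∀ c : ℂ, (∀ j : ℕ, c * q ^ j ≠ 1) →
    binomSum q r (fun t => c ^ t * q ^ ((t : ℤ) ^ 2 - t) * (qPoch c q t)⁻¹) =
      qFacInv q r * (qPoch c q r)⁻¹ := by
  induction r with
  | zero => intro c _; rw [binomSum_zero]; simp [qPoch_zero, qFacInv_zero]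
  | succ r ih =>
    intro c hc
    have hc' := mul_self_mul_pow_ne_one hc
    refine mul_left_cancel₀ (one_sub_pow_succ_ne_zero hq r) ?_
    have e : ∀ i : ℕ, q ^ ((r : ℤ) - i) * (c ^ (i + 1) *
        q ^ (((i + 1 : ℕ) : ℤ) ^ 2 - ((i + 1 : ℕ) : ℤ)) * (qPoch c q (i + 1))⁻¹) =
        c * q ^ r * (1 - c)⁻¹ *
          ((c * q) ^ i * q ^ ((i : ℤ) ^ 2 - i) * (qPoch (c * q) q i)⁻¹) := by
      intro i
      have e2 : q ^ ((r : ℤ) - i) * q ^ (((i + 1 : ℕ) : ℤ) ^ 2 - ((i + 1 : ℕ) : ℤ)) =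
          q ^ (r : ℤ) * q ^ (i : ℤ) * q ^ ((i : ℤ) ^ 2 - i) := by
        simp only [← zpow_add₀ hq0]; congr 1; push_cast; ring
      rw [qPoch_succ', mul_inv, mul_pow, pow_succ]
      simp only [zpow_natCast] at e2
      linear_combination (c ^ i * c * ((1 - c)⁻¹ * (qPoch (c * q) q i)⁻¹)) * e2
    rw [binomSum_succ hq hq0, ih c hc, binomSum_congr q r e, binomSum_mul_left, ih _ hc',
      qFacInv_natCast_succ hq]
    have h5 := qPoch_succ' c q r
    have h6 : 1 - c * q ^ r ≠ 0 := sub_ne_zero.2 (hc r).symm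
    have h7 : (qPoch c q r)⁻¹ = (1 - c * q ^ r) * (qPoch c q (r + 1))⁻¹ := by
      rw [qPoch_succ]; field_simp
    have h8 : (1 - c)⁻¹ * (qPoch (c * q) q r)⁻¹ = (qPoch c q (r + 1))⁻¹ := by
      rw [h5, mul_inv]
    linear_combination (1 - q ^ (r + 1)) * qFacInv q ((r + 1 : ℕ) : ℤ) * (h7 + c * q ^ r * h8)

/-- A `q`-Chu–Vandermonde sum. -/
theorem binomSum_vandermonde {q : ℂ} (hq : ‖q‖ < 1) (hq0 : q ≠ 0) (r : ℕ) :
    ∀ (c : ℂ) (s : ℤ), (∀ j : ℕ, c * q ^ j ≠ 1) →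
    binomSum q r (fun t => qFacInv q (s - t) *
        (c ^ t * q ^ ((t : ℤ) ^ 2 - t) * (qPoch c q t)⁻¹)) =
      qFacInv q r * qFacInv q s * qPoch (c * q ^ s) q r * (qPoch c q r)⁻¹ := by
  induction r with
  | zero => intro c s _; rw [binomSum_zero]; simp [qPoch_zero, qFacInv_zero]
  | succ r ih =>
    intro c s hc
    have hc' := mul_self_mul_pow_ne_one hc
    refine mul_left_cancel₀ (one_sub_pow_succ_ne_zero hq r) ?_
    have e : ∀ i : ℕ, q ^ ((r : ℤ) - i) * (qFacInv q (s - ((i + 1 : ℕ) : ℤ)) * (c ^ (i + 1) *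
        q ^ (((i + 1 : ℕ) : ℤ) ^ 2 - ((i + 1 : ℕ) : ℤ)) * (qPoch c q (i + 1))⁻¹)) =
        c * q ^ r * (1 - c)⁻¹ * (qFacInv q ((s - 1) - i) *
          ((c * q) ^ i * q ^ ((i : ℤ) ^ 2 - i) * (qPoch (c * q) q i)⁻¹)) := by
      intro i
      have e1 : s - ((i + 1 : ℕ) : ℤ) = (s - 1) - i := by push_cast; ring
      have e2 : q ^ ((r : ℤ) - i) * q ^ (((i + 1 : ℕ) : ℤ) ^ 2 - ((i + 1 : ℕ) : ℤ)) =
          q ^ (r : ℤ) * q ^ (i : ℤ) * q ^ ((i : ℤ) ^ 2 - i) := by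
        simp only [← zpow_add₀ hq0]; congr 1; push_cast; ring
      rw [e1, qPoch_succ', mul_inv, mul_pow, pow_succ]
      simp only [zpow_natCast] at e2
      linear_combination
        (qFacInv q ((s - 1) - i) * c ^ i * c * ((1 - c)⁻¹ * (qPoch (c * q) q i)⁻¹)) * e2
    rw [binomSum_succ hq hq0, ih c s hc, binomSum_congr q r e, binomSum_mul_left, ih _ _ hc']
    have e3 : c * q * q ^ (s - 1) = c * q ^ s := by
      rw [mul_assoc, ← zpow_one_add₀ hq0]; congr 2; ring
    rw [e3, qFacInv_pred hq, qFacInv_natCast_succ hq, qPoch_succ (c * q ^ s)]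
    have h5 := qPoch_succ' c q r
    have h6 : 1 - c * q ^ r ≠ 0 := sub_ne_zero.2 (hc r).symm
    have h7 : (qPoch c q r)⁻¹ = (1 - c * q ^ r) * (qPoch c q (r + 1))⁻¹ := by
      rw [qPoch_succ]; field_simp
    have h8 : (1 - c)⁻¹ * (qPoch (c * q) q r)⁻¹ = (qPoch c q (r + 1))⁻¹ := by
      rw [h5, mul_inv]
    linear_combination (1 - q ^ (r + 1)) * qFacInv q ((r + 1 : ℕ) : ℤ) * qFacInv q s *
      qPoch (c * q ^ s) q r * (h7 + c * q ^ r * (1 - q ^ s) * h8)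

/-- A second `q`-Chu–Vandermonde sum, obtained from the first by inverting the base. -/
theorem binomSum_vandermonde' {q : ℂ} (hq : ‖q‖ < 1) (hq0 : q ≠ 0) (r : ℕ) :
    ∀ (c : ℂ) (s : ℤ), (∀ j : ℕ, c * q ^ j ≠ 1) →
    binomSum q r (fun t => qFacInv q (s - t) *
        (q ^ (((r : ℤ) - t) * (s - t)) * (qPoch c q t)⁻¹)) =
      qFacInv q r * qFacInv q s * qPoch (c * q ^ s) q r * (qPoch c q r)⁻¹ := by
  induction r with
  | zero => intro c s _; rw [binomSum_zero]; simp [qPoch_zero, qFacInv_zero]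
  | succ r ih =>
    intro c s hc
    have hc' := mul_self_mul_pow_ne_one hc
    refine mul_left_cancel₀ (one_sub_pow_succ_ne_zero hq r) ?_
    have e0 : ∀ j : ℕ, q ^ (j : ℤ) * (qFacInv q (s - j) *
        (q ^ ((((r + 1 : ℕ) : ℤ) - j) * (s - j)) * (qPoch c q j)⁻¹)) =
        q ^ s * (qFacInv q (s - j) * (q ^ (((r : ℤ) - j) * (s - j)) * (qPoch c q j)⁻¹)) := by
      intro j
      have e2 : q ^ (j : ℤ) * q ^ ((((r + 1 : ℕ) : ℤ) - j) * (s - j)) =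
          q ^ s * q ^ (((r : ℤ) - j) * (s - j)) := by
        simp only [← zpow_add₀ hq0]; congr 1; push_cast; ring
      linear_combination (qFacInv q (s - j) * (qPoch c q j)⁻¹) * e2
    have e : ∀ i : ℕ, (qFacInv q (s - ((i + 1 : ℕ) : ℤ)) *
        (q ^ ((((r + 1 : ℕ) : ℤ) - ((i + 1 : ℕ) : ℤ)) * (s - ((i + 1 : ℕ) : ℤ))) *
          (qPoch c q (i + 1))⁻¹)) =
        (1 - c)⁻¹ * (qFacInv q ((s - 1) - i) *
          (q ^ (((r : ℤ) - i) * ((s - 1) - i)) * (qPoch (c * q) q i)⁻¹)) := by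
      intro i
      have e1 : s - ((i + 1 : ℕ) : ℤ) = (s - 1) - i := by push_cast; ring
      have e2 : ((r + 1 : ℕ) : ℤ) - ((i + 1 : ℕ) : ℤ) = r - i := by push_cast; ring
      rw [e1, e2, qPoch_succ', mul_inv]
      ring
    rw [binomSum_succ' hq hq0, binomSum_congr q r e0, binomSum_congr q r e, binomSum_mul_left,
      binomSum_mul_left, ih c s hc, ih _ _ hc']
    have e3 : c * q * q ^ (s - 1) = c * q ^ s := by
      rw [mul_assoc, ← zpow_one_add₀ hq0]; congr 2; ring
    rw [e3, qFacInv_pred hq, qFacInv_natCast_succ hq, qPoch_succ (c * q ^ s)]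
    have h5 := qPoch_succ' c q r
    have h6 : 1 - c * q ^ r ≠ 0 := sub_ne_zero.2 (hc r).symm
    have h7 : (qPoch c q r)⁻¹ = (1 - c * q ^ r) * (qPoch c q (r + 1))⁻¹ := by
      rw [qPoch_succ]; field_simp
    have h8 : (1 - c)⁻¹ * (qPoch (c * q) q r)⁻¹ = (qPoch c q (r + 1))⁻¹ := by
      rw [h5, mul_inv]
    linear_combination (1 - q ^ (r + 1)) * qFacInv q ((r + 1 : ℕ) : ℤ) * qFacInv q s *
      qPoch (c * q ^ s) q r * (q ^ s * h7 + (1 - q ^ s) * h8)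

end Vandermonde

section Eigen

/-- The transfer operator
`f ↦ ∑_{r ≤ N, s ≤ M} u^r v^s q^{r²-rs+s²} f(r,s) / ((q)_{N-r} (q)_{M-s})`. -/
def transfer (q u v : ℂ) (f : ℕ → ℕ → ℂ) (N M : ℕ) : ℂ :=
  ∑ r ∈ Finset.range (N + 1), ∑ s ∈ Finset.range (M + 1),
    u ^ r * v ^ s * q ^ ((r : ℤ) ^ 2 - r * s + (s : ℤ) ^ 2) *
      qFacInv q ((N : ℤ) - r) * qFacInv q ((M : ℤ) - s) * f r s

theorem sum_range_shift {N n : ℕ} (h : n ≤ N) {f : ℕ → ℂ} (hf : ∀ r < n, f r = 0) :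
    ∑ r ∈ Finset.range (N + 1), f r = ∑ t ∈ Finset.range (N - n + 1), f (n + t) := by
  obtain ⟨d, rfl⟩ := Nat.exists_eq_add_of_le h
  rw [show n + d + 1 = n + (d + 1) by ring, Finset.sum_range_add,
    Finset.sum_eq_zero fun r hr => hf r (Finset.mem_range.1 hr), zero_add,
    show n + d - n + 1 = d + 1 by omega]

theorem sum_qFacInv_shift {q : ℂ} (hq : ‖q‖ < 1) (hq0 : q ≠ 0) {U : ℂ}
    (hU : ∀ j : ℕ, U * q * q ^ j ≠ 1) (N j : ℕ) :
    ∑ r ∈ Finset.range (N + 1), U ^ r * q ^ ((r : ℤ) ^ 2 - r * j) * qFacInv q ((N : ℤ) - r) *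
      qFacInv q ((r : ℤ) - j) * (qPoch (U * q) q r)⁻¹ =
    U ^ j * qFacInv q ((N : ℤ) - j) * (qPoch (U * q) q N)⁻¹ := by
  rcases lt_or_ge N j with h | h
  · rw [qFacInv_of_neg q (show (N : ℤ) - j < 0 by omega), Finset.sum_eq_zero]
    · simp
    · intro r hr
      rw [Finset.mem_range] at hr
      rw [qFacInv_of_neg q (show (r : ℤ) - j < 0 by omega)]
      simp
  · rw [sum_range_shift h (fun r hr => by
      rw [qFacInv_of_neg q (show (r : ℤ) - j < 0 by omega)]; simp)]
    have hc : ∀ i : ℕ, U * q * q ^ j * q ^ i ≠ 1 := fun i => by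
      rw [mul_assoc, ← pow_add]; exact hU _
    have key := binomSum_cauchy hq hq0 (N - j) (U * q * q ^ j) hc
    have e : (((N - j : ℕ) : ℤ)) = (N : ℤ) - j := by push_cast [h]; ring
    have e2 := qPoch_add (U * q) q j (N - j)
    rw [show j + (N - j) = N by omega] at e2
    rw [e2, mul_inv, ← e]
    have : ∀ t : ℕ, U ^ (j + t) * q ^ (((j + t : ℕ) : ℤ) ^ 2 - ((j + t : ℕ) : ℤ) * j) *
        qFacInv q ((N : ℤ) - ((j + t : ℕ) : ℤ)) * qFacInv q (((j + t : ℕ) : ℤ) - j) *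
        (qPoch (U * q) q (j + t))⁻¹ = U ^ j * (qPoch (U * q) q j)⁻¹ *
        (qFacInv q (((N - j : ℕ) : ℤ) - t) * qFacInv q t *
          ((U * q * q ^ j) ^ t * q ^ ((t : ℤ) ^ 2 - t) * (qPoch (U * q * q ^ j) q t)⁻¹)) := by
      intro t
      rw [qPoch_add, mul_inv, e,
        show (N : ℤ) - ((j + t : ℕ) : ℤ) = N - j - t by push_cast; ring,
        show ((j + t : ℕ) : ℤ) - j = t by push_cast; ring]
      have e3 : q ^ (((j + t : ℕ) : ℤ) ^ 2 - ((j + t : ℕ) : ℤ) * j) =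
          (q * q ^ j) ^ t * q ^ ((t : ℤ) ^ 2 - t) := by
        rw [← pow_succ', ← pow_mul, ← zpow_natCast, ← zpow_add₀ hq0]
        congr 1; push_cast; ring
      rw [e3, mul_assoc U, mul_pow U, pow_add]
      ring
    rw [Finset.sum_congr rfl fun t _ => this t, ← Finset.mul_sum]
    rw [binomSum] at key
    rw [key]
    ring

/-- The normalised eigenfunction of `transfer`. -/
def baseKer (q U V : ℂ) (r s : ℕ) : ℂ :=
  qFacInv q r * qFacInv q s * qPoch (U * V * q) q (r + s) *
    ((qPoch (U * q) q r)⁻¹ * (qPoch (U * V * q) q r)⁻¹ *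
     (qPoch (V * q) q s)⁻¹ * (qPoch (U * V * q) q s)⁻¹)

theorem baseKer_eq_sum {q : ℂ} (hq : ‖q‖ < 1) (hq0 : q ≠ 0) {U V : ℂ}
    (hUV : ∀ j : ℕ, U * V * q * q ^ j ≠ 1) {N r : ℕ} (h : r ≤ N) (s : ℕ) :
    baseKer q U V r s = (qPoch (U * q) q r)⁻¹ * (qPoch (V * q) q s)⁻¹ *
      ∑ j ∈ Finset.range (N + 1), qFacInv q ((r : ℤ) - j) * qFacInv q j *
        (qFacInv q ((s : ℤ) - j) * (q ^ (((r : ℤ) - j) * (s - j)) *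
          (qPoch (U * V * q) q j)⁻¹)) := by
  have h1 := qPoch_add (U * V * q) q s r
  have h2 := qPoch_ne_zero hUV s
  rw [binomSum_extend h (fun j : ℕ => (qFacInv q ((s : ℤ) - j) * (q ^ (((r : ℤ) - j) * (s - j)) *
          (qPoch (U * V * q) q j)⁻¹))),
    binomSum_vandermonde' hq hq0 r _ _ hUV, baseKer, zpow_natCast, add_comm r s, h1]
  field_simp

theorem transfer_baseKer {q : ℂ} (hq : ‖q‖ < 1) (hq0 : q ≠ 0) {U V : ℂ}
    (hU : ∀ j : ℕ, U * q * q ^ j ≠ 1) (hV : ∀ j : ℕ, V * q * q ^ j ≠ 1)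
    (hUV : ∀ j : ℕ, U * V * q * q ^ j ≠ 1) (N M : ℕ) :
    transfer q U V (baseKer q U V) N M = baseKer q U V N M := by
  have h1 : transfer q U V (baseKer q U V) N M = ∑ j ∈ Finset.range (N + 1),
      qFacInv q j * q ^ ((j : ℤ) ^ 2) * (qPoch (U * V * q) q j)⁻¹ *
      ((∑ r ∈ Finset.range (N + 1), U ^ r * q ^ ((r : ℤ) ^ 2 - r * j) *
          qFacInv q ((N : ℤ) - r) * qFacInv q ((r : ℤ) - j) * (qPoch (U * q) q r)⁻¹) *
       (∑ s ∈ Finset.range (M + 1), V ^ s * q ^ ((s : ℤ) ^ 2 - s * j) *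
          qFacInv q ((M : ℤ) - s) * qFacInv q ((s : ℤ) - j) * (qPoch (V * q) q s)⁻¹)) := by
    simp only [Finset.sum_mul_sum]
    simp only [Finset.mul_sum]
    rw [transfer]
    symm
    rw [Finset.sum_comm]
    refine Finset.sum_congr rfl fun r hr => ?_
    rw [Finset.sum_comm]
    refine Finset.sum_congr rfl fun s _ => ?_
    symm
    rw [baseKer_eq_sum hq hq0 hUV (Nat.lt_succ_iff.1 (Finset.mem_range.1 hr)), Finset.mul_sum,
      Finset.mul_sum]
    refine Finset.sum_congr rfl fun j _ => ?_
    have e : q ^ ((r : ℤ) ^ 2 - r * s + (s : ℤ) ^ 2) * q ^ (((r : ℤ) - j) * (s - j)) =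
        q ^ ((j : ℤ) ^ 2) * q ^ ((r : ℤ) ^ 2 - r * j) * q ^ ((s : ℤ) ^ 2 - s * j) := by
      simp only [← zpow_add₀ hq0]; congr 1; ring
    linear_combination (U ^ r * V ^ s * qFacInv q ((N : ℤ) - r) * qFacInv q ((M : ℤ) - s) *
      (qPoch (U * q) q r)⁻¹ * (qPoch (V * q) q s)⁻¹ * (qFacInv q ((r : ℤ) - j) * qFacInv q j *
        qFacInv q ((s : ℤ) - j) * (qPoch (U * V * q) q j)⁻¹)) * e
  rw [h1]
  simp only [sum_qFacInv_shift hq hq0 hU, sum_qFacInv_shift hq hq0 hV]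
  have h2 := binomSum_vandermonde hq hq0 N (U * V * q) M hUV
  rw [baseKer]
  have h3 := qPoch_add (U * V * q) q M N
  have h4 := qPoch_ne_zero hUV M
  have h5 : qPoch (U * V * q * q ^ (M : ℤ)) q N =
      qPoch (U * V * q) q (N + M) * (qPoch (U * V * q) q M)⁻¹ := by
    rw [zpow_natCast, add_comm N M, h3]; field_simp
  rw [h5] at h2
  have h6 : qFacInv q N * qFacInv q M * qPoch (U * V * q) q (N + M) *
    ((qPoch (U * q) q N)⁻¹ * (qPoch (U * V * q) q N)⁻¹ *
     (qPoch (V * q) q M)⁻¹ * (qPoch (U * V * q) q M)⁻¹) =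
     (qPoch (U * q) q N)⁻¹ * (qPoch (V * q) q M)⁻¹ * (qFacInv q N * qFacInv q M *
      (qPoch (U * V * q) q (N + M) * (qPoch (U * V * q) q M)⁻¹) * (qPoch (U * V * q) q N)⁻¹) := by
    ring
  rw [h6, ← h2, binomSum, Finset.mul_sum]
  refine Finset.sum_congr rfl fun j _ => ?_
  have e : (U * V * q) ^ j * q ^ ((j : ℤ) ^ 2 - j) = U ^ j * V ^ j * q ^ ((j : ℤ) ^ 2) := by
    rw [mul_pow, mul_pow, mul_assoc (U ^ j * V ^ j), ← zpow_natCast q j, ← zpow_add₀ hq0]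
    congr 2; ring
  linear_combination -(qFacInv q j * (qPoch (U * V * q) q j)⁻¹ * qFacInv q ((N : ℤ) - j) *
    (qPoch (U * q) q N)⁻¹ * qFacInv q ((M : ℤ) - j) * (qPoch (V * q) q M)⁻¹) * e

end Eigen

section Kernel

/-- Nonzero `x₁, x₂, x₃` whose ratios are not integral powers of `q`. -/
structure Generic (q x₁ x₂ x₃ : ℂ) : Prop where
  ne₁ : x₁ ≠ 0
  ne₂ : x₂ ≠ 0
  ne₃ : x₃ ≠ 0
  gen₁₂ : ∀ n : ℤ, x₁ ≠ x₂ * q ^ n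
  gen₂₃ : ∀ n : ℤ, x₂ ≠ x₃ * q ^ n
  gen₁₃ : ∀ n : ℤ, x₁ ≠ x₃ * q ^ n

theorem Generic.point {q x₁ x₂ x₃ : ℂ} (h : Generic q x₁ x₂ x₃) (hq0 : q ≠ 0) (i j l : ℤ) :
    Generic q (x₁ * q ^ i) (x₂ * q ^ j) (x₃ * q ^ l) := by
  have key : ∀ {y z : ℂ} (i j : ℤ), (∀ n : ℤ, y ≠ z * q ^ n) →
      ∀ n : ℤ, y * q ^ i ≠ z * q ^ j * q ^ n := by
    intro y z i j h n e
    refine h (j + n - i) ?_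
    rw [zpow_sub₀ hq0, zpow_add₀ hq0, ← mul_div_assoc, ← mul_assoc, ← e]
    field_simp
  exact ⟨mul_ne_zero h.ne₁ (zpow_ne_zero _ hq0), mul_ne_zero h.ne₂ (zpow_ne_zero _ hq0),
    mul_ne_zero h.ne₃ (zpow_ne_zero _ hq0), key i j h.gen₁₂, key j l h.gen₂₃, key i l h.gen₁₃⟩

theorem div_mul_zpow_ne_one {q y z : ℂ} (hq0 : q ≠ 0) (hz : z ≠ 0)
    (h : ∀ n : ℤ, y ≠ z * q ^ n) (n : ℤ) : y / z * q ^ n ≠ 1 := by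
  intro e
  refine h (-n) ?_
  rw [zpow_neg]
  field_simp at e ⊢
  exact e

/-- The Cauchy-type kernel `∏ᵢ (qX/Zᵢ)_∞ (qZᵢW)_∞ / (qXW)_∞`. -/
def kappa (q Z₁ Z₂ Z₃ X W : ℂ) : ℂ :=
  qPochInf (q * X / Z₁) q * qPochInf (q * X / Z₂) q * qPochInf (q * X / Z₃) q *
    (qPochInf (q * Z₁ * W) q * qPochInf (q * Z₂ * W) q * qPochInf (q * Z₃ * W) q) /
    qPochInf (q * X * W) q

/-- The kernel at the lattice point `Z = (x₁ q^n, x₂ q^{m-n}, x₃ q^{-m})`. -/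
def stKer (q x₁ x₂ x₃ : ℂ) (n m r s : ℕ) : ℂ :=
  kappa q (x₁ * q ^ (n : ℤ)) (x₂ * q ^ ((m : ℤ) - n)) (x₃ * q ^ (-(m : ℤ)))
    (x₁ * q ^ (r : ℤ)) (q ^ (s : ℤ) / x₃)

theorem qPochInf_mul_pow {q : ℂ} (hq : ‖q‖ < 1) {a : ℂ} (h : ∀ j : ℕ, a * q ^ j ≠ 1) (n : ℕ) :
    qPochInf (a * q ^ n) q = qPochInf a q * (qPoch a q n)⁻¹ := by
  rw [qPochInf_eq_mul hq a n]
  have := qPoch_ne_zero h n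
  field_simp

theorem kappa_eq_baseKer {q : ℂ} (hq : ‖q‖ < 1) (hq0 : q ≠ 0) {Z₁ Z₂ Z₃ : ℂ}
    (h : Generic q Z₁ Z₂ Z₃) (r s : ℕ) :
    kappa q Z₁ Z₂ Z₃ (Z₁ * q ^ (r : ℤ)) (q ^ (s : ℤ) / Z₃) =
      qPochInf q q ^ 2 * qPochInf (Z₁ / Z₂ * q) q * qPochInf (Z₂ / Z₃ * q) q *
        qPochInf (Z₁ / Z₂ * (Z₂ / Z₃) * q) q * baseKer q (Z₁ / Z₂) (Z₂ / Z₃) r s := by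
  obtain ⟨h1, h2, h3, g12, g23, g13⟩ := h
  have hU : ∀ j : ℕ, Z₁ / Z₂ * q * q ^ j ≠ 1 := fun j => by
    rw [mul_assoc, ← pow_succ', ← zpow_natCast]; exact div_mul_zpow_ne_one hq0 h2 g12 _
  have hV : ∀ j : ℕ, Z₂ / Z₃ * q * q ^ j ≠ 1 := fun j => by
    rw [mul_assoc, ← pow_succ', ← zpow_natCast]; exact div_mul_zpow_ne_one hq0 h3 g23 _
  have hUV' : Z₁ / Z₂ * (Z₂ / Z₃) = Z₁ / Z₃ := by field_simp
  have hUV : ∀ j : ℕ, Z₁ / Z₂ * (Z₂ / Z₃) * q * q ^ j ≠ 1 := fun j => by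
    rw [hUV', mul_assoc, ← pow_succ', ← zpow_natCast]; exact div_mul_zpow_ne_one hq0 h3 g13 _
  have e1 : q * (Z₁ * q ^ (r : ℤ)) / Z₁ = q * q ^ (r : ℤ) := by field_simp
  have e2 : q * (Z₁ * q ^ (r : ℤ)) / Z₂ = Z₁ / Z₂ * q * q ^ r := by
    rw [zpow_natCast]; field_simp
  have e3 : q * (Z₁ * q ^ (r : ℤ)) / Z₃ = Z₁ / Z₂ * (Z₂ / Z₃) * q * q ^ r := by
    rw [zpow_natCast]; field_simp
  have e4 : q * Z₁ * (q ^ (s : ℤ) / Z₃) = Z₁ / Z₂ * (Z₂ / Z₃) * q * q ^ s := by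
    rw [zpow_natCast]; field_simp
  have e5 : q * Z₂ * (q ^ (s : ℤ) / Z₃) = Z₂ / Z₃ * q * q ^ s := by
    rw [zpow_natCast]; field_simp
  have e6 : q * Z₃ * (q ^ (s : ℤ) / Z₃) = q * q ^ (s : ℤ) := by field_simp
  have e7 : q * (Z₁ * q ^ (r : ℤ)) * (q ^ (s : ℤ) / Z₃) =
      Z₁ / Z₂ * (Z₂ / Z₃) * q * q ^ (r + s) := by
    rw [pow_add, zpow_natCast, zpow_natCast]; field_simp
  rw [kappa, e1, e2, e3, e4, e5, e6, e7, qFacInv_eq_qPochInf hq hq0, qFacInv_eq_qPochInf hq hq0,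
    qPochInf_mul_pow hq hU, qPochInf_mul_pow hq hUV, qPochInf_mul_pow hq hUV,
    qPochInf_mul_pow hq hUV, qPochInf_mul_pow hq hV, baseKer]
  have n1 := qPochInf_ne_zero hq hUV
  have n2 := qPoch_ne_zero hUV
  have n3 := n2 (r + s)
  generalize qPoch (Z₁ / Z₂ * (Z₂ / Z₃) * q) q (r + s) = A at *
  generalize qPochInf (Z₁ / Z₂ * (Z₂ / Z₃) * q) q = B at *
  field_simp

theorem stKer_add {q : ℂ} (hq : ‖q‖ < 1) (hq0 : q ≠ 0) {x₁ x₂ x₃ : ℂ}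
    (h : Generic q x₁ x₂ x₃) (n m : ℕ) : ∃ C : ℂ, ∀ r s : ℕ,
    stKer q x₁ x₂ x₃ n m (n + r) (m + s) =
      C * baseKer q (x₁ / x₂ * q ^ (2 * (n : ℤ) - m)) (x₂ / x₃ * q ^ (2 * (m : ℤ) - n)) r s := by
  have hp := h.point hq0 n ((m : ℤ) - n) (-(m : ℤ))
  have eU : x₁ * q ^ (n : ℤ) / (x₂ * q ^ ((m : ℤ) - n)) = x₁ / x₂ * q ^ (2 * (n : ℤ) - m) := by
    rw [show 2 * (n : ℤ) - m = n - (m - n) by ring, zpow_sub₀ hq0 n]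
    rw [mul_div_mul_comm]
  have eV : x₂ * q ^ ((m : ℤ) - n) / (x₃ * q ^ (-(m : ℤ))) = x₂ / x₃ * q ^ (2 * (m : ℤ) - n) := by
    rw [show 2 * (m : ℤ) - n = (m - n) - -m by ring, zpow_sub₀ hq0 ((m : ℤ) - n)]
    rw [mul_div_mul_comm]
  have h3 := h.ne₃
  rw [← eU, ← eV]
  refine ⟨_, fun r s => Eq.trans ?_ (kappa_eq_baseKer hq hq0 hp r s)⟩
  rw [stKer]
  congr 1
  · rw [mul_assoc, ← zpow_add₀ hq0]; push_cast; rfl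
  · rw [zpow_neg]; push_cast; rw [zpow_add₀ hq0]; field_simp

theorem stKer_eq_zero {q : ℂ} (hq : ‖q‖ < 1) (hq0 : q ≠ 0) {x₁ x₂ x₃ : ℂ}
    (h : Generic q x₁ x₂ x₃) {n m r s : ℕ} (hrs : r < n ∨ s < m) :
    stKer q x₁ x₂ x₃ n m r s = 0 := by
  have h1 := h.ne₁
  have h3 := h.ne₃
  rw [stKer, kappa]
  rcases hrs with hr | hr
  · have : q * (x₁ * q ^ (r : ℤ)) / (x₁ * q ^ (n : ℤ)) = q * q ^ ((r : ℤ) - n) := by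
      rw [zpow_sub₀ hq0]; field_simp
    rw [this, qFacInv_eq_qPochInf hq hq0, qFacInv_of_neg q (by omega)]
    simp
  · have : q * (x₃ * q ^ (-(m : ℤ))) * (q ^ (s : ℤ) / x₃) = q * q ^ ((s : ℤ) - m) := by
      rw [zpow_sub₀ hq0, zpow_neg]; field_simp
    rw [this, qFacInv_eq_qPochInf hq hq0, qFacInv_of_neg q (by omega)]
    simp

/-- The eigenvalue of the transfer operator. -/
def weight (q x₁ x₂ x₃ : ℂ) (n m : ℕ) : ℂ :=
  (x₁ / x₂) ^ n * (x₂ / x₃) ^ m * q ^ ((n : ℤ) ^ 2 - n * m + (m : ℤ) ^ 2)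

theorem transfer_stKer {q : ℂ} (hq : ‖q‖ < 1) (hq0 : q ≠ 0) {x₁ x₂ x₃ : ℂ}
    (h : Generic q x₁ x₂ x₃) (n m N M : ℕ) :
    transfer q (x₁ / x₂) (x₂ / x₃) (stKer q x₁ x₂ x₃ n m) N M =
      weight q x₁ x₂ x₃ n m * stKer q x₁ x₂ x₃ n m N M := by
  by_cases hc : n ≤ N ∧ m ≤ M
  swap
  · have hc' : N < n ∨ M < m := by omega
    rw [stKer_eq_zero hq hq0 h hc', transfer, mul_zero]
    refine Finset.sum_eq_zero fun r hr => Finset.sum_eq_zero fun s hs => ?_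
    rw [Finset.mem_range] at hr hs
    rw [stKer_eq_zero hq hq0 h (by omega), mul_zero]
  obtain ⟨hn, hm⟩ := hc
  obtain ⟨C, hC⟩ := stKer_add hq hq0 h n m
  have hp := h.point hq0 n ((m : ℤ) - n) (-(m : ℤ))
  set U := x₁ / x₂ * q ^ (2 * (n : ℤ) - m) with hU
  set V := x₂ / x₃ * q ^ (2 * (m : ℤ) - n) with hV
  have gU : ∀ j : ℕ, U * q * q ^ j ≠ 1 := fun j => by
    rw [mul_assoc, ← pow_succ', ← zpow_natCast, hU, mul_assoc, ← zpow_add₀ hq0]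
    exact div_mul_zpow_ne_one hq0 h.ne₂ h.gen₁₂ _
  have gV : ∀ j : ℕ, V * q * q ^ j ≠ 1 := fun j => by
    rw [mul_assoc, ← pow_succ', ← zpow_natCast, hV, mul_assoc, ← zpow_add₀ hq0]
    exact div_mul_zpow_ne_one hq0 h.ne₃ h.gen₂₃ _
  have h2 := h.ne₂
  have gUV : ∀ j : ℕ, U * V * q * q ^ j ≠ 1 := fun j => by
    have e : U * V = x₁ / x₃ * (q ^ (2 * (n : ℤ) - m) * q ^ (2 * (m : ℤ) - n)) := by
      rw [hU, hV]; field_simp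
    rw [mul_assoc, ← pow_succ', ← zpow_natCast, e, mul_assoc, ← zpow_add₀ hq0, ← zpow_add₀ hq0]
    exact div_mul_zpow_ne_one hq0 h.ne₃ h.gen₁₃ _
  have key := transfer_baseKer hq hq0 gU gV gUV (N - n) (M - m)
  have hk := hC (N - n) (M - m)
  rw [show n + (N - n) = N by omega, show m + (M - m) = M by omega, ← key] at hk
  rw [hk, transfer, transfer, sum_range_shift hn (fun r hr => Finset.sum_eq_zero fun s _ => by
    rw [stKer_eq_zero hq hq0 h (Or.inl hr), mul_zero])]
  simp only [Finset.mul_sum]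
  refine Finset.sum_congr rfl fun r _ => ?_
  rw [sum_range_shift hm (fun s hs => by rw [stKer_eq_zero hq hq0 h (Or.inr hs), mul_zero])]
  refine Finset.sum_congr rfl fun s _ => ?_
  rw [hC, weight, show (N : ℤ) - ((n + r : ℕ) : ℤ) = ((N - n : ℕ) : ℤ) - r by omega,
    show (M : ℤ) - ((m + s : ℕ) : ℤ) = ((M - m : ℕ) : ℤ) - s by omega, pow_add, pow_add, hU, hV,
    mul_pow, mul_pow]
  have e : q ^ (((n + r : ℕ) : ℤ) ^ 2 - ((n + r : ℕ) : ℤ) * ((m + s : ℕ) : ℤ) +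
      ((m + s : ℕ) : ℤ) ^ 2) = q ^ ((n : ℤ) ^ 2 - n * m + (m : ℤ) ^ 2) *
        ((q ^ (2 * (n : ℤ) - m)) ^ r * (q ^ (2 * (m : ℤ) - n)) ^ s *
        q ^ ((r : ℤ) ^ 2 - r * s + (s : ℤ) ^ 2)) := by
    rw [← zpow_natCast (q ^ (2 * (n : ℤ) - m)), ← zpow_natCast (q ^ (2 * (m : ℤ) - n)),
      ← zpow_mul, ← zpow_mul]
    simp only [← zpow_add₀ hq0]; congr 1; push_cast; ring
  rw [e]
  ring

end Kernel

section ChangeOfBasis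

theorem kappa_lower {q : ℂ} (hq : ‖q‖ < 1) (hq0 : q ≠ 0) {Z₁ Z₂ Z₃ X W : ℂ}
    (h1 : Z₁ ≠ 0) (h2 : Z₂ ≠ 0) (h3 : Z₃ ≠ 0) (h12 : Z₁ ≠ Z₂) (h13 : Z₁ ≠ Z₃) (h23 : Z₂ ≠ Z₃)
    (hXW : X * W ≠ 1) :
    kappa q Z₁ Z₂ Z₃ X W =
      ((1 - Z₁ / Z₂) * (1 - Z₁ / Z₃))⁻¹ * kappa q (Z₁ / q) Z₂ Z₃ (X / q) W +
      ((1 - Z₂ / Z₁) * (1 - Z₂ / Z₃))⁻¹ * kappa q Z₁ (Z₂ / q) Z₃ (X / q) W +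
      ((1 - Z₃ / Z₁) * (1 - Z₃ / Z₂))⁻¹ * kappa q Z₁ Z₂ (Z₃ / q) (X / q) W := by
  have s : ∀ Z, qPochInf (q * (X / q) / Z) q = (1 - X / Z) * qPochInf (q * X / Z) q := fun Z => by
    rw [mul_div_cancel₀ X hq0, qPochInf_step hq, mul_div_assoc]
  have s' : ∀ Z, q * (X / q) / (Z / q) = q * X / Z := fun Z => by field_simp
  have t : ∀ Z, qPochInf (q * (Z / q) * W) q = (1 - Z * W) * qPochInf (q * Z * W) q := fun Z => by
    rw [mul_div_cancel₀ Z hq0, qPochInf_step hq, mul_assoc]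
  simp only [kappa, s, s', t]
  have n1 : 1 - X * W ≠ 0 := sub_ne_zero.2 hXW.symm
  have d12 : Z₁ - Z₂ ≠ 0 := sub_ne_zero.2 h12
  have d13 : Z₁ - Z₃ ≠ 0 := sub_ne_zero.2 h13
  have d23 : Z₂ - Z₃ ≠ 0 := sub_ne_zero.2 h23
  have d21 : Z₂ - Z₁ ≠ 0 := sub_ne_zero.2 h12.symm
  have d31 : Z₃ - Z₁ ≠ 0 := sub_ne_zero.2 h13.symm
  have d32 : Z₃ - Z₂ ≠ 0 := sub_ne_zero.2 h23.symm
  have L : (1 - X * W)⁻¹ * (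
      ((1 - Z₁ / Z₂) * (1 - Z₁ / Z₃))⁻¹ * ((1 - X / Z₂) * (1 - X / Z₃) * (1 - Z₁ * W)) +
      ((1 - Z₂ / Z₁) * (1 - Z₂ / Z₃))⁻¹ * ((1 - X / Z₁) * (1 - X / Z₃) * (1 - Z₂ * W)) +
      ((1 - Z₃ / Z₁) * (1 - Z₃ / Z₂))⁻¹ * ((1 - X / Z₁) * (1 - X / Z₂) * (1 - Z₃ * W))) = 1 := by
    rw [inv_mul_eq_one₀ n1, one_sub_div h2, one_sub_div h3, one_sub_div h1, one_sub_div h3,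
      one_sub_div h1, one_sub_div h2, one_sub_div h1, one_sub_div h2, one_sub_div h3]
    rw [← neg_sub Z₁ Z₂, ← neg_sub Z₁ Z₃, ← neg_sub Z₂ Z₃]
    field_simp
    ring
  generalize ((1 - Z₁ / Z₂) * (1 - Z₁ / Z₃))⁻¹ = c₁ at L ⊢
  generalize ((1 - Z₂ / Z₁) * (1 - Z₂ / Z₃))⁻¹ = c₂ at L ⊢
  generalize ((1 - Z₃ / Z₁) * (1 - Z₃ / Z₂))⁻¹ = c₃ at L ⊢
  simp only [div_eq_mul_inv _ ((1 - X * W) * _), mul_inv (1 - X * W)]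
  linear_combination -(qPochInf (q * X / Z₁) q * qPochInf (q * X / Z₂) q *
    qPochInf (q * X / Z₃) q * (qPochInf (q * Z₁ * W) q * qPochInf (q * Z₂ * W) q *
    qPochInf (q * Z₃ * W) q) * (qPochInf (q * X * W) q)⁻¹) * L

theorem kappa_inv (q Z₁ Z₂ Z₃ X W : ℂ) :
    kappa q Z₁⁻¹ Z₂⁻¹ Z₃⁻¹ W X = kappa q Z₁ Z₂ Z₃ X W := by
  simp only [kappa, div_inv_eq_mul]
  rw [show q * W * Z₁ = q * Z₁ * W by ring, show q * W * Z₂ = q * Z₂ * W by ring,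
    show q * W * Z₃ = q * Z₃ * W by ring, show q * W * X = q * X * W by ring,
    show q * Z₁⁻¹ * X = q * X / Z₁ by ring, show q * Z₂⁻¹ * X = q * X / Z₂ by ring,
    show q * Z₃⁻¹ * X = q * X / Z₃ by ring]
  ring

theorem kappa_raise {q : ℂ} (hq : ‖q‖ < 1) (hq0 : q ≠ 0) {Z₁ Z₂ Z₃ X W : ℂ}
    (h1 : Z₁ ≠ 0) (h2 : Z₂ ≠ 0) (h3 : Z₃ ≠ 0) (h12 : Z₁ ≠ Z₂) (h13 : Z₁ ≠ Z₃) (h23 : Z₂ ≠ Z₃)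
    (hXW : X * W ≠ 1) :
    kappa q Z₁ Z₂ Z₃ X W =
      ((1 - Z₂ / Z₁) * (1 - Z₃ / Z₁))⁻¹ * kappa q (Z₁ * q) Z₂ Z₃ X (W / q) +
      ((1 - Z₁ / Z₂) * (1 - Z₃ / Z₂))⁻¹ * kappa q Z₁ (Z₂ * q) Z₃ X (W / q) +
      ((1 - Z₁ / Z₃) * (1 - Z₂ / Z₃))⁻¹ * kappa q Z₁ Z₂ (Z₃ * q) X (W / q) := by
  have key := kappa_lower hq hq0 (inv_ne_zero h1) (inv_ne_zero h2) (inv_ne_zero h3)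
    (inv_injective.ne h12) (inv_injective.ne h13) (inv_injective.ne h23) (X := W) (W := X)
    (by rwa [mul_comm])
  have e : ∀ Z : ℂ, Z⁻¹ / q = (Z * q)⁻¹ := fun Z => by rw [mul_inv, div_eq_mul_inv]
  have e2 : ∀ Z Y : ℂ, Z⁻¹ / Y⁻¹ = Y / Z := fun Z Y => by rw [div_inv_eq_mul]; ring
  simp only [e, e2, kappa_inv] at key
  exact key

end ChangeOfBasis

section Residue

open Filter Topology

variable {σ : Type*} [DecidableEq σ]

/-- Summand of the residue-type identities `sum_residueTerm_erase` and `sum_residueTerm`. -/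
def residueTerm (z : σ → ℂ) (S : Finset σ) (c : ℂ) (b p : σ) : ℂ :=
  (z b * z p) ^ (S.card - 3) * (z b - z p)⁻¹ *
    ∏ r ∈ (S.erase b).erase p, ((z p - z r) * (z b - z r) * (z b * z p * z r - c))⁻¹

theorem residueTerm_swap (z : σ → ℂ) (S : Finset σ) (c : ℂ) (b p : σ) :
    residueTerm z S c b p = -residueTerm z S c p b := by
  rw [residueTerm, residueTerm, ← neg_sub (z p) (z b), Finset.erase_right_comm, mul_comm (z b),
    inv_neg]
  simp only [mul_comm (z b - z _)]
  ring

theorem sum_residueTerm_erase {z : σ → ℂ} {S : Finset σ} {c : ℂ} {b : σ} (hb : b ∈ S)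
    (hz : Set.InjOn z S) (hz0 : ∀ i ∈ S, z i ≠ 0) (hS : 3 ≤ S.card)
    (hc : ∀ p ∈ S.erase b, ∀ r ∈ S.erase b, p ≠ r → z b * z p * z r ≠ c) :
    ∑ p ∈ S.erase b, residueTerm z S c b p = 0 := by
  set w : σ → ℂ := fun p => z p + c / (z b * z p) with hw
  have hbz := hz0 b hb
  have hwd : ∀ p ∈ S.erase b, ∀ r ∈ S.erase b,
      w p - w r = (z p - z r) * (z b * z p * z r - c) / (z b * z p * z r) := by
    intro p hp r hr
    have h1 := hz0 p (Finset.mem_of_mem_erase hp)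
    have h2 := hz0 r (Finset.mem_of_mem_erase hr)
    simp only [hw]
    field_simp
    ring
  have hzne : ∀ p ∈ S, ∀ r ∈ S, p ≠ r → z p - z r ≠ 0 := fun p hp r hr h =>
    sub_ne_zero.2 fun e => h (hz hp hr e)
  have hinj : Set.InjOn w (S.erase b : Finset σ) := by
    intro p hp r hr e
    by_contra hne
    rw [Finset.mem_coe] at hp hr
    have h0 := hwd p hp r hr
    have e' : w p = w r := e
    rw [e', sub_self, eq_comm, div_eq_zero_iff] at h0
    have hp' := Finset.mem_of_mem_erase hp
    have hr' := Finset.mem_of_mem_erase hr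
    rcases h0 with h0 | h0
    · rcases mul_eq_zero.1 h0 with h0 | h0
      · exact hzne p hp' r hr' hne h0
      · exact hc p hp r hr hne (sub_eq_zero.1 h0)
    · exact mul_ne_zero (mul_ne_zero hbz (hz0 p hp')) (hz0 r hr') h0
  have hcard : (S.erase b).card = S.card - 1 := Finset.card_erase_of_mem hb
  have key := Lagrange.coeff_eq_sum hinj (P := 1)
    (by rw [Polynomial.degree_one, hcard]; exact_mod_cast (by omega : 0 < S.card - 1))
  rw [Polynomial.coeff_one, if_neg (by omega)] at key
  have hterm : ∀ p ∈ S.erase b, residueTerm z S c b p =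
      ((∏ r ∈ S, z r) * ∏ r ∈ S.erase b, (z b - z r))⁻¹ *
        (Polynomial.eval (w p) 1 / ∏ r ∈ (S.erase b).erase p, (w p - w r)) := by
    intro p hp
    have hpS := Finset.mem_of_mem_erase hp
    have hpz := hz0 p hpS
    rw [← Finset.mul_prod_erase _ _ hb, ← Finset.mul_prod_erase _ _ hp,
      ← Finset.mul_prod_erase (S.erase b) (fun r => z b - z r) hp,
      Finset.prod_congr rfl fun r hr => hwd p hp r (Finset.mem_of_mem_erase hr),
      Finset.prod_div_distrib, Finset.prod_mul_distrib (f := fun r => z b * z p),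
      Finset.prod_const, Finset.card_erase_of_mem hp, hcard, residueTerm,
      Finset.prod_inv_distrib, Finset.prod_mul_distrib, Finset.prod_mul_distrib,
      Finset.prod_mul_distrib, Polynomial.eval_one,
      show S.card - 1 - 1 = (S.card - 3) + 1 by omega, pow_succ (z b * z p)]
    have n1 : ∏ r ∈ (S.erase b).erase p, z r ≠ 0 := Finset.prod_ne_zero_iff.2 fun r hr =>
      hz0 r (Finset.mem_of_mem_erase (Finset.mem_of_mem_erase hr))
    generalize ∏ r ∈ (S.erase b).erase p, z r = A at *
    generalize ∏ r ∈ (S.erase b).erase p, (z p - z r) = B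
    generalize ∏ r ∈ (S.erase b).erase p, (z b - z r) = C
    generalize ∏ r ∈ (S.erase b).erase p, (z b * z p * z r - c) = D
    have n2 : (z b * z p) ^ (S.card - 3) ≠ 0 := pow_ne_zero _ (mul_ne_zero hbz hpz)
    generalize (z b * z p) ^ (S.card - 3) = E at *
    generalize z b - z p = F
    rw [one_div_div]
    simp only [mul_inv, div_eq_mul_inv]
    field_simp
  rw [Finset.sum_congr rfl hterm, ← Finset.mul_sum, ← key, mul_zero]

theorem sum_residueTerm_of_generic {z : σ → ℂ} {A B : Finset σ} {c : ℂ} (hAB : Disjoint A B)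
    (hz : Set.InjOn z (A ∪ B : Finset σ)) (hz0 : ∀ i ∈ A ∪ B, z i ≠ 0)
    (hS : 3 ≤ (A ∪ B).card)
    (hc : ∀ b ∈ A ∪ B, ∀ p ∈ A ∪ B, ∀ r ∈ A ∪ B, z b * z p * z r ≠ c) :
    ∑ b ∈ B, ∑ a ∈ A, residueTerm z (A ∪ B) c b a = 0 := by
  have h1 : ∑ b ∈ B, ∑ p ∈ B.erase b, residueTerm z (A ∪ B) c b p = 0 := by
    have h : ∑ b ∈ B, ∑ p ∈ B.erase b, residueTerm z (A ∪ B) c b p =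
        ∑ p ∈ B, ∑ b ∈ B.erase p, residueTerm z (A ∪ B) c b p := by
      refine Finset.sum_comm' fun x y => ?_
      simp only [Finset.mem_erase]
      tauto
    have h' : ∑ p ∈ B, ∑ b ∈ B.erase p, residueTerm z (A ∪ B) c b p =
        -∑ b ∈ B, ∑ p ∈ B.erase b, residueTerm z (A ∪ B) c b p := by
      simp only [← Finset.sum_neg_distrib]
      exact Finset.sum_congr rfl fun p _ => Finset.sum_congr rfl fun b _ => residueTerm_swap ..
    rw [h'] at h
    exact self_eq_neg.1 h
  have h2 : ∑ b ∈ B, ∑ p ∈ (A ∪ B).erase b, residueTerm z (A ∪ B) c b p = 0 := by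
    refine Finset.sum_eq_zero fun b hb => ?_
    have hb' : b ∈ A ∪ B := Finset.mem_union_right _ hb
    exact sum_residueTerm_erase hb' hz hz0 hS fun p hp r hr _ =>
      hc b hb' p (Finset.mem_of_mem_erase hp) r (Finset.mem_of_mem_erase hr)
  rw [← h2, ← add_zero (∑ b ∈ B, ∑ a ∈ A, _), ← h1, ← Finset.sum_add_distrib]
  refine Finset.sum_congr rfl fun b hb => ?_
  have hbA : b ∉ A := Finset.disjoint_right.1 hAB hb
  rw [Finset.erase_union_distrib, Finset.erase_eq_of_notMem hbA, Finset.sum_union]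
  exact hAB.mono_right (Finset.erase_subset _ _)

theorem sum_residueTerm {z : σ → ℂ} {A B : Finset σ} {c : ℂ} (hAB : Disjoint A B)
    (hz : Set.InjOn z (A ∪ B : Finset σ)) (hz0 : ∀ i ∈ A ∪ B, z i ≠ 0)
    (hS : 3 ≤ (A ∪ B).card)
    (hc : ∀ b ∈ B, ∀ a ∈ A, ∀ r ∈ A ∪ B, z b * z a * z r ≠ c) :
    ∑ b ∈ B, ∑ a ∈ A, residueTerm z (A ∪ B) c b a = 0 := by
  have hcont : ContinuousAt (fun t => ∑ b ∈ B, ∑ a ∈ A, residueTerm z (A ∪ B) t b a) c := by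
    refine tendsto_finsetSum _ fun b hb => tendsto_finsetSum _ fun a ha => ?_
    refine Tendsto.mul tendsto_const_nhds (tendsto_finsetProd _ fun r hr => ?_)
    have hr' := Finset.mem_of_mem_erase (Finset.mem_of_mem_erase hr)
    have hne : (z a - z r) * (z b - z r) * (z b * z a * z r - c) ≠ 0 := by
      have hrb : r ≠ b := Finset.ne_of_mem_erase (Finset.mem_of_mem_erase hr)
      have hra : r ≠ a := Finset.ne_of_mem_erase hr
      refine mul_ne_zero (mul_ne_zero ?_ ?_) (sub_ne_zero.2 (hc b hb a ha r hr'))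
      · exact sub_ne_zero.2 fun e => hra (hz hr' (Finset.mem_union_left _ ha) e.symm)
      · exact sub_ne_zero.2 fun e => hrb (hz hr' (Finset.mem_union_right _ hb) e.symm)
    refine Tendsto.inv₀ ?_ hne
    exact (continuous_const.mul (continuous_const.sub continuous_id)).continuousAt
  have hbad : ({t : ℂ | ∀ b ∈ A ∪ B, ∀ p ∈ A ∪ B, ∀ r ∈ A ∪ B, z b * z p * z r ≠ t}) ∈
      𝓝[≠] c := by
    set F : Finset ℂ := (((A ∪ B) ×ˢ (A ∪ B)) ×ˢ (A ∪ B)).image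
      fun x => z x.1.1 * z x.1.2 * z x.2
    have hF : ((F \ {c} : Finset ℂ) : Set ℂ).Finite := Finset.finite_toSet _
    have h1 : ((F \ {c} : Finset ℂ) : Set ℂ)ᶜ ∈ 𝓝 c :=
      hF.isClosed.isOpen_compl.mem_nhds (by simp)
    filter_upwards [mem_nhdsWithin_of_mem_nhds h1, self_mem_nhdsWithin] with t ht1 ht2
    intro b hb p hp r hr e
    apply ht1
    simp only [Finset.coe_sdiff, Finset.coe_singleton, Set.mem_sdiff, Set.mem_singleton_iff]
    refine ⟨?_, ht2⟩
    exact Finset.mem_coe.2 (Finset.mem_image.2 ⟨((b, p), r),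
      Finset.mem_product.2 ⟨Finset.mem_product.2 ⟨hb, hp⟩, hr⟩, e⟩)
  have hev : (fun t => ∑ b ∈ B, ∑ a ∈ A, residueTerm z (A ∪ B) t b a) =ᶠ[𝓝[≠] c] fun _ => 0 := by
    filter_upwards [hbad] with t ht
    exact sum_residueTerm_of_generic hAB hz hz0 hS ht
  exact tendsto_nhds_unique (hcont.tendsto.mono_left nhdsWithin_le_nhds)
    (tendsto_const_nhds.congr' hev.symm)

end Residue

section Seed

/-- `∏_{j=1}^n (1 - q^{-j})`. -/
def descFac (q : ℂ) (n : ℕ) : ℂ := ∏ j ∈ Finset.range n, (1 - q ^ (-(j : ℤ) - 1))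

theorem prod_erase_one_sub {q : ℂ} {n N : ℕ} (h : n ≤ N) :
    ∏ l ∈ (Finset.range (N + 1)).erase n, (1 - q ^ ((l : ℤ) - n)) =
      descFac q n * qPoch q q (N - n) := by
  obtain ⟨d, rfl⟩ := Nat.exists_eq_add_of_le h
  have e : (Finset.range (n + d + 1)).erase n =
      (Finset.range n).disjUnion ((Finset.range d).map (addLeftEmbedding (n + 1)))
        (by rw [Finset.disjoint_left]; intro a ha; simp at ha ⊢; omega) := by
    ext l
    simp only [Finset.mem_erase, Finset.mem_range, Finset.mem_disjUnion, Finset.mem_map,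
      addLeftEmbedding_apply]
    constructor
    · intro hl
      rcases lt_or_ge l n with h | h
      · exact Or.inl h
      · exact Or.inr ⟨l - n - 1, by omega, by omega⟩
    · rintro (h | ⟨j, hj, rfl⟩) <;> omega
  rw [e, Finset.prod_disjUnion, Finset.prod_map, show n + d - n = d by omega]
  congr 1
  · rw [descFac, ← Finset.prod_range_reflect]
    refine Finset.prod_congr rfl fun j hj => ?_
    rw [Finset.mem_range] at hj
    congr 2
    omega
  · rw [qPoch]
    refine Finset.prod_congr rfl fun j _ => ?_
    rw [addLeftEmbedding_apply, ← pow_succ', ← zpow_natCast]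
    congr 2
    push_cast
    ring

theorem inv_prod_erase {q : ℂ} (hq : ‖q‖ < 1) {a : ℂ} (h : ∀ j : ℕ, a * q ^ j ≠ 1) {n N : ℕ}
    (hn : n ≤ N) :
    (∏ l ∈ (Finset.range (N + 1)).erase n, (1 - a * q ^ l))⁻¹ =
      (1 - a * q ^ n) * qPochInf (a * q ^ (N + 1)) q / qPochInf a q := by
  have hm : n ∈ Finset.range (N + 1) := Finset.mem_range.2 (by omega)
  have h1 := Finset.mul_prod_erase (Finset.range (N + 1)) (fun l => 1 - a * q ^ l) hm
  have h2 := qPoch_ne_zero h (N + 1)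
  rw [qPochInf_mul_pow hq h, qPoch, ← h1]
  rw [qPoch, ← h1] at h2
  have h3 := qPochInf_ne_zero hq h
  have h4 := left_ne_zero_of_mul h2
  have h5 := right_ne_zero_of_mul h2
  field_simp

/-- The interpolation nodes `x₁ q^i` and `x₃ q^{-i}`. -/
def node (q x₁ x₃ : ℂ) : ℕ ⊕ ℕ → ℂ :=
  Sum.elim (fun i => x₁ * q ^ (i : ℤ)) (fun i => x₃ * q ^ (-(i : ℤ)))

/-- The coefficients expanding the unit vector at `(0,0)` in the eigenbasis `stKer`. -/
def seedCoef (q x₁ x₂ x₃ : ℂ) (n m : ℕ) : ℂ :=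
  qPochInf (x₁ / x₃) q / qPochInf q q ^ 2 * q ^ (-(n : ℤ) - m) *
    ((1 - x₁ * q ^ (n : ℤ) / (x₂ * q ^ ((m : ℤ) - n))) *
      (1 - x₁ * q ^ (n : ℤ) / (x₃ * q ^ (-(m : ℤ)))) *
      (1 - x₂ * q ^ ((m : ℤ) - n) / (x₃ * q ^ (-(m : ℤ))))) /
    (descFac q n * descFac q m *
      (qPochInf (x₁ / (x₂ * q ^ ((m : ℤ) - n))) q * qPochInf (x₁ / (x₃ * q ^ (-(m : ℤ)))) q *
        qPochInf (x₁ * q ^ (n : ℤ) / x₃) q * qPochInf (x₂ * q ^ ((m : ℤ) - n) / x₃) q))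

theorem descFac_ne_zero {q : ℂ} (hq : ‖q‖ < 1) (hq0 : q ≠ 0) (n : ℕ) : descFac q n ≠ 0 :=
  Finset.prod_ne_zero_iff.2 fun j _ => sub_ne_zero.2 fun e => by
    have := (zpow_eq_one_iff hq hq0 (-(j : ℤ) - 1)).1 e.symm
    omega

theorem Generic.div₁₂ {q x₁ x₂ x₃ : ℂ} (h : Generic q x₁ x₂ x₃) (hq0 : q ≠ 0) (i j : ℤ) (l : ℕ) :
    x₁ * q ^ i / (x₂ * q ^ j) * q ^ l ≠ 1 := by
  have h' := h.point hq0 i j 0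
  rw [← zpow_natCast]
  exact div_mul_zpow_ne_one hq0 h'.ne₂ h'.gen₁₂ _

theorem Generic.div₂₃ {q x₁ x₂ x₃ : ℂ} (h : Generic q x₁ x₂ x₃) (hq0 : q ≠ 0) (i j : ℤ) (l : ℕ) :
    x₂ * q ^ i / (x₃ * q ^ j) * q ^ l ≠ 1 := by
  have h' := h.point hq0 0 i j
  rw [← zpow_natCast]
  exact div_mul_zpow_ne_one hq0 h'.ne₃ h'.gen₂₃ _

theorem Generic.div₁₃ {q x₁ x₂ x₃ : ℂ} (h : Generic q x₁ x₂ x₃) (hq0 : q ≠ 0) (i j : ℤ) (l : ℕ) :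
    x₁ * q ^ i / (x₃ * q ^ j) * q ^ l ≠ 1 := by
  have h' := h.point hq0 i 0 j
  rw [← zpow_natCast]
  exact div_mul_zpow_ne_one hq0 h'.ne₃ h'.gen₁₃ _

theorem residueTerm_node {q : ℂ} (hq : ‖q‖ < 1) (hq0 : q ≠ 0) {x₁ x₂ x₃ : ℂ}
    (h : Generic q x₁ x₂ x₃) {n m N M : ℕ} (hn : n ≤ N) (hm : m ≤ M) (hNM : 1 ≤ N + M) :
    seedCoef q x₁ x₂ x₃ n m * stKer q x₁ x₂ x₃ n m N M =
      qPochInf (x₁ / x₃) q / qPochInf (q * (x₁ * q ^ (N : ℤ)) * (q ^ (M : ℤ) / x₃)) q *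
        (x₁ / x₃) * (-(x₁ * x₂ * x₃)) ^ N *
        (∏ l ∈ Finset.range (M + 1), x₃ * q ^ (-(l : ℤ))) ^ 3 *
        residueTerm (node q x₁ x₃) ((Finset.range (N + 1)).disjSum (Finset.range (M + 1)))
          (x₁ * x₂ * x₃) (Sum.inr m) (Sum.inl n) := by
  have hp := h.point hq0 n ((m : ℤ) - n) (-(m : ℤ))
  have e1 := h.ne₁
  have e3 := h.ne₃
  have a12 : ∀ j : ℕ, x₁ / (x₂ * q ^ ((m : ℤ) - n)) * q ^ j ≠ 1 := fun j => by
    simpa using h.div₁₂ hq0 0 ((m : ℤ) - n) j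
  have a13 : ∀ j : ℕ, x₁ / (x₃ * q ^ (-(m : ℤ))) * q ^ j ≠ 1 := fun j => by
    simpa using h.div₁₃ hq0 0 (-(m : ℤ)) j
  have b13 : ∀ j : ℕ, x₁ * q ^ (n : ℤ) / x₃ * q ^ j ≠ 1 := fun j => by
    simpa using h.div₁₃ hq0 n 0 j
  have b23 : ∀ j : ℕ, x₂ * q ^ ((m : ℤ) - n) / x₃ * q ^ j ≠ 1 := fun j => by
    simpa using h.div₂₃ hq0 ((m : ℤ) - n) 0 j
  have d13 : x₃ * q ^ (-(m : ℤ)) - x₁ * q ^ (n : ℤ) ≠ 0 :=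
    sub_ne_zero.2 fun e => hp.gen₁₃ 0 (by simpa using e.symm)
  have hc : x₁ * x₂ * x₃ = (x₁ * q ^ (n : ℤ)) * (x₂ * q ^ ((m : ℤ) - n)) *
      (x₃ * q ^ (-(m : ℤ))) := by
    have : q ^ (n : ℤ) * q ^ ((m : ℤ) - n) * q ^ (-(m : ℤ)) = 1 := by
      rw [← zpow_add₀ hq0, ← zpow_add₀ hq0]; simp
    linear_combination -(x₁ * x₂ * x₃) * this
  have hqnm : q ^ (-(n : ℤ) - m) = x₁ / x₃ * ((x₃ * q ^ (-(m : ℤ))) / (x₁ * q ^ (n : ℤ))) := by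
    rw [sub_eq_add_neg, zpow_add₀ hq0, zpow_neg q n]; field_simp
  have hset : (((Finset.range (N + 1)).disjSum (Finset.range (M + 1))).erase (Sum.inr m)).erase
      (Sum.inl n) =
      ((Finset.range (N + 1)).erase n).disjSum ((Finset.range (M + 1)).erase m) := by
    ext (i | i) <;> simp
  have hmN : n ∈ Finset.range (N + 1) := Finset.mem_range.2 (by omega)
  have hmM : m ∈ Finset.range (M + 1) := Finset.mem_range.2 (by omega)
  have A1 : ∏ l ∈ (Finset.range (N + 1)).erase n, (1 - x₁ * q ^ (l : ℤ) / (x₁ * q ^ (n : ℤ))) =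
      descFac q n * qPoch q q (N - n) := by
    rw [← prod_erase_one_sub hn]
    refine Finset.prod_congr rfl fun l _ => ?_
    rw [mul_div_mul_left _ _ e1, zpow_sub₀ hq0]
  have B3 : ∏ l ∈ (Finset.range (M + 1)).erase m,
      (1 - x₃ * q ^ (-(m : ℤ)) / (x₃ * q ^ (-(l : ℤ)))) = descFac q m * qPoch q q (M - m) := by
    rw [← prod_erase_one_sub hm]
    refine Finset.prod_congr rfl fun l _ => ?_
    rw [mul_div_mul_left _ _ e3, ← zpow_sub₀ hq0]
    congr 2; ring
  have A23 : ∀ Z : ℂ, ∀ l : ℕ, x₁ * q ^ (l : ℤ) / Z = x₁ / Z * q ^ l := fun Z l => by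
    rw [zpow_natCast]; ring
  have B12 : ∀ Z : ℂ, ∀ l : ℕ, Z / (x₃ * q ^ (-(l : ℤ))) = Z / x₃ * q ^ l := fun Z l => by
    rw [zpow_neg, zpow_natCast]; field_simp
  obtain ⟨k1, k2, k3, -, -, -⟩ := hp
  rw [residueTerm, hset, Finset.prod_disjSum, Finset.card_disjSum, Finset.card_range,
    Finset.card_range]
  simp only [node, Sum.elim_inl, Sum.elim_inr]
  rw [seedCoef, stKer, kappa, hqnm, hc]
  have G1 : ∀ Z : ℂ, q * (x₁ * q ^ (N : ℤ)) / Z = x₁ / Z * q ^ (N + 1) := fun Z => by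
    rw [zpow_natCast, pow_succ]; ring
  have G2 : ∀ Z : ℂ, q * Z * (q ^ (M : ℤ) / x₃) = Z / x₃ * q ^ (M + 1) := fun Z => by
    rw [zpow_natCast, pow_succ]; ring
  have G3 : q * (x₁ * q ^ (N : ℤ)) / (x₁ * q ^ (n : ℤ)) = q * q ^ (((N - n : ℕ) : ℤ)) := by
    rw [Nat.cast_sub hn, zpow_sub₀ hq0]; field_simp
  have G4 : q * (x₃ * q ^ (-(m : ℤ))) * (q ^ (M : ℤ) / x₃) = q * q ^ (((M - m : ℕ) : ℤ)) := by
    rw [Nat.cast_sub hm, zpow_sub₀ hq0, zpow_neg]; field_simp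
  rw [G3, G4, qFacInv_eq_qPochInf hq hq0, qFacInv_eq_qPochInf hq hq0, G1, G1, G2 (x₁ * q ^ (n : ℤ)),
    G2 (x₂ * q ^ ((m : ℤ) - n)), qFacInv_natCast, qFacInv_natCast]
  have I2 := inv_prod_erase hq a12 hn
  have I3 := inv_prod_erase hq a13 hn
  have J1 := inv_prod_erase hq b13 hm
  have J2 := inv_prod_erase hq b23 hm
  simp only [← A23] at I2 I3
  simp only [← B12] at J1 J2
  rw [A23 _ (N + 1)] at I2 I3
  rw [B12 _ (M + 1)] at J1 J2
  have hcard : ((Finset.range (N + 1)).erase n).card = N := by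
    rw [Finset.card_erase_of_mem hmN, Finset.card_range]; rfl
  have hcard' : ((Finset.range (M + 1)).erase m).card = M := by
    rw [Finset.card_erase_of_mem hmM, Finset.card_range]; rfl
  have hpi := Finset.mul_prod_erase (Finset.range (M + 1)) (fun l : ℕ => x₃ * q ^ (-(l : ℤ))) hmM
  have hpi0 : ∏ l ∈ (Finset.range (M + 1)).erase m, x₃ * q ^ (-(l : ℤ)) ≠ 0 :=
    Finset.prod_ne_zero_iff.2 fun l _ => mul_ne_zero e3 (zpow_ne_zero _ hq0)
  have D1 := descFac_ne_zero hq hq0 n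
  have D3 := descFac_ne_zero hq hq0 m
  have P0 := qPochInf_ne_zero hq (self_mul_pow_ne_one hq)
  have PN := qPoch_ne_zero (self_mul_pow_ne_one hq) (N - n)
  have PM := qPoch_ne_zero (self_mul_pow_ne_one hq) (M - m)
  rw [← hpi]
  generalize x₁ * q ^ (n : ℤ) = Z₁ at *
  generalize x₂ * q ^ ((m : ℤ) - n) = Z₂ at *
  generalize x₃ * q ^ (-(m : ℤ)) = Z₃ at *
  have HA : ∏ l ∈ (Finset.range (N + 1)).erase n, ((Z₁ - x₁ * q ^ (l : ℤ)) *
      (Z₃ - x₁ * q ^ (l : ℤ)) * (Z₃ * Z₁ * (x₁ * q ^ (l : ℤ)) - Z₁ * Z₂ * Z₃))⁻¹ =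
      (((-(Z₁ * Z₂ * Z₃)) * (Z₃ * Z₁)) ^ N)⁻¹ *
      ((∏ l ∈ (Finset.range (N + 1)).erase n, (1 - x₁ * q ^ (l : ℤ) / Z₁))⁻¹ *
       (∏ l ∈ (Finset.range (N + 1)).erase n, (1 - x₁ * q ^ (l : ℤ) / Z₂))⁻¹ *
       (∏ l ∈ (Finset.range (N + 1)).erase n, (1 - x₁ * q ^ (l : ℤ) / Z₃))⁻¹) := by
    rw [Finset.prod_inv_distrib, ← mul_inv, ← mul_inv, ← mul_inv]
    have hpc : ((-(Z₁ * Z₂ * Z₃)) * (Z₃ * Z₁)) ^ N =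
        ∏ _l ∈ (Finset.range (N + 1)).erase n, ((-(Z₁ * Z₂ * Z₃)) * (Z₃ * Z₁)) := by
      rw [Finset.prod_const, hcard]
    rw [hpc, ← Finset.prod_mul_distrib, ← Finset.prod_mul_distrib, ← Finset.prod_mul_distrib]
    congr 1
    refine Finset.prod_congr rfl fun l _ => ?_
    field_simp
    ring
  have HB : ∏ l ∈ (Finset.range (M + 1)).erase m, ((Z₁ - x₃ * q ^ (-(l : ℤ))) *
      (Z₃ - x₃ * q ^ (-(l : ℤ))) * (Z₃ * Z₁ * (x₃ * q ^ (-(l : ℤ))) - Z₁ * Z₂ * Z₃))⁻¹ =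
      ((∏ l ∈ (Finset.range (M + 1)).erase m, x₃ * q ^ (-(l : ℤ))) ^ 3)⁻¹ *
      ((Z₃ * Z₁) ^ M)⁻¹ *
      ((∏ l ∈ (Finset.range (M + 1)).erase m, (1 - Z₁ / (x₃ * q ^ (-(l : ℤ)))))⁻¹ *
       (∏ l ∈ (Finset.range (M + 1)).erase m, (1 - Z₂ / (x₃ * q ^ (-(l : ℤ)))))⁻¹ *
       (∏ l ∈ (Finset.range (M + 1)).erase m, (1 - Z₃ / (x₃ * q ^ (-(l : ℤ)))))⁻¹) := by
    rw [Finset.prod_inv_distrib, ← mul_inv, ← mul_inv, ← mul_inv, ← mul_inv]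
    have hpc : (Z₃ * Z₁) ^ M = ∏ _l ∈ (Finset.range (M + 1)).erase m, (Z₃ * Z₁) := by
      rw [Finset.prod_const, hcard']
    rw [hpc, ← Finset.prod_pow, ← Finset.prod_mul_distrib, ← Finset.prod_mul_distrib,
      ← Finset.prod_mul_distrib, ← Finset.prod_mul_distrib]
    congr 1
    refine Finset.prod_congr rfl fun l _ => ?_
    have : x₃ * q ^ (-(l : ℤ)) ≠ 0 := mul_ne_zero e3 (zpow_ne_zero _ hq0)
    generalize x₃ * q ^ (-(l : ℤ)) = p at *
    field_simp
    ring
  rw [HA, HB, A1, B3, I2, I3, J1, J2]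
  generalize ∏ l ∈ (Finset.range (M + 1)).erase m, x₃ * q ^ (-(l : ℤ)) = Q at *
  have Q1 := qPochInf_ne_zero hq a12
  have Q2 := qPochInf_ne_zero hq a13
  have Q3 := qPochInf_ne_zero hq b13
  have Q4 := qPochInf_ne_zero hq b23
  have k31 : 1 - Z₁ / Z₃ ≠ 0 := by
    rw [one_sub_div k3]; exact div_ne_zero d13 k3
  have hdiff : (Z₃ - Z₁)⁻¹ * (1 - Z₁ / Z₃) = Z₃⁻¹ := by
    rw [one_sub_div k3]; field_simp
  have hpow : (Z₃ * Z₁) ^ (N + 1 + (M + 1) - 3) = (Z₃ * Z₁) ^ N * (Z₃ * Z₁) ^ M / (Z₃ * Z₁) := by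
    rw [eq_div_iff (mul_ne_zero k3 k1), ← pow_succ, ← pow_add]
    congr 1
    omega
  rw [hpow, mul_pow (-(Z₁ * Z₂ * Z₃)), mul_pow Z₃ Q]
  have R1 : (-(Z₁ * Z₂ * Z₃)) ^ N ≠ 0 :=
    pow_ne_zero _ (neg_ne_zero.2 (mul_ne_zero (mul_ne_zero k1 k2) k3))
  have R2 : (Z₃ * Z₁) ^ N ≠ 0 := pow_ne_zero _ (mul_ne_zero k3 k1)
  have R3 : (Z₃ * Z₁) ^ M ≠ 0 := pow_ne_zero _ (mul_ne_zero k3 k1)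
  generalize (-(Z₁ * Z₂ * Z₃)) ^ N = S1 at *
  generalize (Z₃ * Z₁) ^ N = S2 at *
  generalize (Z₃ * Z₁) ^ M = S3 at *
  generalize 1 - Z₁ / Z₂ = f12 at *
  generalize 1 - Z₂ / Z₃ = f23 at *
  generalize 1 - Z₁ / Z₃ = f13 at *
  generalize qPochInf (x₁ / Z₂) q = F1 at *
  generalize qPochInf (x₁ / Z₃) q = F2 at *
  generalize qPochInf (Z₁ / x₃) q = F3 at *
  generalize qPochInf (Z₂ / x₃) q = F4 at *
  generalize qPochInf (x₁ / Z₂ * q ^ (N + 1)) q = H1 at *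
  generalize qPochInf (x₁ / Z₃ * q ^ (N + 1)) q = H2 at *
  generalize qPochInf (Z₁ / x₃ * q ^ (M + 1)) q = H3 at *
  generalize qPochInf (Z₂ / x₃ * q ^ (M + 1)) q = H4 at *
  generalize qPochInf q q = P at *
  generalize qPoch q q (N - n) = PN' at *
  generalize qPoch q q (M - m) = PM' at *
  generalize qPochInf (q * (x₁ * q ^ (N : ℤ)) * (q ^ (M : ℤ) / x₃)) q = V
  generalize qPochInf (x₁ / x₃) q = V'
  generalize descFac q n = Dn at *
  generalize descFac q m = Dm at *
  clear hpi hpow HA HB A1 B3 A23 B12 G1 G2 I2 I3 J1 J2 a12 a13 b13 b23 hset hqnm hc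
  rw [div_eq_mul_inv _ V, div_eq_mul_inv _ V]
  generalize V⁻¹ = V at *
  have : (Z₃ - Z₁)⁻¹ = Z₃⁻¹ * f13⁻¹ := by rw [← hdiff]; field_simp
  rw [this]
  field_simp

theorem seedCoef_zero_mul_stKer {q : ℂ} (hq : ‖q‖ < 1) (hq0 : q ≠ 0) {x₁ x₂ x₃ : ℂ}
    (h : Generic q x₁ x₂ x₃) : seedCoef q x₁ x₂ x₃ 0 0 * stKer q x₁ x₂ x₃ 0 0 0 0 = 1 := by
  have e1 := h.ne₁
  have e2 := h.ne₂
  have e3 := h.ne₃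
  have g12 : ∀ j : ℕ, x₁ / x₂ * q ^ j ≠ 1 := fun j => by simpa using h.div₁₂ hq0 0 0 j
  have g13 : ∀ j : ℕ, x₁ / x₃ * q ^ j ≠ 1 := fun j => by simpa using h.div₁₃ hq0 0 0 j
  have g23 : ∀ j : ℕ, x₂ / x₃ * q ^ j ≠ 1 := fun j => by simpa using h.div₂₃ hq0 0 0 j
  have P0 := qPochInf_ne_zero hq (self_mul_pow_ne_one hq)
  have s12 := qPochInf_step hq (x₁ / x₂)
  have s13 := qPochInf_step hq (x₁ / x₃)
  have s23 := qPochInf_step hq (x₂ / x₃)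
  have n12 := qPochInf_ne_zero hq g12
  have n13 := qPochInf_ne_zero hq g13
  have n23 := qPochInf_ne_zero hq g23
  rw [seedCoef, stKer, kappa]
  simp only [Nat.cast_zero, zpow_zero, mul_one, neg_zero, sub_zero, descFac, Finset.range_zero,
    Finset.prod_empty, one_mul, mul_div_assoc, div_self e1]
  rw [show q * x₁ * (1 / x₃) = q * (x₁ / x₃) by ring, show q * x₂ * (1 / x₃) = q * (x₂ / x₃) by ring,
    show q * x₃ * (1 / x₃) = q by field_simp]
  rw [s12] at n12 ⊢
  rw [s13] at n13 ⊢
  rw [s23] at n23 ⊢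
  generalize qPochInf (q * (x₁ / x₂)) q = A at *
  generalize qPochInf (q * (x₁ / x₃)) q = B at *
  generalize qPochInf (q * (x₂ / x₃)) q = C at *
  generalize 1 - x₁ / x₂ = a at *
  generalize 1 - x₁ / x₃ = b at *
  generalize 1 - x₂ / x₃ = c at *
  have a0 := left_ne_zero_of_mul n12
  have A0 := right_ne_zero_of_mul n12
  have b0 := left_ne_zero_of_mul n13
  have B0 := right_ne_zero_of_mul n13
  have c0 := left_ne_zero_of_mul n23
  have C0 := right_ne_zero_of_mul n23
  field_simp

theorem sum_seedCoef_mul_stKer {q : ℂ} (hq : ‖q‖ < 1) (hq0 : q ≠ 0) {x₁ x₂ x₃ : ℂ}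
    (h : Generic q x₁ x₂ x₃) (N M : ℕ) :
    ∑ m ∈ Finset.range (M + 1), ∑ n ∈ Finset.range (N + 1),
      seedCoef q x₁ x₂ x₃ n m * stKer q x₁ x₂ x₃ n m N M = if N = 0 ∧ M = 0 then 1 else 0 := by
  by_cases h0 : N = 0 ∧ M = 0
  · obtain ⟨rfl, rfl⟩ := h0
    simpa using seedCoef_zero_mul_stKer hq hq0 h
  rw [if_neg h0]
  have e1 := h.ne₁
  have e3 := h.ne₃
  have inj1 : ∀ i j : ℤ, q ^ i = q ^ j → i = j := fun i j e => by
    have := (zpow_eq_one_iff hq hq0 (i - j)).1 (by rw [zpow_sub₀ hq0, e]; field_simp)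
    omega
  have ne13 : ∀ i j : ℤ, x₁ * q ^ i ≠ x₃ * q ^ j := fun i j => by
    simpa using (h.point hq0 i 0 j).gen₁₃ 0
  have key := sum_residueTerm (z := node q x₁ x₃) (A := (Finset.range (N + 1)).disjSum ∅)
    (B := (∅ : Finset ℕ).disjSum (Finset.range (M + 1))) (c := x₁ * x₂ * x₃) ?_ ?_ ?_ ?_ ?_
  · have hU : (Finset.range (N + 1)).disjSum ∅ ∪ (∅ : Finset ℕ).disjSum (Finset.range (M + 1)) =
        (Finset.range (N + 1)).disjSum (Finset.range (M + 1)) := by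
      ext (i | i) <;> simp
    rw [hU] at key
    simp only [Finset.sum_disjSum, Finset.sum_empty, zero_add, add_zero] at key
    rw [← mul_zero (qPochInf (x₁ / x₃) q /
      qPochInf (q * (x₁ * q ^ (N : ℤ)) * (q ^ (M : ℤ) / x₃)) q *
        (x₁ / x₃) * (-(x₁ * x₂ * x₃)) ^ N *
        (∏ l ∈ Finset.range (M + 1), x₃ * q ^ (-(l : ℤ))) ^ 3), ← key, Finset.mul_sum]
    refine Finset.sum_congr rfl fun m hm => ?_
    rw [Finset.mul_sum]
    refine Finset.sum_congr rfl fun n hn => ?_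
    rw [Finset.mem_range] at hm hn
    exact residueTerm_node hq hq0 h (by omega) (by omega) (by omega)
  · rw [Finset.disjoint_left]
    rintro (i | i) <;> simp
  · rintro (i | i) - (j | j) - e
    · have e' : q ^ (i : ℤ) = q ^ (j : ℤ) := mul_left_cancel₀ e1 e
      have := inj1 _ _ e'
      rw [show i = j by omega]
    · exact absurd e (ne13 _ _)
    · exact absurd e.symm (ne13 _ _)
    · have e' : q ^ (-(i : ℤ)) = q ^ (-(j : ℤ)) := mul_left_cancel₀ e3 e
      have := inj1 _ _ e'
      rw [show i = j by omega]
  · rintro (i | i) - <;> simp only [node, Sum.elim_inl, Sum.elim_inr]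
    · exact mul_ne_zero e1 (zpow_ne_zero _ hq0)
    · exact mul_ne_zero e3 (zpow_ne_zero _ hq0)
  · rw [Finset.card_union_of_disjoint]
    · simp only [Finset.card_disjSum, Finset.card_range, Finset.card_empty]
      omega
    · rw [Finset.disjoint_left]
      rintro (i | i) <;> simp
  · rintro (m | m) hm <;> simp only [Finset.inl_mem_disjSum, Finset.inr_mem_disjSum, Finset.notMem_empty] at hm
    rintro (n | n) hn <;> simp only [Finset.inl_mem_disjSum, Finset.inr_mem_disjSum, Finset.notMem_empty] at hn
    rintro (r | r) - e <;> simp only [node, Sum.elim_inl, Sum.elim_inr] at e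
    · refine (h.point hq0 ((n : ℤ) - m + r) 0 0).gen₁₂ 0 ?_
      rw [zpow_add₀ hq0, zpow_sub₀ hq0]
      rw [zpow_neg] at e
      refine mul_left_cancel₀ (mul_ne_zero e1 e3) ?_
      simp only [zpow_zero, mul_one]
      linear_combination e
    · refine (h.point hq0 0 0 ((n : ℤ) - m - r)).gen₂₃ 0 ?_
      rw [zpow_sub₀ hq0, zpow_sub₀ hq0]
      rw [zpow_neg, zpow_neg] at e
      refine mul_left_cancel₀ (mul_ne_zero e1 e3) ?_
      simp only [zpow_zero, mul_one]
      linear_combination -e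

end Seed

section Chain

/-- The point `(x₁ q^n, x₂ q^{m-n}, x₃ q^{-m})`. -/
def pt (q x₁ x₂ x₃ : ℂ) (n m : ℕ) : Fin 3 → ℂ :=
  ![x₁ * q ^ (n : ℤ), x₂ * q ^ ((m : ℤ) - n), x₃ * q ^ (-(m : ℤ))]

def lowCoef (Z : Fin 3 → ℂ) (j : Fin 3) : ℂ := (∏ i ∈ Finset.univ.erase j, (1 - Z j / Z i))⁻¹

def raiseCoef (Z : Fin 3 → ℂ) (l : Fin 3) : ℂ := (∏ i ∈ Finset.univ.erase l, (1 - Z i / Z l))⁻¹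

/-- Increments of `n` and `m` when the `j`-th coordinate of `pt` is divided by `q` and `x₁` is
replaced by `x₁ / q`. -/
def lowN : Fin 3 → ℕ := ![0, 1, 1]
def lowM : Fin 3 → ℕ := ![0, 0, 1]

/-- Increments of `n` and `m` when the `l`-th coordinate of `pt` is multiplied by `q` and `x₃` is
replaced by `x₃ q`. -/
def raiseN : Fin 3 → ℕ := ![1, 0, 0]
def raiseM : Fin 3 → ℕ := ![1, 1, 0]

theorem erase_zero : (Finset.univ.erase (0 : Fin 3)) = {1, 2} := by decide
theorem erase_one : (Finset.univ.erase (1 : Fin 3)) = {0, 2} := by decide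
theorem erase_two : (Finset.univ.erase (2 : Fin 3)) = {0, 1} := by decide

theorem Generic.low {q x₁ x₂ x₃ : ℂ} (h : Generic q x₁ x₂ x₃) (hq0 : q ≠ 0) :
    Generic q (x₁ / q) x₂ x₃ := by
  simpa [div_eq_mul_inv] using h.point hq0 (-1) 0 0

theorem Generic.raise {q x₁ x₂ x₃ : ℂ} (h : Generic q x₁ x₂ x₃) (hq0 : q ≠ 0) :
    Generic q x₁ x₂ (x₃ * q) := by
  simpa using h.point hq0 0 0 1

theorem pt_low {q x₁ x₂ x₃ : ℂ} (hq0 : q ≠ 0) (n m : ℕ) (j : Fin 3) :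
    pt q (x₁ / q) x₂ x₃ (n + lowN j) (m + lowM j) =
      Function.update (pt q x₁ x₂ x₃ n m) j (pt q x₁ x₂ x₃ n m j / q) := by
  ext i
  have e : q ^ ((n : ℤ) + 1) = q ^ (n : ℤ) * q := zpow_add_one₀ hq0 _
  fin_cases j <;> fin_cases i <;> simp [pt, lowN, lowM, Function.update, -zpow_natCast, e]
  · ring
  · field_simp
  · rw [show (m : ℤ) - (n + 1) = m - n - 1 by ring, zpow_sub_one₀ hq0]; ring
  · field_simp
  · rw [show -1 + -(m : ℤ) = -m - 1 by ring, zpow_sub_one₀ hq0, zpow_neg]; ring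

theorem pt_raise {q x₁ x₂ x₃ : ℂ} (hq0 : q ≠ 0) (n m : ℕ) (l : Fin 3) :
    pt q x₁ x₂ (x₃ * q) (n + raiseN l) (m + raiseM l) =
      Function.update (pt q x₁ x₂ x₃ n m) l (pt q x₁ x₂ x₃ n m l * q) := by
  ext i
  have e : q ^ ((n : ℤ) + 1) = q ^ (n : ℤ) * q := zpow_add_one₀ hq0 _
  have e' : q ^ (-1 + -(m : ℤ)) = q ^ (-(m : ℤ)) / q := by
    rw [show -1 + -(m : ℤ) = -m - 1 by ring, zpow_sub_one₀ hq0]; rfl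
  fin_cases l <;> fin_cases i <;> simp [pt, raiseN, raiseM, Function.update, -zpow_natCast, e, e']
  · ring
  · field_simp
  · rw [show (m : ℤ) + 1 - n = m - n + 1 by ring, zpow_add_one₀ hq0]; ring
  · field_simp
  · ring

theorem stKer_low {q : ℂ} (hq : ‖q‖ < 1) (hq0 : q ≠ 0) {x₁ x₂ x₃ : ℂ}
    (h : Generic q x₁ x₂ x₃) (n m r s : ℕ) :
    stKer q x₁ x₂ x₃ n m r s = ∑ j, lowCoef (pt q x₁ x₂ x₃ n m) j *
      stKer q (x₁ / q) x₂ x₃ (n + lowN j) (m + lowM j) r s := by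
  have hp := h.point hq0 n ((m : ℤ) - n) (-(m : ℤ))
  have g : ∀ {y z : ℂ}, (∀ k : ℤ, y ≠ z * q ^ k) → y ≠ z := fun H => by simpa using H 0
  have key := kappa_lower hq hq0 hp.ne₁ hp.ne₂ hp.ne₃ (g hp.gen₁₂) (g hp.gen₁₃) (g hp.gen₂₃)
    (X := x₁ * q ^ (r : ℤ)) (W := q ^ (s : ℤ) / x₃) (by
      have e : x₁ * q ^ (r : ℤ) * (q ^ (s : ℤ) / x₃) = x₁ * q ^ (r : ℤ) / (x₃ * q ^ (0 : ℤ)) * q ^ s := by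
        rw [zpow_zero, mul_one, zpow_natCast q s]; ring
      rw [e]
      exact h.div₁₃ hq0 r 0 s)
  have P : ∀ j, stKer q (x₁ / q) x₂ x₃ (n + lowN j) (m + lowM j) r s =
      kappa q (pt q (x₁ / q) x₂ x₃ (n + lowN j) (m + lowM j) 0)
        (pt q (x₁ / q) x₂ x₃ (n + lowN j) (m + lowM j) 1)
        (pt q (x₁ / q) x₂ x₃ (n + lowN j) (m + lowM j) 2) (x₁ * q ^ (r : ℤ) / q)
        (q ^ (s : ℤ) / x₃) := fun j => by
    rw [← div_mul_eq_mul_div]; rfl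
  rw [Fin.sum_univ_three, P, P, P, pt_low hq0, pt_low hq0, pt_low hq0, lowCoef, lowCoef, lowCoef,
    erase_zero, erase_one, erase_two, Finset.prod_pair (by decide), Finset.prod_pair (by decide),
    Finset.prod_pair (by decide)]
  exact key

theorem stKer_raise {q : ℂ} (hq : ‖q‖ < 1) (hq0 : q ≠ 0) {x₁ x₂ x₃ : ℂ}
    (h : Generic q x₁ x₂ x₃) (n m r s : ℕ) :
    stKer q x₁ x₂ x₃ n m r s = ∑ l, raiseCoef (pt q x₁ x₂ x₃ n m) l *
      stKer q x₁ x₂ (x₃ * q) (n + raiseN l) (m + raiseM l) r s := by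
  have hp := h.point hq0 n ((m : ℤ) - n) (-(m : ℤ))
  have g : ∀ {y z : ℂ}, (∀ k : ℤ, y ≠ z * q ^ k) → y ≠ z := fun H => by simpa using H 0
  have key := kappa_raise hq hq0 hp.ne₁ hp.ne₂ hp.ne₃ (g hp.gen₁₂) (g hp.gen₁₃) (g hp.gen₂₃)
    (X := x₁ * q ^ (r : ℤ)) (W := q ^ (s : ℤ) / x₃) (by
      have e : x₁ * q ^ (r : ℤ) * (q ^ (s : ℤ) / x₃) = x₁ * q ^ (r : ℤ) / (x₃ * q ^ (0 : ℤ)) * q ^ s := by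
        rw [zpow_zero, mul_one, zpow_natCast q s]; ring
      rw [e]
      exact h.div₁₃ hq0 r 0 s)
  have P : ∀ j, stKer q x₁ x₂ (x₃ * q) (n + raiseN j) (m + raiseM j) r s =
      kappa q (pt q x₁ x₂ (x₃ * q) (n + raiseN j) (m + raiseM j) 0)
        (pt q x₁ x₂ (x₃ * q) (n + raiseN j) (m + raiseM j) 1)
        (pt q x₁ x₂ (x₃ * q) (n + raiseN j) (m + raiseM j) 2) (x₁ * q ^ (r : ℤ))
        (q ^ (s : ℤ) / x₃ / q) := fun j => by
    rw [stKer, div_div]; rfl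
  rw [Fin.sum_univ_three, P, P, P, pt_raise hq0, pt_raise hq0, pt_raise hq0, raiseCoef, raiseCoef,
    raiseCoef, erase_zero, erase_one, erase_two, Finset.prod_pair (by decide),
    Finset.prod_pair (by decide), Finset.prod_pair (by decide)]
  exact key

theorem weight_low {q : ℂ} (hq0 : q ≠ 0) {x₁ x₂ x₃ : ℂ} (h : Generic q x₁ x₂ x₃) (n m : ℕ)
    (j : Fin 3) : weight q (x₁ / q) x₂ x₃ (n + lowN j) (m + lowM j) =
      weight q x₁ x₂ x₃ n m * (x₁ / pt q x₁ x₂ x₃ n m j) := by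
  obtain ⟨e1, e2, e3, -, -, -⟩ := h
  have E : ∀ i : ℕ, (x₁ / q / x₂) ^ i = (x₁ / x₂) ^ i * q ^ (-(i : ℤ)) := fun i => by
    rw [zpow_neg, zpow_natCast, ← inv_pow, ← mul_pow]; congr 1; ring
  have e := zpow_add_one₀ hq0 (n : ℤ)
  have F1 : q ^ (((n : ℤ) + 1) ^ 2 - (n + 1) * m + (m : ℤ) ^ 2) =
      q ^ ((n : ℤ) ^ 2 - n * m + (m : ℤ) ^ 2) * (q ^ (n : ℤ) * q) / q ^ ((m : ℤ) - n) := by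
    rw [← e, ← zpow_add₀ hq0, ← zpow_sub₀ hq0]; congr 1; ring
  have F2 : q ^ (((n : ℤ) + 1) ^ 2 - (n + 1) * (m + 1) + ((m : ℤ) + 1) ^ 2) =
      q ^ ((n : ℤ) ^ 2 - n * m + (m : ℤ) ^ 2) * (q ^ (n : ℤ) * q) * q ^ (m : ℤ) := by
    rw [← e, ← zpow_add₀ hq0, ← zpow_add₀ hq0]; congr 1; ring
  fin_cases j <;> simp [weight, lowN, lowM, pt, E, -zpow_natCast, -neg_add_rev, pow_succ]
  · field_simp
  · simp only [← sq, F1, e]; field_simp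
  · simp only [← sq, F2, e]; field_simp

theorem weight_raise {q : ℂ} (hq0 : q ≠ 0) {x₁ x₂ x₃ : ℂ} (h : Generic q x₁ x₂ x₃) (n m : ℕ)
    (l : Fin 3) : weight q x₁ x₂ (x₃ * q) (n + raiseN l) (m + raiseM l) =
      weight q x₁ x₂ x₃ n m * (pt q x₁ x₂ x₃ n m l / x₃) := by
  obtain ⟨e1, e2, e3, -, -, -⟩ := h
  have E : ∀ i : ℕ, (x₂ / (x₃ * q)) ^ i = (x₂ / x₃) ^ i * q ^ (-(i : ℤ)) := fun i => by
    rw [zpow_neg, zpow_natCast, ← inv_pow, ← mul_pow]; congr 1; field_simp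
  have e := zpow_add_one₀ hq0 (m : ℤ)
  have F1 : q ^ ((n : ℤ) ^ 2 - n * (m + 1) + ((m : ℤ) + 1) ^ 2) =
      q ^ ((n : ℤ) ^ 2 - n * m + (m : ℤ) ^ 2) * (q ^ (m : ℤ) * q) * q ^ ((m : ℤ) - n) := by
    rw [← e, ← zpow_add₀ hq0, ← zpow_add₀ hq0]; congr 1; ring
  have F2 : q ^ (((n : ℤ) + 1) ^ 2 - (n + 1) * (m + 1) + ((m : ℤ) + 1) ^ 2) =
      q ^ ((n : ℤ) ^ 2 - n * m + (m : ℤ) ^ 2) * (q ^ (m : ℤ) * q) * q ^ (n : ℤ) := by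
    rw [← e, ← zpow_add₀ hq0, ← zpow_add₀ hq0]; congr 1; ring
  fin_cases l <;> simp [weight, raiseN, raiseM, pt, E, -zpow_natCast, -neg_add_rev, pow_succ]
  · simp only [← sq, F2, e]; field_simp
  · simp only [← sq, F1, e]; field_simp
  · field_simp

/-- Iterated transfer operators, the first `a` (resp. `b`) having parameter `u / q`
(resp. `v / q`). -/
def chain (q u v : ℂ) (f : ℕ → ℕ → ℂ) : ℕ → ℕ → ℕ → ℕ → ℕ → ℂ
  | 0, _, _ => f
  | k + 1, a, b => transfer q (if 0 < a then u / q else u) (if 0 < b then v / q else v)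
      (chain q u v f k (a - 1) (b - 1))

theorem transfer_sum {ι : Type*} (q u v : ℂ) (s : Finset ι) (c : ι → ℂ) (f : ι → ℕ → ℕ → ℂ)
    (N M : ℕ) : transfer q u v (fun r t => ∑ i ∈ s, c i * f i r t) N M =
      ∑ i ∈ s, c i * transfer q u v (f i) N M := by
  simp only [transfer, Finset.mul_sum]
  rw [Finset.sum_comm]
  conv_rhs => rw [Finset.sum_comm]
  rw [Finset.sum_comm]
  conv_rhs =>
    enter [2, y]
    rw [Finset.sum_comm]
  refine Finset.sum_congr rfl fun _ _ => Finset.sum_congr rfl fun _ _ =>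
    Finset.sum_congr rfl fun _ _ => by ring

theorem transfer_congr {q u v : ℂ} {f g : ℕ → ℕ → ℂ} {N M : ℕ}
    (h : ∀ r ≤ N, ∀ s ≤ M, f r s = g r s) : transfer q u v f N M = transfer q u v g N M := by
  refine Finset.sum_congr rfl fun r hr => Finset.sum_congr rfl fun s hs => ?_
  rw [Finset.mem_range] at hr hs
  rw [h r (by omega) s (by omega)]

theorem chain_congr {q u v : ℂ} {f g : ℕ → ℕ → ℂ} (k : ℕ) : ∀ {a b N M : ℕ},
    (∀ r ≤ N, ∀ s ≤ M, f r s = g r s) → chain q u v f k a b N M = chain q u v g k a b N M := by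
  induction k with
  | zero => intro a b N M h; exact h N le_rfl M le_rfl
  | succ k ih =>
    intro a b N M h
    exact transfer_congr fun r hr s hs => ih fun r' hr' s' hs' =>
      h r' (hr'.trans hr) s' (hs'.trans hs)

theorem chain_sum {ι : Type*} (q u v : ℂ) (s : Finset ι) (c : ι → ℂ) (f : ι → ℕ → ℕ → ℂ)
    (k : ℕ) : ∀ a b N M, chain q u v (fun r t => ∑ i ∈ s, c i * f i r t) k a b N M =
      ∑ i ∈ s, c i * chain q u v (f i) k a b N M := by
  induction k with
  | zero => intros; rfl
  | succ k ih =>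
    intro a b N M
    rw [chain, show chain q u v (fun r t => ∑ i ∈ s, c i * f i r t) k (a - 1) (b - 1) =
      fun r t => ∑ i ∈ s, c i * chain q u v (f i) k (a - 1) (b - 1) r t from
      funext fun r => funext fun t => ih _ _ r t, transfer_sum]
    rfl

theorem transfer_swap (q u v : ℂ) (f : ℕ → ℕ → ℂ) (N M : ℕ) :
    transfer q v u (fun r s => f s r) M N = transfer q u v f N M := by
  rw [transfer, Finset.sum_comm, transfer]
  refine Finset.sum_congr rfl fun r _ => Finset.sum_congr rfl fun s _ => ?_
  rw [show (s : ℤ) ^ 2 - s * r + (r : ℤ) ^ 2 = (r : ℤ) ^ 2 - r * s + (s : ℤ) ^ 2 by ring]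
  ring

theorem chain_swap (q u v : ℂ) (f : ℕ → ℕ → ℂ) (k : ℕ) : ∀ a b N M,
    chain q v u (fun r s => f s r) k b a M N = chain q u v f k a b N M := by
  induction k with
  | zero => intros; rfl
  | succ k ih =>
    intro a b N M
    rw [chain, chain, ← transfer_swap]
    exact transfer_congr fun r _ s _ => ih _ _ _ _

theorem chain_stKer_zero {q : ℂ} (hq : ‖q‖ < 1) (hq0 : q ≠ 0) {x₁ x₂ x₃ : ℂ}
    (h : Generic q x₁ x₂ x₃) (n m k : ℕ) : ∀ N M,
    chain q (x₁ / x₂) (x₂ / x₃) (stKer q x₁ x₂ x₃ n m) k 0 0 N M =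
      weight q x₁ x₂ x₃ n m ^ k * stKer q x₁ x₂ x₃ n m N M := by
  induction k with
  | zero => intros; simp [chain]
  | succ k ih =>
    intro N M
    have := transfer_sum q (x₁ / x₂) (x₂ / x₃) {()} (fun _ => weight q x₁ x₂ x₃ n m ^ k)
      (fun _ => stKer q x₁ x₂ x₃ n m) N M
    simp only [Finset.sum_singleton, transfer_stKer hq hq0 h] at this
    rw [chain, transfer_congr fun r _ s _ => ih r s]
    simp only [lt_irrefl, if_false]
    rw [this]
    ring

theorem chain_stKer_low {q : ℂ} (hq : ‖q‖ < 1) (hq0 : q ≠ 0) {x₁ x₂ x₃ : ℂ}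
    (h : Generic q x₁ x₂ x₃) (n m k : ℕ) : ∀ a ≤ k, ∀ N M,
    chain q (x₁ / x₂) (x₂ / x₃) (stKer q x₁ x₂ x₃ n m) k a 0 N M =
      ∑ j, (weight q x₁ x₂ x₃ n m ^ k * lowCoef (pt q x₁ x₂ x₃ n m) j *
        (x₁ / pt q x₁ x₂ x₃ n m j) ^ a) *
        stKer q (x₁ / q) x₂ x₃ (n + lowN j) (m + lowM j) N M := by
  induction k with
  | zero =>
    intro a ha N M
    obtain rfl : a = 0 := by omega
    simpa [chain] using stKer_low hq hq0 h n m N M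
  | succ k ih =>
    intro a ha N M
    rcases a with _ | a
    · rw [chain_stKer_zero hq hq0 h, stKer_low hq hq0 h, Finset.mul_sum]
      exact Finset.sum_congr rfl fun _ _ => by ring
    · simp only [chain, Nat.add_sub_cancel, Nat.zero_sub, lt_irrefl, if_false, Nat.succ_pos,
        if_true]
      rw [transfer_congr fun r _ s _ => ih a (by omega) r s]
      rw [transfer_sum, div_right_comm]
      refine Finset.sum_congr rfl fun j _ => ?_
      rw [transfer_stKer hq hq0 (h.low hq0), weight_low hq0 h]
      ring

theorem chain_stKer {q : ℂ} (hq : ‖q‖ < 1) (hq0 : q ≠ 0) {x₁ x₂ x₃ : ℂ}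
    (h : Generic q x₁ x₂ x₃) (n m k : ℕ) : ∀ a ≤ k, ∀ b ≤ a, ∀ N M,
    chain q (x₁ / x₂) (x₂ / x₃) (stKer q x₁ x₂ x₃ n m) k a b N M =
      ∑ p : Fin 3 × Fin 3, (weight q x₁ x₂ x₃ n m ^ k * lowCoef (pt q x₁ x₂ x₃ n m) p.1 *
        (x₁ / pt q x₁ x₂ x₃ n m p.1) ^ a *
        raiseCoef (pt q (x₁ / q) x₂ x₃ (n + lowN p.1) (m + lowM p.1)) p.2 *
        (pt q (x₁ / q) x₂ x₃ (n + lowN p.1) (m + lowM p.1) p.2 / x₃) ^ b) *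
        stKer q (x₁ / q) x₂ (x₃ * q) (n + lowN p.1 + raiseN p.2) (m + lowM p.1 + raiseM p.2)
          N M := by
  have h0 : ∀ k a, a ≤ k → ∀ N M,
      chain q (x₁ / x₂) (x₂ / x₃) (stKer q x₁ x₂ x₃ n m) k a 0 N M =
      ∑ p : Fin 3 × Fin 3, (weight q x₁ x₂ x₃ n m ^ k * lowCoef (pt q x₁ x₂ x₃ n m) p.1 *
        (x₁ / pt q x₁ x₂ x₃ n m p.1) ^ a *
        raiseCoef (pt q (x₁ / q) x₂ x₃ (n + lowN p.1) (m + lowM p.1)) p.2 *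
        (pt q (x₁ / q) x₂ x₃ (n + lowN p.1) (m + lowM p.1) p.2 / x₃) ^ 0) *
        stKer q (x₁ / q) x₂ (x₃ * q) (n + lowN p.1 + raiseN p.2) (m + lowM p.1 + raiseM p.2)
          N M := by
    intro k a ha N M
    rw [chain_stKer_low hq hq0 h n m k a ha, Fintype.sum_prod_type]
    refine Finset.sum_congr rfl fun j _ => ?_
    rw [stKer_raise hq hq0 (h.low hq0), Finset.mul_sum]
    exact Finset.sum_congr rfl fun l _ => by ring
  induction k with
  | zero =>
    intro a ha b hb
    obtain rfl : b = 0 := by omega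
    exact h0 _ _ ha
  | succ k ih =>
    intro a ha b hb
    rcases b with _ | b
    · exact h0 _ _ ha
    obtain ⟨a, rfl⟩ : ∃ a', a = a' + 1 := ⟨a - 1, by omega⟩
    intro N M
    simp only [chain, Nat.add_sub_cancel, Nat.succ_pos, if_true]
    rw [transfer_congr fun r _ s _ => ih a (by omega) b (by omega) r s]
    rw [transfer_sum, div_right_comm, div_div x₂]
    refine Finset.sum_congr rfl fun p _ => ?_
    rw [transfer_stKer hq hq0 ((h.low hq0).raise hq0), weight_raise hq0 (h.low hq0),
      weight_low hq0 h]
    ring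

end Chain

section Alternant

/-- The sign of the permutation `(j, m, l)` of `(0, 1, 2)`, zero if `j = l`. -/
def permSign : Matrix (Fin 3) (Fin 3) ℂ := !![0, -1, 1; 1, 0, -1; -1, 1, 0]

/-- The Vandermonde-type product `∏_{i<j} (1 - Z_i/Z_j)`. -/
def vdm (Z : Fin 3 → ℂ) : ℂ := (1 - Z 0 / Z 1) * (1 - Z 0 / Z 2) * (1 - Z 1 / Z 2)

theorem sum_raiseCoef {Z : Fin 3 → ℂ} (h0 : ∀ i, Z i ≠ 0) (hZ : ∀ i j, i ≠ j → Z i ≠ Z j) :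
    ∑ l, raiseCoef Z l = 1 := by
  have z0 := h0 0
  have z1 := h0 1
  have z2 := h0 2
  have d01 : Z 0 - Z 1 ≠ 0 := sub_ne_zero.2 (hZ 0 1 (by decide))
  have d10 : Z 1 - Z 0 ≠ 0 := sub_ne_zero.2 (hZ 1 0 (by decide))
  have d02 : Z 0 - Z 2 ≠ 0 := sub_ne_zero.2 (hZ 0 2 (by decide))
  have d20 : Z 2 - Z 0 ≠ 0 := sub_ne_zero.2 (hZ 2 0 (by decide))
  have d12 : Z 1 - Z 2 ≠ 0 := sub_ne_zero.2 (hZ 1 2 (by decide))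
  have d21 : Z 2 - Z 1 ≠ 0 := sub_ne_zero.2 (hZ 2 1 (by decide))
  rw [Fin.sum_univ_three, raiseCoef, raiseCoef, raiseCoef, erase_zero, erase_one, erase_two,
    Finset.prod_pair (by decide), Finset.prod_pair (by decide), Finset.prod_pair (by decide),
    one_sub_div z0, one_sub_div z0, one_sub_div z1, one_sub_div z1, one_sub_div z2, one_sub_div z2]
  rw [show Z 1 - Z 0 = -(Z 0 - Z 1) by ring, show Z 2 - Z 0 = -(Z 0 - Z 2) by ring,
    show Z 2 - Z 1 = -(Z 1 - Z 2) by ring]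
  field_simp
  ring

theorem vdm_mul_lowCoef {Z : Fin 3 → ℂ} (h0 : ∀ i, Z i ≠ 0) (hZ : ∀ i j, i ≠ j → Z i ≠ Z j)
    (j : Fin 3) : vdm Z * lowCoef Z j = ∑ l, permSign j l * (Z 0 / Z 2 * (Z l / Z j)) := by
  have z0 := h0 0
  have z1 := h0 1
  have z2 := h0 2
  have d01 : Z 0 - Z 1 ≠ 0 := sub_ne_zero.2 (hZ 0 1 (by decide))
  have d10 : Z 1 - Z 0 ≠ 0 := sub_ne_zero.2 (hZ 1 0 (by decide))
  have d02 : Z 0 - Z 2 ≠ 0 := sub_ne_zero.2 (hZ 0 2 (by decide))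
  have d20 : Z 2 - Z 0 ≠ 0 := sub_ne_zero.2 (hZ 2 0 (by decide))
  have d12 : Z 1 - Z 2 ≠ 0 := sub_ne_zero.2 (hZ 1 2 (by decide))
  have d21 : Z 2 - Z 1 ≠ 0 := sub_ne_zero.2 (hZ 2 1 (by decide))
  rw [Fin.sum_univ_three, vdm, lowCoef, one_sub_div z1, one_sub_div z2, one_sub_div z2]
  fin_cases j <;> simp only [Fin.zero_eta, Fin.mk_one, Fin.reduceFinMk, erase_zero, erase_one,
    erase_two]
  · rw [Finset.prod_pair (by decide), one_sub_div z1, one_sub_div z2]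
    simp [permSign]
    field_simp
    ring
  · rw [Finset.prod_pair (by decide), one_sub_div z0, one_sub_div z2]
    simp [permSign]
    rw [show Z 1 - Z 0 = -(Z 0 - Z 1) by ring] at *
    field_simp
    ring
  · rw [Finset.prod_pair (by decide), one_sub_div z0, one_sub_div z1]
    simp [permSign]
    field_simp
    ring

theorem vdm_mul_lowCoef_mul_raiseCoef {q : ℂ} (hq0 : q ≠ 0) {Z : Fin 3 → ℂ} (h0 : ∀ i, Z i ≠ 0)
    (hZ : ∀ i j, i ≠ j → Z i ≠ Z j) (hZq : ∀ i j, i ≠ j → Z i ≠ Z j * q) (j l : Fin 3) :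
    vdm Z * lowCoef Z j * raiseCoef (Function.update Z j (Z j / q)) l *
      (Function.update Z j (Z j / q) l / Z j - q⁻¹) =
      permSign j l * (Z 0 / Z 2 * (Z l / Z j) ^ 2) := by
  have z0 := h0 0
  have z1 := h0 1
  have z2 := h0 2
  have d01 : Z 0 - Z 1 ≠ 0 := sub_ne_zero.2 (hZ 0 1 (by decide))
  have d02 : Z 0 - Z 2 ≠ 0 := sub_ne_zero.2 (hZ 0 2 (by decide))
  have d12 : Z 1 - Z 2 ≠ 0 := sub_ne_zero.2 (hZ 1 2 (by decide))
  have d10 : Z 1 - Z 0 ≠ 0 := sub_ne_zero.2 (hZ 1 0 (by decide))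
  have d20 : Z 2 - Z 0 ≠ 0 := sub_ne_zero.2 (hZ 2 0 (by decide))
  have d21 : Z 2 - Z 1 ≠ 0 := sub_ne_zero.2 (hZ 2 1 (by decide))
  have e : ∀ i j, i ≠ j → Z j * q - Z i ≠ 0 := fun i j h => sub_ne_zero.2 (hZq i j h).symm
  have e01 := e 0 1 (by decide)
  have e10 := e 1 0 (by decide)
  have e02 := e 0 2 (by decide)
  have e20 := e 2 0 (by decide)
  have e12 := e 1 2 (by decide)
  have e21 := e 2 1 (by decide)
  have f : ∀ i j, i ≠ j → 1 - Z i / q / Z j = (Z j * q - Z i) / (Z j * q) := fun i j _ => by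
    have := h0 j
    field_simp
  have f' : ∀ i j, i ≠ j → Z j / Z i - q⁻¹ = (Z j * q - Z i) / (Z i * q) := fun i j _ => by
    have := h0 i
    field_simp
  by_cases hjl : j = l
  · subst hjl
    have := h0 j
    have h : permSign j j = 0 := by fin_cases j <;> simp [permSign]
    rw [h, Function.update_self]
    field_simp
    simp
  rw [Function.update_of_ne (Ne.symm hjl), f' j l hjl, vdm, lowCoef, raiseCoef,
    one_sub_div z1, one_sub_div z2, one_sub_div z2]
  fin_cases j <;> fin_cases l <;>
    simp only [Fin.zero_eta, Fin.mk_one, Fin.reduceFinMk, erase_zero, erase_one, erase_two,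
      not_true_eq_false] at hjl ⊢ <;>
    rw [Finset.prod_pair (by decide), Finset.prod_pair (by decide)] <;>
    simp only [Function.update, eq_rec_constant, dite_eq_ite, Fin.isValue, Fin.reduceEq, if_true,
      if_false] <;>
    rw [f _ _ hjl] <;>
    simp [permSign, one_sub_div z0, one_sub_div z1, one_sub_div z2] <;>
    field_simp <;> ring

/-- The coefficient of the eigenfunction of index `p` in the chain applied to `stKer n m`. -/
def chainCoef (q x₁ x₂ x₃ : ℂ) (k a b n m : ℕ) (p : Fin 3 × Fin 3) : ℂ :=
  weight q x₁ x₂ x₃ n m ^ k * lowCoef (pt q x₁ x₂ x₃ n m) p.1 *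
    (x₁ / pt q x₁ x₂ x₃ n m p.1) ^ a *
    raiseCoef (pt q (x₁ / q) x₂ x₃ (n + lowN p.1) (m + lowM p.1)) p.2 *
    (pt q (x₁ / q) x₂ x₃ (n + lowN p.1) (m + lowM p.1) p.2 / x₃) ^ b

/-- The alternating sum which is a `3 × 3` determinant up to normalization. -/
def altSum (x₁ x₃ : ℂ) (a b : ℕ) (Z : Fin 3 → ℂ) : ℂ :=
  Z 0 / Z 2 * ∑ j, ∑ l, permSign j l * (Z l / Z j * (x₁ / Z j) ^ a * (Z l / x₃) ^ b)

theorem pt_ne_zero {q x₁ x₂ x₃ : ℂ} (hq0 : q ≠ 0) (h : Generic q x₁ x₂ x₃) (n m : ℕ) (i : Fin 3) :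
    pt q x₁ x₂ x₃ n m i ≠ 0 := by
  have hp := h.point hq0 n ((m : ℤ) - n) (-(m : ℤ))
  fin_cases i
  exacts [hp.ne₁, hp.ne₂, hp.ne₃]

theorem pt_ne {q x₁ x₂ x₃ : ℂ} (hq0 : q ≠ 0) (h : Generic q x₁ x₂ x₃) (n m : ℕ) (d : ℤ)
    (i j : Fin 3) (hij : i ≠ j) :
    pt q x₁ x₂ x₃ n m i ≠ pt q x₁ x₂ x₃ n m j * q ^ d := by
  have hp := h.point hq0 n ((m : ℤ) - n) (-(m : ℤ))
  have g : ∀ {y z : ℂ}, (∀ n : ℤ, y ≠ z * q ^ n) → ∀ n : ℤ, z ≠ y * q ^ n := fun H n e =>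
    H (-n) (by rw [e, zpow_neg]; have := zpow_ne_zero n hq0; field_simp)
  fin_cases i <;> fin_cases j
  exacts [absurd rfl hij, hp.gen₁₂ d, hp.gen₁₃ d, g hp.gen₁₂ d, absurd rfl hij, hp.gen₂₃ d,
    g hp.gen₁₃ d, g hp.gen₂₃ d, absurd rfl hij]

theorem pt_ne' {q x₁ x₂ x₃ : ℂ} (hq0 : q ≠ 0) (h : Generic q x₁ x₂ x₃) (n m : ℕ)
    (i j : Fin 3) (hij : i ≠ j) : pt q x₁ x₂ x₃ n m i ≠ pt q x₁ x₂ x₃ n m j := by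
  simpa using pt_ne hq0 h n m 0 i j hij

theorem vdm_mul_sum_chainCoef_zero {q : ℂ} (hq0 : q ≠ 0) {x₁ x₂ x₃ : ℂ}
    (h : Generic q x₁ x₂ x₃) (k a n m : ℕ) :
    vdm (pt q x₁ x₂ x₃ n m) * ∑ p, chainCoef q x₁ x₂ x₃ k a 0 n m p =
      weight q x₁ x₂ x₃ n m ^ k * altSum x₁ x₃ a 0 (pt q x₁ x₂ x₃ n m) := by
  simp only [chainCoef, pow_zero, mul_one]
  rw [Fintype.sum_prod_type, Finset.mul_sum, altSum, Finset.mul_sum, Finset.mul_sum]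
  refine Finset.sum_congr rfl fun j _ => ?_
  simp only
  rw [← Finset.mul_sum, sum_raiseCoef (pt_ne_zero hq0 (h.low hq0) _ _)
    (pt_ne' hq0 (h.low hq0) _ _), mul_one]
  have := vdm_mul_lowCoef (pt_ne_zero hq0 h n m) (pt_ne' hq0 h n m) j
  rw [show ∀ v w c d : ℂ, v * (w * c * d) = w * d * (v * c) from fun _ _ _ _ => by ring, this,
    Finset.mul_sum, Finset.mul_sum, Finset.mul_sum]
  exact Finset.sum_congr rfl fun l _ => by ring

theorem vdm_mul_sum_chainCoef_succ {q : ℂ} (hq0 : q ≠ 0) {x₁ x₂ x₃ : ℂ}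
    (h : Generic q x₁ x₂ x₃) (k a b n m : ℕ) :
    vdm (pt q x₁ x₂ x₃ n m) * (∑ p, chainCoef q x₁ x₂ x₃ k (a + 1) (b + 1) n m p -
      x₁ / x₃ * q⁻¹ * ∑ p, chainCoef q x₁ x₂ x₃ k a b n m p) =
      weight q x₁ x₂ x₃ n m ^ k * altSum x₁ x₃ (a + 1) (b + 1) (pt q x₁ x₂ x₃ n m) := by
  rw [Finset.mul_sum, ← Finset.sum_sub_distrib, Finset.mul_sum, altSum, Fintype.sum_prod_type,
    Finset.mul_sum, Finset.mul_sum]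
  refine Finset.sum_congr rfl fun j _ => ?_
  rw [Finset.mul_sum, Finset.mul_sum]
  refine Finset.sum_congr rfl fun l _ => ?_
  have key := vdm_mul_lowCoef_mul_raiseCoef hq0 (pt_ne_zero hq0 h n m) (pt_ne' hq0 h n m)
    (fun i j hij => by simpa using pt_ne hq0 h n m 1 i j hij) j l
  have hs : permSign j l * Function.update (pt q x₁ x₂ x₃ n m) j (pt q x₁ x₂ x₃ n m j / q) l ^ b =
      permSign j l * pt q x₁ x₂ x₃ n m l ^ b := by
    by_cases hjl : j = l
    · subst hjl
      have h : permSign j j = 0 := by fin_cases j <;> simp [permSign]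
      rw [h, zero_mul, zero_mul]
    · rw [Function.update_of_ne (Ne.symm hjl)]
  simp only [chainCoef, pt_low hq0]
  have n0 := pt_ne_zero hq0 h n m j
  generalize pt q x₁ x₂ x₃ n m = Z at *
  generalize Function.update Z j (Z j / q) = Z' at *
  have e3 := h.ne₃
  calc _ = weight q x₁ x₂ x₃ n m ^ k * (x₁ / x₃) * (x₁ / Z j) ^ a * (1 / x₃) ^ b * Z' l ^ b *
        (vdm Z * lowCoef Z j * raiseCoef Z' l * (Z' l / Z j - q⁻¹)) := by
        rw [pow_succ, pow_succ, div_eq_mul_one_div (Z' l) x₃, mul_pow]; ring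
    _ = weight q x₁ x₂ x₃ n m ^ k * (x₁ / x₃) * (x₁ / Z j) ^ a * (1 / x₃) ^ b *
        (permSign j l * Z' l ^ b) * (Z 0 / Z 2 * (Z l / Z j) ^ 2) := by rw [key]; ring
    _ = _ := by
        rw [hs, pow_succ, pow_succ, div_eq_mul_one_div (Z l) x₃, mul_pow]; ring

end Alternant

section Bounds

open Filter Topology

/-- Functions on `ℕ × ℕ` of at most exponential growth. -/
def ExpBdd (f : ℕ × ℕ → ℂ) : Prop :=
  ∃ C D : ℝ, 0 ≤ C ∧ 1 ≤ D ∧ ∀ p, ‖f p‖ ≤ C * D ^ (p.1 + p.2)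

theorem ExpBdd.mul {f g : ℕ × ℕ → ℂ} (hf : ExpBdd f) (hg : ExpBdd g) :
    ExpBdd fun p => f p * g p := by
  obtain ⟨C, D, hC, hD, h⟩ := hf
  obtain ⟨C', D', hC', hD', h'⟩ := hg
  refine ⟨C * C', D * D', mul_nonneg hC hC', by nlinarith, fun p => ?_⟩
  rw [norm_mul, mul_pow, mul_mul_mul_comm]
  exact mul_le_mul (h p) (h' p) (norm_nonneg _) (by positivity)

theorem ExpBdd.pow {f : ℕ × ℕ → ℂ} (hf : ExpBdd f) (k : ℕ) : ExpBdd fun p => f p ^ k := by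
  induction k with
  | zero => exact ⟨1, 1, zero_le_one, le_rfl, fun p => by simp⟩
  | succ k ih => simpa only [pow_succ] using ih.mul hf

theorem expBdd_of_bdd {f : ℕ × ℕ → ℂ} {C : ℝ} (h : ∀ p, ‖f p‖ ≤ C) : ExpBdd f :=
  ⟨C, 1, (norm_nonneg _).trans (h (0, 0)), le_rfl, fun p => by simpa using h p⟩

theorem ExpBdd.add {f g : ℕ × ℕ → ℂ} (hf : ExpBdd f) (hg : ExpBdd g) :
    ExpBdd fun p => f p + g p := by
  obtain ⟨C, D, hC, hD, h⟩ := hf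
  obtain ⟨C', D', hC', hD', h'⟩ := hg
  have e1 : ∀ n : ℕ, D ^ n ≤ (D * D') ^ n := fun n =>
    pow_le_pow_left₀ (by linarith) (by nlinarith) n
  have e2 : ∀ n : ℕ, D' ^ n ≤ (D * D') ^ n := fun n =>
    pow_le_pow_left₀ (by linarith) (by nlinarith) n
  refine ⟨C + C', D * D', add_nonneg hC hC', by nlinarith, fun p => ?_⟩
  rw [add_mul]
  exact (norm_add_le _ _).trans (add_le_add
    ((h p).trans (mul_le_mul_of_nonneg_left (e1 _) hC))
    ((h' p).trans (mul_le_mul_of_nonneg_left (e2 _) hC')))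

theorem expBdd_const (c : ℂ) : ExpBdd fun _ => c := expBdd_of_bdd fun _ => le_rfl

theorem expBdd_of_natAbs {g : ℤ → ℂ} {C D : ℝ} (hC : 0 ≤ C) (hD : 1 ≤ D)
    (hg : ∀ d, ‖g d‖ ≤ C * D ^ d.natAbs) {d : ℕ × ℕ → ℤ}
    (hd : ∀ p, (d p).natAbs ≤ p.1 + p.2 + 2) : ExpBdd fun p => g (d p) := by
  refine ⟨C * D ^ 2, D, by positivity, hD, fun p => (hg _).trans ?_⟩
  rw [mul_assoc, ← pow_add, add_comm 2]
  exact mul_le_mul_of_nonneg_left (pow_le_pow_right₀ hD (hd p)) hC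

theorem norm_zpow_le {q : ℂ} (hq : ‖q‖ < 1) (hq0 : q ≠ 0) (d : ℤ) :
    ‖q ^ d‖ ≤ 1 * ‖q‖⁻¹ ^ d.natAbs := by
  have h1 : 0 < ‖q‖ := norm_pos_iff.2 hq0
  have h2 : 1 ≤ ‖q‖⁻¹ := (one_le_inv₀ h1).2 hq.le
  rw [one_mul, norm_zpow]
  rcases Int.natAbs_eq d with h | h
  · rw [h, Int.natAbs_natCast, zpow_natCast]
    exact pow_le_pow_left₀ h1.le (by linarith) _
  · rw [h, Int.natAbs_neg, Int.natAbs_natCast, zpow_neg, zpow_natCast, inv_pow]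

theorem expBdd_zpow {q : ℂ} (hq : ‖q‖ < 1) (hq0 : q ≠ 0) {d : ℕ × ℕ → ℤ}
    (hd : ∀ p, (d p).natAbs ≤ p.1 + p.2 + 2) : ExpBdd fun p => q ^ d p :=
  expBdd_of_natAbs zero_le_one ((one_le_inv₀ (norm_pos_iff.2 hq0)).2 hq.le)
    (norm_zpow_le hq hq0) hd

theorem tendsto_mul_pow {q : ℂ} (hq : ‖q‖ < 1) (z : ℂ) :
    Tendsto (fun n : ℕ => z * q ^ n) atTop (𝓝 0) := by
  simpa using (tendsto_pow_atTop_nhds_zero_of_norm_lt_one hq).const_mul z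

theorem exists_norm_inv_one_sub_le {q : ℂ} (hq : ‖q‖ < 1) (hq0 : q ≠ 0) {z : ℂ} (hz : z ≠ 0) :
    ∃ C : ℝ, 1 ≤ C ∧ ∀ d : ℤ, ‖(1 - z * q ^ d)⁻¹‖ ≤ C := by
  have t1 : Tendsto (fun n : ℕ => (1 - z * q ^ n)⁻¹) atTop (𝓝 ((1 - 0)⁻¹)) :=
    ((tendsto_mul_pow hq z).const_sub 1).inv₀ (by simp)
  have t2 : Tendsto (fun n : ℕ => q ^ n * (q ^ n - z)⁻¹) atTop (𝓝 (0 * (0 - z)⁻¹)) := by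
    have := tendsto_mul_pow hq 1
    simp only [one_mul] at this
    exact this.mul ((this.sub_const z).inv₀ (by simpa using hz))
  obtain ⟨C₁, h1⟩ := (Metric.isBounded_range_of_tendsto _ t1).exists_norm_le
  obtain ⟨C₂, h2⟩ := (Metric.isBounded_range_of_tendsto _ t2).exists_norm_le
  refine ⟨max 1 (max C₁ C₂), le_max_left _ _, fun d => ?_⟩
  rcases Int.eq_nat_or_neg d with ⟨n, rfl | rfl⟩
  · rw [zpow_natCast]
    exact (h1 _ ⟨n, rfl⟩).trans ((le_max_left _ _).trans (le_max_right _ _))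
  · have : (1 - z * q ^ (-(n : ℤ)))⁻¹ = q ^ n * (q ^ n - z)⁻¹ := by
      have := pow_ne_zero n hq0
      rw [zpow_neg, zpow_natCast, show 1 - z * (q ^ n)⁻¹ = (q ^ n - z) / q ^ n by field_simp,
        inv_div, div_eq_mul_inv]
    rw [this]
    exact (h2 _ ⟨n, rfl⟩).trans ((le_max_right _ _).trans (le_max_right _ _))

theorem exists_norm_inv_qPochInf_le {q : ℂ} (hq : ‖q‖ < 1) (z : ℂ) :
    ∃ C : ℝ, 0 ≤ C ∧ ∀ n : ℕ, ‖(qPochInf (z * q ^ n) q)⁻¹‖ ≤ C := by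
  have t : Tendsto (fun n : ℕ => (qPochInf (z * q ^ n) q)⁻¹) atTop (𝓝 1⁻¹) :=
    (tendsto_qPochInf hq (tendsto_mul_pow hq z)).inv₀ one_ne_zero
  obtain ⟨C, h⟩ := (Metric.isBounded_range_of_tendsto _ t).exists_norm_le
  exact ⟨C, (norm_nonneg _).trans (h _ ⟨0, rfl⟩), fun n => h _ ⟨n, rfl⟩⟩

theorem exists_norm_inv_qPochInf_zpow_le {q : ℂ} (hq : ‖q‖ < 1) (hq0 : q ≠ 0) {z : ℂ}
    (hz : z ≠ 0) : ∃ C D : ℝ, 0 ≤ C ∧ 1 ≤ D ∧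
      ∀ d : ℤ, ‖(qPochInf (z * q ^ d) q)⁻¹‖ ≤ C * D ^ d.natAbs := by
  obtain ⟨C, hC, h⟩ := exists_norm_inv_qPochInf_le hq z
  obtain ⟨D, hD, h'⟩ := exists_norm_inv_one_sub_le hq hq0 hz
  refine ⟨C, D, hC, hD, fun d => ?_⟩
  rcases Int.eq_nat_or_neg d with ⟨n, rfl | rfl⟩
  · rw [zpow_natCast]
    exact (h n).trans (le_mul_of_one_le_right hC (one_le_pow₀ hD))
  · rw [Int.natAbs_neg, Int.natAbs_natCast]
    induction n with
    | zero => simpa using h 0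
    | succ n ih =>
      have e : q * (z * q ^ (-((n + 1 : ℕ) : ℤ))) = z * q ^ (-(n : ℤ)) := by
        rw [mul_left_comm, ← zpow_one_add₀ hq0]; congr 2; push_cast; ring
      rw [qPochInf_step hq, e, mul_inv, norm_mul, pow_succ, ← mul_assoc, mul_comm]
      exact mul_le_mul ih (h' _) (norm_nonneg _) (by positivity)

theorem expBdd_inv_qPochInf {q : ℂ} (hq : ‖q‖ < 1) (hq0 : q ≠ 0) {z : ℂ} (hz : z ≠ 0)
    {d : ℕ × ℕ → ℤ} (hd : ∀ p, (d p).natAbs ≤ p.1 + p.2 + 2) :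
    ExpBdd fun p => (qPochInf (z * q ^ d p) q)⁻¹ := by
  obtain ⟨C, D, hC, hD, h⟩ := exists_norm_inv_qPochInf_zpow_le hq hq0 hz
  exact expBdd_of_natAbs hC hD h hd

theorem exists_norm_inv_descFac_le {q : ℂ} (hq : ‖q‖ < 1) (hq0 : q ≠ 0) :
    ∃ D : ℝ, 1 ≤ D ∧ ∀ n, ‖(descFac q n)⁻¹‖ ≤ D ^ n := by
  obtain ⟨D, hD, h⟩ := exists_norm_inv_one_sub_le hq hq0 one_ne_zero
  refine ⟨D, hD, fun n => ?_⟩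
  rw [descFac, ← Finset.prod_inv_distrib, norm_prod]
  refine (Finset.prod_le_prod (fun _ _ => norm_nonneg _) fun j _ => ?_).trans_eq
    (by rw [Finset.prod_const, Finset.card_range])
  simpa using h (-(j : ℤ) - 1)

theorem summable_gaussian (D : ℝ) (hD : 1 ≤ D) {ρ : ℝ} (h0 : 0 < ρ) (h1 : ρ < 1) :
    Summable fun n : ℕ => D ^ n * ρ ^ (n ^ 2) := by
  have hpos : ∀ n : ℕ, 0 < D ^ n * ρ ^ (n ^ 2) := fun n => by positivity
  refine summable_of_ratio_test_tendsto_lt_one (l := 0) one_pos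
    (Eventually.of_forall fun n => (hpos n).ne') ?_
  have e : ∀ n : ℕ, ‖D ^ (n + 1) * ρ ^ ((n + 1) ^ 2)‖ / ‖D ^ n * ρ ^ (n ^ 2)‖ =
      D * ρ * (ρ ^ 2) ^ n := fun n => by
    rw [Real.norm_of_nonneg (hpos _).le, Real.norm_of_nonneg (hpos _).le, div_eq_iff (hpos n).ne']
    ring
  simp only [e]
  simpa using (tendsto_pow_atTop_nhds_zero_of_lt_one (by positivity : 0 ≤ ρ ^ 2)
    (by nlinarith)).const_mul (D * ρ)

theorem summable_expBdd_mul {q : ℂ} (hq : ‖q‖ < 1) (hq0 : q ≠ 0) (C D : ℝ) (hD : 1 ≤ D) :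
    Summable fun p : ℕ × ℕ =>
      C * D ^ (p.1 + p.2) * ‖q ^ ((p.1 : ℤ) ^ 2 - p.1 * p.2 + (p.2 : ℤ) ^ 2)‖ := by
  have hp := norm_pos_iff.2 hq0
  set ρ := Real.sqrt ‖q‖ with hρ
  have r0 : 0 < ρ := Real.sqrt_pos.2 hp
  have r1 : ρ < 1 := by rw [hρ, Real.sqrt_lt' one_pos]; simpa using hq
  have rq : ‖q‖ = ρ ^ 2 := (Real.sq_sqrt hp.le).symm
  have s := summable_gaussian D hD r0 r1
  have s2 := (s.mul_of_nonneg s (fun n => by positivity) (fun n => by positivity)).mul_left |C|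
  refine Summable.of_norm_bounded s2 fun p => ?_
  rw [norm_mul, norm_norm, norm_mul, Real.norm_eq_abs, norm_pow, Real.norm_of_nonneg (by linarith),
    pow_add, mul_assoc]
  refine mul_le_mul_of_nonneg_left ?_ (abs_nonneg C)
  rw [mul_mul_mul_comm]
  refine mul_le_mul_of_nonneg_left ?_ (by positivity)
  rw [norm_zpow, rq, ← pow_add, ← zpow_natCast ρ 2, ← zpow_mul, ← zpow_natCast ρ]
  refine zpow_le_zpow_right_of_le_one₀ r0 r1.le ?_
  push_cast
  nlinarith [sq_nonneg ((p.1 : ℤ) - p.2)]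

end Bounds

section KernelLimit

open Filter Topology

theorem stKer_diag {q : ℂ} (hq0 : q ≠ 0) {x₁ x₂ x₃ : ℂ} (h : Generic q x₁ x₂ x₃) (n m R : ℕ) :
    stKer q x₁ x₂ x₃ n m R R =
      qPochInf (q * q ^ ((R : ℤ) - n)) q * qPochInf (q * x₁ / x₂ * q ^ ((R : ℤ) - (m - n))) q *
        qPochInf (q * x₁ / x₃ * q ^ ((R : ℤ) + m)) q *
      (qPochInf (q * x₁ / x₃ * q ^ ((R : ℤ) + n)) q *
        qPochInf (q * x₂ / x₃ * q ^ ((R : ℤ) + (m - n))) q * qPochInf (q * q ^ ((R : ℤ) - m)) q) /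
      qPochInf (q * x₁ / x₃ * q ^ (2 * R)) q := by
  have h1 := h.ne₁
  have h2 := h.ne₂
  have h3 := h.ne₃
  rw [stKer, kappa]
  congr 1
  · congr 1
    · congr 1
      · congr 1 <;> congr 1
        · rw [zpow_sub₀ hq0]; field_simp
        · rw [zpow_sub₀ hq0 (R : ℤ), zpow_sub₀ hq0 (m : ℤ)]; field_simp
      · congr 1
        rw [zpow_add₀ hq0, zpow_neg]; field_simp
    · congr 1
      · congr 1 <;> congr 1
        · rw [zpow_add₀ hq0]; field_simp
        · rw [zpow_add₀ hq0]; field_simp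
      · congr 1
        rw [zpow_sub₀ hq0, zpow_neg]; field_simp
  · congr 1
    rw [zpow_natCast, two_mul, pow_add]; field_simp

theorem norm_mul_zpow_le {q : ℂ} (hq : ‖q‖ < 1) (c : ℂ) {d : ℤ} (hd : 0 ≤ d) :
    ‖c * q ^ d‖ ≤ ‖c‖ := by
  obtain ⟨n, rfl⟩ := Int.eq_ofNat_of_zero_le hd
  rw [zpow_natCast, norm_mul, norm_pow]
  exact mul_le_of_le_one_right (norm_nonneg _) (pow_le_one₀ (norm_nonneg _) hq.le)

theorem exists_norm_stKer_diag_le {q : ℂ} (hq : ‖q‖ < 1) (hq0 : q ≠ 0) {x₁ x₂ x₃ : ℂ}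
    (h : Generic q x₁ x₂ x₃) :
    ∃ C : ℝ, 0 ≤ C ∧ ∀ n m R, ‖stKer q x₁ x₂ x₃ n m R R‖ ≤ C := by
  obtain ⟨B, hB, hb⟩ := exists_norm_inv_qPochInf_le hq (q * x₁ / x₃)
  set E : ℂ → ℝ := fun c => Real.exp (‖c‖ * (1 - ‖q‖)⁻¹) with hE
  have hE0 : ∀ c, 0 ≤ E c := fun c => (Real.exp_pos _).le
  have key : ∀ (c : ℂ) (d : ℤ), 0 ≤ d → ‖qPochInf (c * q ^ d) q‖ ≤ E c := fun c d hd =>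
    norm_qPochInf_le hq (norm_mul_zpow_le hq c hd)
  refine ⟨E q * E (q * x₁ / x₂) * E (q * x₁ / x₃) *
    (E (q * x₁ / x₃) * E (q * x₂ / x₃) * E q) * B, ?_, fun n m R => ?_⟩
  · have := hE0; positivity
  by_cases hc : R < n ∨ R < m
  · rw [stKer_eq_zero hq hq0 h hc, norm_zero]
    have := hE0; positivity
  rw [not_or, not_lt, not_lt] at hc
  rw [stKer_diag hq0 h, div_eq_mul_inv]
  simp only [norm_mul]
  have := hE0
  gcongr
  · exact key _ _ (by omega)
  · exact key _ _ (by omega)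
  · exact key _ _ (by omega)
  · exact key _ _ (by omega)
  · exact key _ _ (by omega)
  · exact key _ _ (by omega)
  · exact hb _

theorem tendsto_stKer_diag {q : ℂ} (hq : ‖q‖ < 1) (hq0 : q ≠ 0) {x₁ x₂ x₃ : ℂ}
    (h : Generic q x₁ x₂ x₃) (n m : ℕ) :
    Tendsto (fun R => stKer q x₁ x₂ x₃ n m R R) atTop (𝓝 1) := by
  have key : ∀ (c : ℂ) (d : ℤ),
      Tendsto (fun R : ℕ => qPochInf (c * q ^ ((R : ℤ) + d)) q) atTop (𝓝 1) := fun c d => by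
    refine tendsto_qPochInf hq ?_
    have := tendsto_mul_pow hq (c * q ^ d)
    refine this.congr fun R => ?_
    rw [zpow_add₀ hq0, zpow_natCast]; ring
  have k2 : Tendsto (fun R : ℕ => qPochInf (q * x₁ / x₃ * q ^ (2 * R)) q) atTop (𝓝 1) :=
    tendsto_qPochInf hq ((tendsto_mul_pow hq _).comp (tendsto_id.const_mul_atTop' two_pos))
  have := ((((key q (-n)).mul (key (q * x₁ / x₂) (-(m - n)))).mul (key (q * x₁ / x₃) m)).mul
    (((key (q * x₁ / x₃) n).mul (key (q * x₂ / x₃) (m - n))).mul (key q (-m)))).div k2 one_ne_zero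
  simp only [mul_one, div_one] at this
  refine this.congr fun R => ?_
  rw [stKer_diag hq0 h]
  simp only [← sub_eq_add_neg, Pi.div_apply]

end KernelLimit

section CoefBounds

theorem expBdd_pow_of_le (c : ℂ) {d : ℕ × ℕ → ℕ} (hd : ∀ p, d p ≤ p.1 + p.2) :
    ExpBdd fun p => c ^ d p := by
  refine ⟨1, max 1 ‖c‖, zero_le_one, le_max_left _ _, fun p => ?_⟩
  rw [norm_pow, one_mul]
  exact (pow_le_pow_left₀ (norm_nonneg _) (le_max_right _ _) _).trans
    (pow_le_pow_right₀ (le_max_left _ _) (hd p))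

theorem sq_form_nonneg (n m : ℕ) : 0 ≤ (n : ℤ) ^ 2 - n * m + (m : ℤ) ^ 2 := by
  nlinarith [sq_nonneg ((n : ℤ) - m), sq_nonneg (n : ℤ), sq_nonneg (m : ℤ)]

theorem expBdd_weight {q : ℂ} (hq : ‖q‖ < 1) (x₁ x₂ x₃ : ℂ) :
    ExpBdd fun p => weight q x₁ x₂ x₃ p.1 p.2 := by
  unfold weight
  refine ((expBdd_pow_of_le _ fun p => Nat.le_add_right _ _).mul
    (expBdd_pow_of_le _ fun p => Nat.le_add_left _ _)).mul (expBdd_of_bdd (C := ‖(1 : ℂ)‖)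
      fun p => ?_)
  simpa using norm_mul_zpow_le hq 1 (sq_form_nonneg p.1 p.2)

/-- The exponents of `q` in the coordinates of `pt`. -/
def ptExp (n m : ℕ) : Fin 3 → ℤ := ![n, m - n, -m]

theorem pt_eq (q x₁ x₂ x₃ : ℂ) (n m : ℕ) (i : Fin 3) :
    pt q x₁ x₂ x₃ n m i = ![x₁, x₂, x₃] i * q ^ ptExp n m i := by
  fin_cases i <;> rfl

theorem natAbs_ptExp_le (n m : ℕ) (i : Fin 3) : (ptExp n m i).natAbs ≤ n + m := by
  fin_cases i
  · show ((n : ℤ)).natAbs ≤ _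
    omega
  · show ((m : ℤ) - n).natAbs ≤ _
    omega
  · show (-(m : ℤ)).natAbs ≤ _
    omega

theorem expBdd_pt {q : ℂ} (hq : ‖q‖ < 1) (hq0 : q ≠ 0) (x₁ x₂ x₃ : ℂ) (i : Fin 3)
    {c d : ℕ} (hcd : c + d ≤ 2) : ExpBdd fun p => pt q x₁ x₂ x₃ (p.1 + c) (p.2 + d) i := by
  simp only [pt_eq]
  exact (expBdd_const _).mul (expBdd_zpow hq hq0 fun p => (natAbs_ptExp_le _ _ i).trans (by omega))

theorem expBdd_inv_pt {q : ℂ} (hq : ‖q‖ < 1) (hq0 : q ≠ 0) (x₁ x₂ x₃ : ℂ) (i : Fin 3) :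
    ExpBdd fun p => (pt q x₁ x₂ x₃ p.1 p.2 i)⁻¹ := by
  simp only [pt_eq, mul_inv, ← zpow_neg]
  exact (expBdd_const _).mul (expBdd_zpow hq hq0 fun p => by
    have := natAbs_ptExp_le p.1 p.2 i
    omega)

theorem exists_norm_inv_one_sub_pt_le {q : ℂ} (hq : ‖q‖ < 1) (hq0 : q ≠ 0) {x₁ x₂ x₃ : ℂ}
    (h : Generic q x₁ x₂ x₃) (i j : Fin 3) : ∃ C : ℝ, 0 ≤ C ∧
      ∀ n m, ‖(1 - pt q x₁ x₂ x₃ n m i / pt q x₁ x₂ x₃ n m j)⁻¹‖ ≤ C := by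
  have hx : ∀ i, ![x₁, x₂, x₃] i ≠ 0 := fun i => by
    fin_cases i
    exacts [h.ne₁, h.ne₂, h.ne₃]
  obtain ⟨C, hC, hb⟩ := exists_norm_inv_one_sub_le hq hq0 (div_ne_zero (hx i) (hx j))
  refine ⟨C, zero_le_one.trans hC, fun n m => ?_⟩
  rw [pt_eq, pt_eq, mul_div_mul_comm, ← zpow_sub₀ hq0]
  exact hb _

theorem exists_norm_lowCoef_le {q : ℂ} (hq : ‖q‖ < 1) (hq0 : q ≠ 0) {x₁ x₂ x₃ : ℂ}
    (h : Generic q x₁ x₂ x₃) (j : Fin 3) :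
    ∃ C : ℝ, ∀ n m, ‖lowCoef (pt q x₁ x₂ x₃ n m) j‖ ≤ C := by
  choose C hC hb using fun i => exists_norm_inv_one_sub_pt_le hq hq0 h j i
  refine ⟨∏ i ∈ Finset.univ.erase j, C i, fun n m => ?_⟩
  rw [lowCoef, ← Finset.prod_inv_distrib, norm_prod]
  exact Finset.prod_le_prod (fun _ _ => norm_nonneg _) fun i _ => hb i n m

theorem exists_norm_raiseCoef_le {q : ℂ} (hq : ‖q‖ < 1) (hq0 : q ≠ 0) {x₁ x₂ x₃ : ℂ}
    (h : Generic q x₁ x₂ x₃) (l : Fin 3) :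
    ∃ C : ℝ, ∀ n m, ‖raiseCoef (pt q x₁ x₂ x₃ n m) l‖ ≤ C := by
  choose C hC hb using fun i => exists_norm_inv_one_sub_pt_le hq hq0 h i l
  refine ⟨∏ i ∈ Finset.univ.erase l, C i, fun n m => ?_⟩
  rw [raiseCoef, ← Finset.prod_inv_distrib, norm_prod]
  exact Finset.prod_le_prod (fun _ _ => norm_nonneg _) fun i _ => hb i n m

theorem expBdd_chainCoef {q : ℂ} (hq : ‖q‖ < 1) (hq0 : q ≠ 0) {x₁ x₂ x₃ : ℂ}
    (h : Generic q x₁ x₂ x₃) (k a b : ℕ) (t : Fin 3 × Fin 3) :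
    ExpBdd fun p => chainCoef q x₁ x₂ x₃ k a b p.1 p.2 t := by
  obtain ⟨C, hC⟩ := exists_norm_lowCoef_le hq hq0 h t.1
  obtain ⟨C', hC'⟩ := exists_norm_raiseCoef_le hq hq0 (h.low hq0) t.2
  have hs : lowN t.1 + lowM t.1 ≤ 2 := by generalize t.1 = i; revert i; decide
  simp only [chainCoef, div_eq_mul_inv _ x₃, div_eq_mul_inv _ (pt _ _ _ _ _ _ _)]
  refine (((((expBdd_weight hq x₁ x₂ x₃).pow k).mul (expBdd_of_bdd fun p => hC _ _)).mul
    (((expBdd_const x₁).mul (expBdd_inv_pt hq hq0 x₁ x₂ x₃ t.1)).pow a)).mul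
    (expBdd_of_bdd fun p => hC' _ _)).mul
    (((expBdd_pt hq hq0 (x₁ / q) x₂ x₃ t.2 hs).mul (expBdd_const x₃⁻¹)).pow b)

theorem expBdd_inv_descFac {q : ℂ} (hq : ‖q‖ < 1) (hq0 : q ≠ 0) {d : ℕ × ℕ → ℕ}
    (hd : ∀ p, d p ≤ p.1 + p.2) : ExpBdd fun p => (descFac q (d p))⁻¹ := by
  obtain ⟨D, hD, hb⟩ := exists_norm_inv_descFac_le hq hq0
  refine ⟨1, D, zero_le_one, hD, fun p => ?_⟩
  rw [one_mul]
  exact (hb _).trans (pow_le_pow_right₀ hD (hd p))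

theorem expBdd_seedCoef {q : ℂ} (hq : ‖q‖ < 1) (hq0 : q ≠ 0) {x₁ x₂ x₃ : ℂ}
    (h : Generic q x₁ x₂ x₃) : ExpBdd fun p => seedCoef q x₁ x₂ x₃ p.1 p.2 := by
  have h1 := h.ne₁
  have h2 := h.ne₂
  have h3 := h.ne₃
  have e : (fun p : ℕ × ℕ => seedCoef q x₁ x₂ x₃ p.1 p.2) = fun p =>
      qPochInf (x₁ / x₃) q / qPochInf q q ^ 2 * q ^ (-(p.1 : ℤ) - p.2) *
      ((1 + -1 * (pt q x₁ x₂ x₃ (p.1 + 0) (p.2 + 0) 0 * (pt q x₁ x₂ x₃ p.1 p.2 1)⁻¹)) *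
        (1 + -1 * (pt q x₁ x₂ x₃ (p.1 + 0) (p.2 + 0) 0 * (pt q x₁ x₂ x₃ p.1 p.2 2)⁻¹)) *
        (1 + -1 * (pt q x₁ x₂ x₃ (p.1 + 0) (p.2 + 0) 1 * (pt q x₁ x₂ x₃ p.1 p.2 2)⁻¹))) *
      ((descFac q p.1)⁻¹ * (descFac q p.2)⁻¹ *
        ((qPochInf (x₁ / x₂ * q ^ ((p.1 : ℤ) - p.2)) q)⁻¹ *
          (qPochInf (x₁ / x₃ * q ^ (p.2 : ℤ)) q)⁻¹ *
          (qPochInf (x₁ / x₃ * q ^ (p.1 : ℤ)) q)⁻¹ *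
          (qPochInf (x₂ / x₃ * q ^ ((p.2 : ℤ) - p.1)) q)⁻¹)) := by
    ext p
    rw [seedCoef, div_eq_mul_inv _ (descFac _ _ * _ * _)]
    simp only [mul_inv, add_zero]
    congr 2
    · simp only [pt, neg_one_mul, ← sub_eq_add_neg, ← div_eq_mul_inv]
      rfl
    · rw [show x₁ / (x₂ * q ^ ((p.2 : ℤ) - p.1)) = x₁ / x₂ * q ^ ((p.1 : ℤ) - p.2) by
          rw [← neg_sub (p.2 : ℤ), zpow_neg]; field_simp,
        show x₁ / (x₃ * q ^ (-(p.2 : ℤ))) = x₁ / x₃ * q ^ (p.2 : ℤ) by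
          rw [zpow_neg]; field_simp,
        mul_div_right_comm, mul_div_right_comm]
  rw [e]
  have one : ExpBdd fun _ => (1 : ℂ) := expBdd_const 1
  have r : ∀ i j, ExpBdd fun p => 1 + -1 * (pt q x₁ x₂ x₃ (p.1 + 0) (p.2 + 0) i *
      (pt q x₁ x₂ x₃ p.1 p.2 j)⁻¹) := fun i j =>
    one.add ((expBdd_const (-1)).mul ((expBdd_pt hq hq0 x₁ x₂ x₃ i (by omega)).mul
      (expBdd_inv_pt hq hq0 x₁ x₂ x₃ j)))
  refine (((expBdd_const _).mul (expBdd_zpow hq hq0 fun p => by omega)).mul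
    (((r 0 1).mul (r 0 2)).mul (r 1 2))).mul
    (((expBdd_inv_descFac hq hq0 fun p => by omega).mul
      (expBdd_inv_descFac hq hq0 fun p => by omega)).mul
    ((((expBdd_inv_qPochInf hq hq0 (div_ne_zero h1 h2) fun p => by omega).mul
      (expBdd_inv_qPochInf hq hq0 (div_ne_zero h1 h3) fun p => by omega)).mul
      (expBdd_inv_qPochInf hq hq0 (div_ne_zero h1 h3) fun p => by omega)).mul
      (expBdd_inv_qPochInf hq hq0 (div_ne_zero h2 h3) fun p => by omega)))

theorem exists_norm_mul_weight_le {q : ℂ} (x₁ x₂ x₃ : ℂ)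
    {f : ℕ × ℕ → ℂ} (hf : ExpBdd f) : ∃ C D : ℝ, 1 ≤ D ∧ ∀ p : ℕ × ℕ,
      ‖f p * weight q x₁ x₂ x₃ p.1 p.2‖ ≤
        C * D ^ (p.1 + p.2) * ‖q ^ ((p.1 : ℤ) ^ 2 - p.1 * p.2 + (p.2 : ℤ) ^ 2)‖ := by
  obtain ⟨C, D, -, hD, hb⟩ := hf.mul ((expBdd_pow_of_le (x₁ / x₂)
    fun p => Nat.le_add_right p.1 p.2).mul (expBdd_pow_of_le (x₂ / x₃)
    fun p => Nat.le_add_left p.2 p.1))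
  refine ⟨C, D, hD, fun p => ?_⟩
  rw [weight, ← mul_assoc, norm_mul]
  exact mul_le_mul_of_nonneg_right (hb p) (norm_nonneg _)

end CoefBounds

section ChainLimit

open Filter Topology

/-- The function `1/((q)_r (q)_s)` at which the chain of transfer operators is started. -/
def initial (q : ℂ) (r s : ℕ) : ℂ := qFacInv q r * qFacInv q s

theorem sum_box_seedCoef_mul_stKer {q : ℂ} (hq : ‖q‖ < 1) (hq0 : q ≠ 0) {x₁ x₂ x₃ : ℂ}
    (h : Generic q x₁ x₂ x₃) {r s R : ℕ} (hr : r ≤ R) (hs : s ≤ R) :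
    ∑ p ∈ Finset.range (R + 1) ×ˢ Finset.range (R + 1),
      seedCoef q x₁ x₂ x₃ p.1 p.2 * stKer q x₁ x₂ x₃ p.1 p.2 r s =
      if r = 0 ∧ s = 0 then 1 else 0 := by
  rw [← sum_seedCoef_mul_stKer hq hq0 h, Finset.sum_comm, ← Finset.sum_product']
  symm
  refine Finset.sum_subset ?_ fun p _ hp => ?_
  · intro p hp
    simp only [Finset.mem_product, Finset.mem_range] at hp ⊢
    omega
  · simp only [Finset.mem_product, Finset.mem_range] at hp
    rw [stKer_eq_zero hq hq0 h (by omega), mul_zero]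

theorem transfer_delta (q u v : ℂ) (r s : ℕ) :
    transfer q u v (fun r s => if r = 0 ∧ s = 0 then 1 else 0) r s = initial q r s := by
  rw [transfer, Finset.sum_eq_single 0, Finset.sum_eq_single 0]
  · simp [initial]
  · intro t _ ht
    simp [ht]
  · simp
  · intro t _ ht
    simp [ht]
  · simp

theorem initial_eq_sum {q : ℂ} (hq : ‖q‖ < 1) (hq0 : q ≠ 0) {x₁ x₂ x₃ : ℂ}
    (h : Generic q x₁ x₂ x₃) {r s R : ℕ} (hr : r ≤ R) (hs : s ≤ R) :
    initial q r s = ∑ p ∈ Finset.range (R + 1) ×ˢ Finset.range (R + 1),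
      seedCoef q x₁ x₂ x₃ p.1 p.2 * weight q x₁ x₂ x₃ p.1 p.2 *
        stKer q x₁ x₂ x₃ p.1 p.2 r s := by
  rw [← transfer_delta q (x₁ / x₂) (x₂ / x₃), transfer_congr fun i hi j hj =>
    (sum_box_seedCoef_mul_stKer hq hq0 h (hi.trans hr) (hj.trans hs)).symm, transfer_sum]
  refine Finset.sum_congr rfl fun p _ => ?_
  rw [transfer_stKer hq hq0 h, mul_assoc]

/-- Coefficient of the kernel at the lattice point `(n, m)` in the iterated transfer. -/
def chainTerm (q x₁ x₂ x₃ : ℂ) (k a b : ℕ) (p : ℕ × ℕ) : ℂ :=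
  seedCoef q x₁ x₂ x₃ p.1 p.2 * weight q x₁ x₂ x₃ p.1 p.2 *
    ∑ t, chainCoef q x₁ x₂ x₃ k a b p.1 p.2 t

theorem summable_norm_mul_weight {q : ℂ} (hq : ‖q‖ < 1) (hq0 : q ≠ 0) (x₁ x₂ x₃ : ℂ)
    {f : ℕ × ℕ → ℂ} (hf : ExpBdd f) : Summable fun p => ‖f p * weight q x₁ x₂ x₃ p.1 p.2‖ := by
  obtain ⟨C, D, hD, hb⟩ := exists_norm_mul_weight_le x₁ x₂ x₃ hf
  exact Summable.of_nonneg_of_le (fun _ => norm_nonneg _) hb (summable_expBdd_mul hq hq0 C D hD)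

theorem summable_norm_chainTerm_aux {q : ℂ} (hq : ‖q‖ < 1) (hq0 : q ≠ 0) {x₁ x₂ x₃ : ℂ}
    (h : Generic q x₁ x₂ x₃) (k a b : ℕ) (t : Fin 3 × Fin 3) :
    Summable fun p : ℕ × ℕ => ‖seedCoef q x₁ x₂ x₃ p.1 p.2 * weight q x₁ x₂ x₃ p.1 p.2 *
      chainCoef q x₁ x₂ x₃ k a b p.1 p.2 t‖ := by
  refine (summable_norm_mul_weight hq hq0 x₁ x₂ x₃ ((expBdd_seedCoef hq hq0 h).mul
    (expBdd_chainCoef hq hq0 h k a b t))).congr fun p => ?_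
  rw [mul_right_comm]

theorem summable_chainTerm {q : ℂ} (hq : ‖q‖ < 1) (hq0 : q ≠ 0) {x₁ x₂ x₃ : ℂ}
    (h : Generic q x₁ x₂ x₃) (k a b : ℕ) : Summable (chainTerm q x₁ x₂ x₃ k a b) := by
  have := summable_sum (s := Finset.univ) fun t _ =>
    (summable_norm_chainTerm_aux hq hq0 h k a b t).of_norm
  refine this.congr fun p => ?_
  rw [chainTerm, Finset.mul_sum]

theorem tendsto_chain_initial {q : ℂ} (hq : ‖q‖ < 1) (hq0 : q ≠ 0) {x₁ x₂ x₃ : ℂ}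
    (h : Generic q x₁ x₂ x₃) {k a b : ℕ} (ha : a ≤ k) (hb : b ≤ a) :
    Tendsto (fun R => chain q (x₁ / x₂) (x₂ / x₃) (initial q) k a b R R) atTop
      (𝓝 (∑' p, chainTerm q x₁ x₂ x₃ k a b p)) := by
  set c : ℕ × ℕ → Fin 3 × Fin 3 → ℂ := fun p t =>
    seedCoef q x₁ x₂ x₃ p.1 p.2 * weight q x₁ x₂ x₃ p.1 p.2 *
      chainCoef q x₁ x₂ x₃ k a b p.1 p.2 t with hc
  set K : ℕ → ℕ × ℕ → Fin 3 × Fin 3 → ℂ := fun R p t =>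
    stKer q (x₁ / q) x₂ (x₃ * q) (p.1 + lowN t.1 + raiseN t.2) (p.2 + lowM t.1 + raiseM t.2) R R
    with hK
  have h' : Generic q (x₁ / q) x₂ (x₃ * q) := (h.low hq0).raise hq0
  have e : ∀ R, chain q (x₁ / x₂) (x₂ / x₃) (initial q) k a b R R =
      ∑' p, ∑ t, c p t * K R p t := fun R => by
    rw [chain_congr k fun r hr s hs => initial_eq_sum hq hq0 h hr hs, chain_sum, tsum_eq_sum]
    · refine Finset.sum_congr rfl fun p _ => ?_
      rw [chain_stKer hq hq0 h _ _ k a ha b hb, Finset.mul_sum]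
      exact Finset.sum_congr rfl fun t _ => (mul_assoc _ _ _).symm
    · intro p hp
      refine Finset.sum_eq_zero fun t _ => ?_
      simp only [Finset.mem_product, Finset.mem_range] at hp
      rw [hK]
      simp only
      rw [stKer_eq_zero hq hq0 h' (by omega), mul_zero]
  obtain ⟨B, hB, hb'⟩ := exists_norm_stKer_diag_le hq hq0 h'
  simp only [e]
  refine tendsto_tsum_of_dominated_convergence (bound := fun p => ∑ t, ‖c p t‖ * B)
    (summable_sum fun t _ => (summable_norm_chainTerm_aux hq hq0 h k a b t).mul_right B)
    (fun p => ?_) (Eventually.of_forall fun R p => ?_)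
  · have := tendsto_finsetSum Finset.univ fun t _ =>
      (tendsto_stKer_diag hq hq0 h' (p.1 + lowN t.1 + raiseN t.2)
        (p.2 + lowM t.1 + raiseM t.2)).const_mul (c p t)
    simpa only [mul_one, chainTerm, Finset.mul_sum] using this
  · refine (norm_sum_le _ _).trans (Finset.sum_le_sum fun t _ => ?_)
    rw [norm_mul]
    exact mul_le_mul_of_nonneg_left (hb' _ _ _) (norm_nonneg _)

end ChainLimit

section Levels

open Filter Topology

theorem nth_cons_one {k : ℕ} (r : ℕ) (f : Fin k → ℕ) :
    nth (Fin.cons r f : Fin (k + 1) → ℕ) 1 = r := by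
  simp only [nth]
  rw [dif_pos (by omega)]
  rfl

theorem nth_cons_succ {k : ℕ} (r : ℕ) (f : Fin k → ℕ) {i : ℕ} (hi : 1 ≤ i) :
    nth (Fin.cons r f : Fin (k + 1) → ℕ) (i + 1) = nth f i := by
  simp only [nth]
  by_cases h : i ≤ k
  · rw [dif_pos (by omega), dif_pos (by omega)]
    exact congrArg _ (show (⟨i + 1 - 1, by omega⟩ : Fin (k + 1)) =
      Fin.succ ⟨i - 1, by omega⟩ from Fin.ext (by simp; omega)) |>.trans (Fin.cons_succ _ _ _)
  · rw [dif_neg (by omega), dif_neg (by omega)]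

/-- The summand of the fermionic sum, without the linear prefactor. -/
def levelProd (q u v : ℂ) (k a b : ℕ) (p : (Fin k → ℕ) × (Fin k → ℕ)) : ℂ :=
  ∏ i ∈ Finset.Icc 1 k,
    (u ^ nth p.1 i * v ^ nth p.2 i *
      q ^ ((nth p.1 i : ℤ) ^ 2 - (nth p.1 i : ℤ) * (nth p.2 i : ℤ) + (nth p.2 i : ℤ) ^ 2 -
        (if i ≤ a then (nth p.1 i : ℤ) else 0) - (if i ≤ b then (nth p.2 i : ℤ) else 0)) *
      qFacInv q ((nth p.1 i : ℤ) - (nth p.1 (i + 1) : ℤ)) *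
      qFacInv q ((nth p.2 i : ℤ) - (nth p.2 (i + 1) : ℤ)))

/-- Prepending a pair to a pair of sequences. -/
def consPair (k : ℕ) : (ℕ × ℕ) × (Fin k → ℕ) × (Fin k → ℕ) ≃
    (Fin (k + 1) → ℕ) × (Fin (k + 1) → ℕ) :=
  (Equiv.prodProdProdComm _ _ _ _).trans
    (Equiv.prodCongr (Fin.consEquiv fun _ => ℕ) (Fin.consEquiv fun _ => ℕ))

theorem consPair_apply {k : ℕ} (t : (ℕ × ℕ) × (Fin k → ℕ) × (Fin k → ℕ)) :
    consPair k t = (Fin.cons t.1.1 t.2.1, Fin.cons t.1.2 t.2.2) := rfl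

theorem levelProd_cons {q : ℂ} (hq0 : q ≠ 0) (u v : ℂ) (k a b : ℕ)
    (t : (ℕ × ℕ) × (Fin k → ℕ) × (Fin k → ℕ)) :
    levelProd q u v (k + 1) a b (consPair k t) =
      (if 0 < a then u / q else u) ^ t.1.1 * (if 0 < b then v / q else v) ^ t.1.2 *
        q ^ ((t.1.1 : ℤ) ^ 2 - t.1.1 * t.1.2 + (t.1.2 : ℤ) ^ 2) *
        (qFacInv q ((t.1.1 : ℤ) - nth t.2.1 1) * qFacInv q ((t.1.2 : ℤ) - nth t.2.2 1) *
          levelProd q u v k (a - 1) (b - 1) t.2) := by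
  obtain ⟨⟨r, s⟩, f, g⟩ := t
  rw [consPair_apply, levelProd, ← Finset.prod_Ioc_mul_eq_prod_Icc (by omega), mul_comm]
  have e : Finset.Ioc 1 (k + 1) = (Finset.Icc 1 k).map (addRightEmbedding 1) := by
    rw [Finset.map_add_right_Icc]; rfl
  rw [e, Finset.prod_map]
  simp only [addRightEmbedding_apply]
  have hd : ∀ (w : ℂ) (c r : ℕ), (if 0 < c then w / q else w) ^ r =
      w ^ r * q ^ (-(if 1 ≤ c then (r : ℤ) else 0)) := fun w c r => by
    rcases Nat.eq_zero_or_pos c with rfl | hc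
    · simp
    · rw [if_pos hc, if_pos (show 1 ≤ c from hc), div_pow, zpow_neg, zpow_natCast, div_eq_mul_inv]
  have h1 : ∏ x ∈ Finset.Icc 1 k, (u ^ nth (Fin.cons r f : Fin (k + 1) → ℕ) (x + 1) *
        v ^ nth (Fin.cons s g : Fin (k + 1) → ℕ) (x + 1) *
      q ^ ((nth (Fin.cons r f : Fin (k + 1) → ℕ) (x + 1) : ℤ) ^ 2 -
          (nth (Fin.cons r f : Fin (k + 1) → ℕ) (x + 1) : ℤ) *
            (nth (Fin.cons s g : Fin (k + 1) → ℕ) (x + 1) : ℤ) +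
          (nth (Fin.cons s g : Fin (k + 1) → ℕ) (x + 1) : ℤ) ^ 2 -
        (if x + 1 ≤ a then (nth (Fin.cons r f : Fin (k + 1) → ℕ) (x + 1) : ℤ) else 0) -
        (if x + 1 ≤ b then (nth (Fin.cons s g : Fin (k + 1) → ℕ) (x + 1) : ℤ) else 0)) *
      qFacInv q ((nth (Fin.cons r f : Fin (k + 1) → ℕ) (x + 1) : ℤ) -
        (nth (Fin.cons r f : Fin (k + 1) → ℕ) (x + 1 + 1) : ℤ)) *
      qFacInv q ((nth (Fin.cons s g : Fin (k + 1) → ℕ) (x + 1) : ℤ) -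
        (nth (Fin.cons s g : Fin (k + 1) → ℕ) (x + 1 + 1) : ℤ))) =
      levelProd q u v k (a - 1) (b - 1) (f, g) := by
    refine Finset.prod_congr rfl fun i hi => ?_
    have hi1 := (Finset.mem_Icc.1 hi).1
    rw [nth_cons_succ r f hi1, nth_cons_succ s g hi1, nth_cons_succ r f (by omega),
      nth_cons_succ s g (by omega)]
    simp only [show i + 1 ≤ a ↔ i ≤ a - 1 by omega, show i + 1 ≤ b ↔ i ≤ b - 1 by omega]
  have h2 : nth (Fin.cons r f : Fin (k + 1) → ℕ) (1 + 1) = nth f 1 := nth_cons_succ r f le_rfl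
  have h3 : nth (Fin.cons s g : Fin (k + 1) → ℕ) (1 + 1) = nth g 1 := nth_cons_succ s g le_rfl
  rw [h1, h2, h3, nth_cons_one, nth_cons_one, hd, hd, sub_eq_add_neg, sub_eq_add_neg _ (ite _ _ _),
    zpow_add₀ hq0, zpow_add₀ hq0]
  ring

theorem exists_bound_levelProd {q : ℂ} (hq : ‖q‖ < 1) (hq0 : q ≠ 0) (u v : ℂ) (k : ℕ) :
    ∃ B : (Fin k → ℕ) × (Fin k → ℕ) → ℝ, Summable B ∧ (∀ p, 0 ≤ B p) ∧
      ∀ a b p, ‖levelProd q u v k a b p‖ ≤ B p := by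
  induction k with
  | zero =>
    exact ⟨fun _ => 1, (hasSum_fintype _).summable, fun _ => zero_le_one, fun a b p => by
      simp [levelProd]⟩
  | succ k ih =>
    obtain ⟨B, hB, hB0, hb⟩ := ih
    obtain ⟨C, hC, hc⟩ := exists_norm_qFacInv_le hq hq0
    set D : ℝ := 1 + ‖u‖ + ‖v‖ + ‖u / q‖ + ‖v / q‖ with hD
    have hD1 : 1 ≤ D := by
      have := norm_nonneg u; have := norm_nonneg v
      have := norm_nonneg (u / q); have := norm_nonneg (v / q)
      linarith
    have hu : ∀ a : ℕ, ‖if 0 < a then u / q else u‖ ≤ D := fun a => by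
      have := norm_nonneg u; have := norm_nonneg v
      have := norm_nonneg (u / q); have := norm_nonneg (v / q)
      split_ifs <;> linarith
    have hv : ∀ a : ℕ, ‖if 0 < a then v / q else v‖ ≤ D := fun a => by
      have := norm_nonneg u; have := norm_nonneg v
      have := norm_nonneg (u / q); have := norm_nonneg (v / q)
      split_ifs <;> linarith
    obtain ⟨g, hg⟩ : ∃ g : ℕ × ℕ → ℝ, g = fun p =>
      C * C * D ^ (p.1 + p.2) * ‖q ^ ((p.1 : ℤ) ^ 2 - p.1 * p.2 + (p.2 : ℤ) ^ 2)‖ := ⟨_, rfl⟩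
    have hg0 : ∀ p, 0 ≤ g p := fun p => by rw [hg]; positivity
    have hgs : Summable g := by rw [hg]; exact summable_expBdd_mul hq hq0 _ D hD1
    refine ⟨fun p => g ((consPair k).symm p).1 * B ((consPair k).symm p).2, ?_,
      fun p => mul_nonneg (hg0 _) (hB0 _), fun a b p => ?_⟩
    · exact (hgs.mul_of_nonneg hB hg0 hB0).comp_injective (consPair k).symm.injective
    · obtain ⟨t, rfl⟩ := (consPair k).surjective p
      rw [levelProd_cons hq0]
      beta_reduce
      rw [Equiv.symm_apply_apply, hg]
      simp only [norm_mul, norm_pow]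
      calc _ ≤ D ^ t.1.1 * D ^ t.1.2 *
            ‖q ^ ((t.1.1 : ℤ) ^ 2 - t.1.1 * t.1.2 + (t.1.2 : ℤ) ^ 2)‖ * (C * C * B t.2) := by
            gcongr
            · exact hu a
            · exact hv b
            · exact hc _
            · exact hc _
            · exact hb _ _ _
        _ = _ := by ring

theorem summable_qFacInv_mul_levelProd {q : ℂ} (hq : ‖q‖ < 1) (hq0 : q ≠ 0) (u v : ℂ)
    (k a b N M : ℕ) : Summable fun p : (Fin k → ℕ) × (Fin k → ℕ) =>
      qFacInv q ((N : ℤ) - nth p.1 1) * qFacInv q ((M : ℤ) - nth p.2 1) *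
        levelProd q u v k a b p := by
  obtain ⟨B, hB, hB0, hb⟩ := exists_bound_levelProd hq hq0 u v k
  obtain ⟨C, hC, hc⟩ := exists_norm_qFacInv_le hq hq0
  refine Summable.of_norm_bounded (hB.mul_left (C * C)) fun p => ?_
  rw [norm_mul, norm_mul]
  gcongr
  · exact hc _
  · exact hc _
  · exact hb _ _ _

theorem chain_initial_eq_tsum {q : ℂ} (hq : ‖q‖ < 1) (hq0 : q ≠ 0) (u v : ℂ) (k : ℕ) :
    ∀ a b N M, chain q u v (initial q) k a b N M =
      ∑' p : (Fin k → ℕ) × (Fin k → ℕ), qFacInv q ((N : ℤ) - nth p.1 1) *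
        qFacInv q ((M : ℤ) - nth p.2 1) * levelProd q u v k a b p := by
  induction k with
  | zero =>
    intro a b N M
    rw [tsum_fintype]
    simp [chain, initial, levelProd, nth]
  | succ k ih =>
    intro a b N M
    have hs : Summable fun t => qFacInv q ((N : ℤ) - nth (consPair k t).1 1) *
        qFacInv q ((M : ℤ) - nth (consPair k t).2 1) *
        levelProd q u v (k + 1) a b (consPair k t) :=
      (summable_qFacInv_mul_levelProd hq hq0 u v (k + 1) a b N M).comp_injective
        (consPair k).injective
    rw [← (consPair k).tsum_eq, hs.tsum_prod, tsum_eq_sum (s := Finset.range (N + 1) ×ˢ Finset.range (M + 1)), chain, transfer,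
      Finset.sum_product]
    · refine Finset.sum_congr rfl fun r _ => Finset.sum_congr rfl fun s _ => ?_
      rw [ih, ← tsum_mul_left]
      refine tsum_congr fun p => ?_
      rw [levelProd_cons hq0, consPair_apply, nth_cons_one, nth_cons_one]
      ring
    · intro t ht
      simp only [Finset.mem_product, Finset.mem_range] at ht
      have : ∀ p, qFacInv q ((N : ℤ) - nth (consPair k (t, p)).1 1) *
          qFacInv q ((M : ℤ) - nth (consPair k (t, p)).2 1) = 0 := fun p => by
        rw [consPair_apply, nth_cons_one, nth_cons_one]
        simp only
        rcases not_and_or.1 ht with h | h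
        · rw [qFacInv_of_neg q (by omega), zero_mul]
        · rw [qFacInv_of_neg q (n := (M : ℤ) - t.2) (by omega), mul_zero]
      simp only [this, zero_mul, tsum_zero]

theorem tendsto_qFacInv_sub {q : ℂ} (hq : ‖q‖ < 1) (hq0 : q ≠ 0) (c : ℕ) :
    Tendsto (fun R : ℕ => qFacInv q ((R : ℤ) - c)) atTop (𝓝 (qPochInf q q)⁻¹) := by
  have h0 : qPochInf q q ≠ 0 := qPochInf_ne_zero hq (self_mul_pow_ne_one hq)
  have t : Tendsto (fun R : ℕ => qPochInf (q * q ^ ((R : ℤ) - c)) q) atTop (𝓝 1) := by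
    refine tendsto_qPochInf hq ((tendsto_mul_pow hq (q * q ^ (-(c : ℤ)))).congr fun R => ?_)
    rw [sub_eq_add_neg, zpow_add₀ hq0, zpow_natCast]; ring
  have := t.const_mul (qPochInf q q)⁻¹
  rw [mul_one] at this
  refine this.congr fun R => ?_
  rw [qFacInv_eq_qPochInf hq hq0, inv_mul_cancel_left₀ h0]

theorem tendsto_chain_levelProd {q : ℂ} (hq : ‖q‖ < 1) (hq0 : q ≠ 0) (u v : ℂ) (k a b : ℕ) :
    Tendsto (fun R => chain q u v (initial q) k a b R R) atTop
      (𝓝 ((qPochInf q q)⁻¹ * (qPochInf q q)⁻¹ * ∑' p, levelProd q u v k a b p)) := by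
  obtain ⟨B, hB, hB0, hb⟩ := exists_bound_levelProd hq hq0 u v k
  obtain ⟨C, hC, hc⟩ := exists_norm_qFacInv_le hq hq0
  simp only [chain_initial_eq_tsum hq hq0, ← tsum_mul_left]
  refine tendsto_tsum_of_dominated_convergence (hB.mul_left (C * C))
    (fun p => ((tendsto_qFacInv_sub hq hq0 _).mul (tendsto_qFacInv_sub hq hq0 _)).mul_const _)
    (Eventually.of_forall fun R p => ?_)
  rw [norm_mul, norm_mul]
  gcongr
  · exact hc _
  · exact hc _
  · exact hb _ _ _

theorem summable_levelProd {q : ℂ} (hq : ‖q‖ < 1) (hq0 : q ≠ 0) (u v : ℂ) (k a b : ℕ) :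
    Summable (levelProd q u v k a b) := by
  obtain ⟨B, hB, -, hb⟩ := exists_bound_levelProd hq hq0 u v k
  exact Summable.of_norm_bounded hB fun p => hb a b p

theorem tsum_levelProd_swap {q : ℂ} (hq : ‖q‖ < 1) (hq0 : q ≠ 0) (u v : ℂ) (k a b : ℕ) :
    ∑' p, levelProd q v u k b a p = ∑' p, levelProd q u v k a b p := by
  have h0 : qPochInf q q ≠ 0 := qPochInf_ne_zero hq (self_mul_pow_ne_one hq)
  have := tendsto_nhds_unique (tendsto_chain_levelProd hq hq0 v u k b a)
    ((tendsto_chain_levelProd hq hq0 u v k a b).congr fun R => by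
      rw [← chain_swap]
      congr 1
      funext r s
      exact mul_comm _ _)
  exact mul_left_cancel₀ (mul_ne_zero (inv_ne_zero h0) (inv_ne_zero h0)) this

theorem tsum_levelProd_eq {q : ℂ} (hq : ‖q‖ < 1) (hq0 : q ≠ 0) {x₁ x₂ x₃ : ℂ}
    (h : Generic q x₁ x₂ x₃) {k a b : ℕ} (ha : a ≤ k) (hb : b ≤ a) :
    ∑' p, levelProd q (x₁ / x₂) (x₂ / x₃) k a b p =
      qPochInf q q ^ 2 * ∑' p, chainTerm q x₁ x₂ x₃ k a b p := by
  have h0 : qPochInf q q ≠ 0 := qPochInf_ne_zero hq (self_mul_pow_ne_one hq)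
  rw [← tendsto_nhds_unique (tendsto_chain_levelProd hq hq0 _ _ k a b)
    (tendsto_chain_initial hq hq0 h ha hb)]
  field_simp

theorem levelProd_pred {q : ℂ} (hq0 : q ≠ 0) (u v : ℂ) {k a b : ℕ} (ha : a + 1 ≤ k)
    (hb : b + 1 ≤ k) (p : (Fin k → ℕ) × (Fin k → ℕ)) :
    levelProd q u v k a b p = q ^ ((nth p.1 (a + 1) : ℤ) + nth p.2 (b + 1)) *
      levelProd q u v k (a + 1) (b + 1) p := by
  have h1 : q ^ ((nth p.1 (a + 1) : ℤ) + nth p.2 (b + 1)) = ∏ i ∈ Finset.Icc 1 k,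
      ((if i = a + 1 then q ^ (nth p.1 i : ℤ) else 1) *
        (if i = b + 1 then q ^ (nth p.2 i : ℤ) else 1)) := by
    rw [Finset.prod_mul_distrib, Finset.prod_ite_eq', Finset.prod_ite_eq',
      if_pos (Finset.mem_Icc.2 ⟨by omega, ha⟩), if_pos (Finset.mem_Icc.2 ⟨by omega, hb⟩),
      zpow_add₀ hq0]
  rw [h1, levelProd, levelProd, ← Finset.prod_mul_distrib]
  refine Finset.prod_congr rfl fun i _ => ?_
  have e : ∀ (c : ℕ) (z : ℤ), (if i = c + 1 then q ^ z else 1) * q ^ (-(if i ≤ c + 1 then z else 0))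
      = q ^ (-(if i ≤ c then z else 0)) := fun c z => by
    rcases lt_trichotomy i (c + 1) with h | h | h
    · rw [if_neg (by omega), if_pos (by omega), if_pos (by omega), one_mul]
    · rw [if_pos h, if_pos (by omega), if_neg (by omega), ← zpow_add₀ hq0, add_neg_cancel, neg_zero]
    · rw [if_neg (by omega), if_neg (by omega), if_neg (by omega), one_mul]
  have e' : ∀ (A c d : ℤ), q ^ (A - c - d) = q ^ A * q ^ (-c) * q ^ (-d) := fun A c d => by
    rw [← zpow_add₀ hq0, ← zpow_add₀ hq0, sub_eq_add_neg, sub_eq_add_neg]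
  rw [e', e', ← e a, ← e b]
  ring

theorem levelProd_eq_zero (q u v : ℂ) {k a b : ℕ} {p : (Fin k → ℕ) × (Fin k → ℕ)}
    (h : levelProd q u v k a b p ≠ 0) :
    (∀ i j : Fin k, i ≤ j → p.1 j ≤ p.1 i) ∧ (∀ i j : Fin k, i ≤ j → p.2 j ≤ p.2 i) := by
  have step : ∀ f : Fin k → ℕ,
      (∀ i ∈ Finset.Icc 1 k, nth f (i + 1) ≤ nth f i) → ∀ i j : Fin k, i ≤ j → f j ≤ f i := by
    intro f hf
    have hn : ∀ i : Fin k, nth f (i + 1) = f i := fun i => by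
      rw [nth, dif_pos (by omega)]; rfl
    have main : ∀ d i : ℕ, 1 ≤ i → i + d ≤ k → nth f (i + d) ≤ nth f i := by
      intro d
      induction d with
      | zero => intros; rfl
      | succ d ih =>
        intro i hi hd
        exact (hf (i + d) (Finset.mem_Icc.2 ⟨by omega, by omega⟩)).trans (ih i hi (by omega))
    intro i j hij
    rw [← hn i, ← hn j]
    have := main (j - i) (i + 1) (by omega) (by omega)
    rwa [show (i : ℕ) + 1 + (j - i) = j + 1 by have : (i : ℕ) ≤ j := hij; omega] at this
  rw [levelProd, Finset.prod_ne_zero_iff] at h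
  constructor
  · refine step _ fun i hi => ?_
    by_contra! hc
    exact h i hi (by rw [qFacInv_of_neg q (by omega)]; ring)
  · refine step _ fun i hi => ?_
    by_contra! hc
    exact h i hi (by rw [qFacInv_of_neg q (n := (nth p.2 i : ℤ) - _) (by omega)]; ring)

theorem tsum_decr {k : ℕ} (F : (Fin k → ℕ) × (Fin k → ℕ) → ℂ)
    (hF : ∀ p, F p ≠ 0 →
      (∀ i j : Fin k, i ≤ j → p.1 j ≤ p.1 i) ∧ (∀ i j : Fin k, i ≤ j → p.2 j ≤ p.2 i)) :
    ∑' p : Decr k × Decr k, F (p.1.1, p.2.1) = ∑' p, F p := by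
  have inj : Function.Injective fun p : Decr k × Decr k => (p.1.1, p.2.1) := fun p p' e =>
    Prod.ext (Subtype.ext (congrArg Prod.fst e)) (Subtype.ext (congrArg Prod.snd e))
  exact inj.tsum_eq fun p hp => ⟨(⟨p.1, (hF p hp).1⟩, ⟨p.2, (hF p hp).2⟩), rfl⟩

end Levels

section Fermionic

/-- Summand of the sum over the cone of lattice points, with the determinant written as `altSum`. -/
def latticeTerm (q x₁ x₂ x₃ : ℂ) (k a b : ℕ) (p : ℕ × ℕ) : ℂ :=
  qPochInf (x₁ / x₃) q * q ^ (-(p.1 : ℤ) - p.2) /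
    (descFac q p.1 * descFac q p.2 *
      (qPochInf (x₁ / x₂ * q ^ ((p.1 : ℤ) - p.2)) q * qPochInf (x₁ / x₃ * q ^ (p.2 : ℤ)) q *
        qPochInf (x₁ / x₃ * q ^ (p.1 : ℤ)) q * qPochInf (x₂ / x₃ * q ^ ((p.2 : ℤ) - p.1)) q)) *
    weight q x₁ x₂ x₃ p.1 p.2 ^ (k + 1) * altSum x₁ x₃ a b (pt q x₁ x₂ x₃ p.1 p.2)

theorem sq_mul_seedCoef_mul {q : ℂ} (hq : ‖q‖ < 1) (hq0 : q ≠ 0) {x₁ x₂ x₃ : ℂ}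
    (h : Generic q x₁ x₂ x₃) (k a b : ℕ) (p : ℕ × ℕ) {s : ℂ}
    (hs : vdm (pt q x₁ x₂ x₃ p.1 p.2) * s =
      weight q x₁ x₂ x₃ p.1 p.2 ^ k * altSum x₁ x₃ a b (pt q x₁ x₂ x₃ p.1 p.2)) :
    qPochInf q q ^ 2 * (seedCoef q x₁ x₂ x₃ p.1 p.2 * weight q x₁ x₂ x₃ p.1 p.2 * s) =
      latticeTerm q x₁ x₂ x₃ k a b p := by
  have h1 := h.ne₁
  have h2 := h.ne₂
  have h3 := h.ne₃
  have h0 : qPochInf q q ≠ 0 := qPochInf_ne_zero hq (self_mul_pow_ne_one hq)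
  have e : seedCoef q x₁ x₂ x₃ p.1 p.2 = qPochInf (x₁ / x₃) q / qPochInf q q ^ 2 *
      q ^ (-(p.1 : ℤ) - p.2) * vdm (pt q x₁ x₂ x₃ p.1 p.2) / (descFac q p.1 * descFac q p.2 *
      (qPochInf (x₁ / x₂ * q ^ ((p.1 : ℤ) - p.2)) q * qPochInf (x₁ / x₃ * q ^ (p.2 : ℤ)) q *
        qPochInf (x₁ / x₃ * q ^ (p.1 : ℤ)) q * qPochInf (x₂ / x₃ * q ^ ((p.2 : ℤ) - p.1)) q)) := by
    rw [show x₁ / x₂ * q ^ ((p.1 : ℤ) - p.2) = x₁ / (x₂ * q ^ ((p.2 : ℤ) - p.1)) by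
        rw [← neg_sub (p.2 : ℤ), zpow_neg]; field_simp,
      show x₁ / x₃ * q ^ (p.2 : ℤ) = x₁ / (x₃ * q ^ (-(p.2 : ℤ))) by
        rw [zpow_neg]; field_simp,
      show x₁ / x₃ * q ^ (p.1 : ℤ) = x₁ * q ^ (p.1 : ℤ) / x₃ by ring,
      show x₂ / x₃ * q ^ ((p.2 : ℤ) - p.1) = x₂ * q ^ ((p.2 : ℤ) - p.1) / x₃ by ring]
    rfl
  have hw : weight q x₁ x₂ x₃ p.1 p.2 ^ (k + 1) * altSum x₁ x₃ a b (pt q x₁ x₂ x₃ p.1 p.2) =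
      weight q x₁ x₂ x₃ p.1 p.2 * (vdm (pt q x₁ x₂ x₃ p.1 p.2) * s) := by
    rw [hs, pow_succ]; ring
  rw [e, latticeTerm, mul_assoc _ (weight _ _ _ _ _ _ ^ (k + 1)), hw]
  field_simp

theorem tsum_levelProd_factor {q : ℂ} (hq : ‖q‖ < 1) (hq0 : q ≠ 0) (u v c : ℂ) {k a b : ℕ}
    (ha : a + 1 ≤ k) (hb : b + 1 ≤ k) :
    ∑' p : (Fin k → ℕ) × (Fin k → ℕ),
      (1 - c * q ^ ((nth p.1 (a + 1) : ℤ) + (nth p.2 (b + 1) : ℤ) - 1)) *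
        levelProd q u v k (a + 1) (b + 1) p =
      ∑' p, levelProd q u v k (a + 1) (b + 1) p - c * q⁻¹ * ∑' p, levelProd q u v k a b p := by
  rw [← tsum_mul_left, ← Summable.tsum_sub (summable_levelProd hq hq0 _ _ _ _ _)
    ((summable_levelProd hq hq0 _ _ _ _ _).mul_left _)]
  refine tsum_congr fun p => ?_
  rw [levelProd_pred hq0 u v ha hb, zpow_sub_one₀ hq0]
  ring

/-- The fermionic sum with its linear prefactor, over all pairs of sequences. -/
def fermionicSum (q x₁ x₂ x₃ : ℂ) (k a b : ℕ) : ℂ :=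
  ∑' p : (Fin k → ℕ) × (Fin k → ℕ),
    (1 - (if a = 0 ∨ b = 0 then (0 : ℂ) else
      x₁ / x₃ * q ^ ((nth p.1 a : ℤ) + (nth p.2 b : ℤ) - 1))) *
      levelProd q (x₁ / x₂) (x₂ / x₃) k a b p

theorem fermionicSum_zero (q x₁ x₂ x₃ : ℂ) (k : ℕ) {a b : ℕ} (h : a = 0 ∨ b = 0) :
    fermionicSum q x₁ x₂ x₃ k a b = ∑' p, levelProd q (x₁ / x₂) (x₂ / x₃) k a b p := by
  simp [fermionicSum, h]

theorem fermionicSum_succ {q : ℂ} (hq : ‖q‖ < 1) (hq0 : q ≠ 0) (x₁ x₂ x₃ : ℂ) {k a b : ℕ}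
    (ha : a + 1 ≤ k) (hb : b + 1 ≤ k) :
    fermionicSum q x₁ x₂ x₃ k (a + 1) (b + 1) =
      ∑' p, levelProd q (x₁ / x₂) (x₂ / x₃) k (a + 1) (b + 1) p -
        x₁ / x₃ * q⁻¹ * ∑' p, levelProd q (x₁ / x₂) (x₂ / x₃) k a b p := by
  rw [← tsum_levelProd_factor hq hq0 _ _ _ ha hb]
  simp [fermionicSum]

theorem fermionicSum_eq_of_le {q : ℂ} (hq : ‖q‖ < 1) (hq0 : q ≠ 0) {x₁ x₂ x₃ : ℂ}
    (h : Generic q x₁ x₂ x₃) {k a b : ℕ} (ha : a ≤ k) (hb : b ≤ a) :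
    fermionicSum q x₁ x₂ x₃ k a b = ∑' p, latticeTerm q x₁ x₂ x₃ k a b p := by
  rcases Nat.eq_zero_or_pos b with rfl | hb0
  · rw [fermionicSum_zero _ _ _ _ _ (Or.inr rfl), tsum_levelProd_eq hq hq0 h ha hb,
      ← tsum_mul_left]
    exact tsum_congr fun p =>
      sq_mul_seedCoef_mul hq hq0 h k a 0 p (vdm_mul_sum_chainCoef_zero hq0 h k a p.1 p.2)
  · obtain ⟨b, rfl⟩ := Nat.exists_eq_add_of_le' hb0
    obtain ⟨a, rfl⟩ := Nat.exists_eq_add_of_le' (hb0.trans_le hb)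
    rw [fermionicSum_succ hq hq0 _ _ _ ha (hb.trans ha), tsum_levelProd_eq hq hq0 h ha hb,
      tsum_levelProd_eq hq hq0 h (by omega) (by omega), mul_left_comm, ← mul_sub, ← tsum_mul_left,
      ← Summable.tsum_sub (summable_chainTerm hq hq0 h _ _ _)
        ((summable_chainTerm hq hq0 h _ _ _).mul_left _), ← tsum_mul_left]
    refine tsum_congr fun p => ?_
    rw [← sq_mul_seedCoef_mul hq hq0 h k (a + 1) (b + 1) p
      (vdm_mul_sum_chainCoef_succ hq0 h k a b p.1 p.2), chainTerm, chainTerm]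
    ring

theorem Generic.dual {q x₁ x₂ x₃ : ℂ} (h : Generic q x₁ x₂ x₃) :
    Generic q x₃⁻¹ x₂⁻¹ x₁⁻¹ := by
  have key : ∀ {y z : ℂ}, y ≠ 0 → z ≠ 0 → (∀ n : ℤ, y ≠ z * q ^ n) →
      ∀ n : ℤ, z⁻¹ ≠ y⁻¹ * q ^ n := by
    intro y z hy hz H n e
    refine H n ?_
    field_simp at e
    exact e
  exact ⟨inv_ne_zero h.ne₃, inv_ne_zero h.ne₂, inv_ne_zero h.ne₁, key h.ne₂ h.ne₃ h.gen₂₃,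
    key h.ne₁ h.ne₂ h.gen₁₂, key h.ne₁ h.ne₃ h.gen₁₃⟩

theorem latticeTerm_dual (q x₁ x₂ x₃ : ℂ) (k a b : ℕ) (p : ℕ × ℕ) :
    latticeTerm q x₃⁻¹ x₂⁻¹ x₁⁻¹ k b a p.swap = latticeTerm q x₁ x₂ x₃ k a b p := by
  have d : ∀ y z : ℂ, z⁻¹ / y⁻¹ = y / z := fun y z => by rw [inv_div_inv]
  have ew : weight q x₃⁻¹ x₂⁻¹ x₁⁻¹ p.2 p.1 = weight q x₁ x₂ x₃ p.1 p.2 := by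
    rw [weight, weight, d, d, mul_comm ((x₂ / x₃) ^ _),
      show (p.2 : ℤ) ^ 2 - p.2 * p.1 + (p.1 : ℤ) ^ 2 = (p.1 : ℤ) ^ 2 - p.1 * p.2 + (p.2 : ℤ) ^ 2 by
        ring]
  have ez : ∀ i, pt q x₃⁻¹ x₂⁻¹ x₁⁻¹ p.2 p.1 i = (pt q x₁ x₂ x₃ p.1 p.2 (Fin.rev i))⁻¹ := by
    intro i
    fin_cases i
    · simp [pt, Fin.rev, mul_comm]
    · simp only [pt, Fin.rev]
      rw [← neg_sub (p.2 : ℤ), zpow_neg]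
      simp [mul_comm]
    · simp [pt, Fin.rev, mul_comm]
  have ea : altSum x₃⁻¹ x₁⁻¹ b a (pt q x₃⁻¹ x₂⁻¹ x₁⁻¹ p.2 p.1) =
      altSum x₁ x₃ a b (pt q x₁ x₂ x₃ p.1 p.2) := by
    generalize pt q x₁ x₂ x₃ p.1 p.2 = Z at ez
    simp only [altSum, ez, Fin.sum_univ_three, permSign, d]
    simp [Fin.rev]
    left
    ring
  simp only [latticeTerm, Prod.fst_swap, Prod.snd_swap, ew, ea, d]
  congr 3
  · ring_nf
  · ring

theorem fermionicSum_dual {q : ℂ} (hq : ‖q‖ < 1) (hq0 : q ≠ 0) (x₁ x₂ x₃ : ℂ) {k a b : ℕ}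
    (ha : a ≤ k) (hb : b ≤ k) :
    fermionicSum q x₃⁻¹ x₂⁻¹ x₁⁻¹ k b a = fermionicSum q x₁ x₂ x₃ k a b := by
  by_cases h : a = 0 ∨ b = 0
  · rw [fermionicSum_zero _ _ _ _ _ h, fermionicSum_zero _ _ _ _ _ h.symm, inv_div_inv, inv_div_inv,
      tsum_levelProd_swap hq hq0 (x₁ / x₂)]
  · obtain ⟨a, rfl⟩ := Nat.exists_eq_add_of_le' (Nat.one_le_iff_ne_zero.2 (not_or.1 h).1)
    obtain ⟨b, rfl⟩ := Nat.exists_eq_add_of_le' (Nat.one_le_iff_ne_zero.2 (not_or.1 h).2)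
    rw [fermionicSum_succ hq hq0 _ _ _ ha hb, fermionicSum_succ hq hq0 _ _ _ hb ha, inv_div_inv,
      inv_div_inv, inv_div_inv, tsum_levelProd_swap hq hq0 (x₁ / x₂) (x₂ / x₃) k (a + 1),
      tsum_levelProd_swap hq hq0 (x₁ / x₂) (x₂ / x₃) k a]

theorem fermionicSum_eq {q : ℂ} (hq : ‖q‖ < 1) (hq0 : q ≠ 0) {x₁ x₂ x₃ : ℂ}
    (h : Generic q x₁ x₂ x₃) {k a b : ℕ} (ha : a ≤ k) (hb : b ≤ k) :
    fermionicSum q x₁ x₂ x₃ k a b = ∑' p, latticeTerm q x₁ x₂ x₃ k a b p := by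
  rcases le_total b a with hab | hab
  · exact fermionicSum_eq_of_le hq hq0 h ha hab
  · rw [← fermionicSum_dual hq hq0 x₁ x₂ x₃ ha hb, fermionicSum_eq_of_le hq hq0 h.dual hb hab,
      ← (Equiv.prodComm ℕ ℕ).tsum_eq]
    exact tsum_congr fun p => latticeTerm_dual q x₁ x₂ x₃ k a b p

end Fermionic

section Bosonic

theorem qPochZ_natCast (a q : ℂ) (n : ℕ) : qPochZ a q n = qPoch a q n := by
  simp [qPochZ]

theorem qPochZ_neg_natCast (a q : ℂ) (m : ℕ) :
    qPochZ a q (-(m : ℤ)) = (∏ j ∈ Finset.range m, (1 - a * q ^ (-(j : ℤ) - 1)))⁻¹ := by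
  rcases Nat.eq_zero_or_pos m with rfl | hm
  · simp [qPochZ, qPoch]
  · rw [qPochZ, if_neg (by omega)]
    simp

theorem qPochZ_add_one {a q : ℂ} (h : ∀ n : ℤ, a * q ^ n ≠ 1) (y : ℤ) :
    qPochZ a q (y + 1) = qPochZ a q y * (1 - a * q ^ y) := by
  obtain ⟨n, rfl | rfl⟩ := y.eq_nat_or_neg
  · rw [← Nat.cast_succ, qPochZ_natCast, qPochZ_natCast, qPoch_succ, zpow_natCast]
  · rcases n with - | n
    · simp [qPochZ, qPoch]
    · rw [show -((n + 1 : ℕ) : ℤ) + 1 = -(n : ℤ) by push_cast; ring, qPochZ_neg_natCast,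
        qPochZ_neg_natCast, Finset.prod_range_succ,
        show -((n + 1 : ℕ) : ℤ) = -(n : ℤ) - 1 by push_cast; ring, mul_inv_rev, mul_right_comm,
        inv_mul_cancel₀ (sub_ne_zero.2 (h _).symm), one_mul]

theorem qPochZ_mul_qPochInf {a q : ℂ} (hq : ‖q‖ < 1) (hq0 : q ≠ 0) (h : ∀ n : ℤ, a * q ^ n ≠ 1)
    (y : ℤ) : qPochZ a q y * qPochInf (a * q ^ y) q = qPochInf a q := by
  have step : ∀ y : ℤ, qPochZ a q (y + 1) * qPochInf (a * q ^ (y + 1)) q =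
      qPochZ a q y * qPochInf (a * q ^ y) q := fun y => by
    rw [qPochZ_add_one h, qPochInf_step hq (a * q ^ y), zpow_add_one₀ hq0,
      show q * (a * q ^ y) = a * (q ^ y * q) by ring, mul_assoc]
  induction y using Int.induction_on with
  | zero => simp [qPochZ, qPoch]
  | succ n ih => rw [step, ih]
  | pred n ih => rw [← step, sub_add_cancel, ih]

/-- The binomial coefficient `y (y - 1) / 2`. -/
def triangle (y : ℤ) : ℤ := y * (y - 1) / 2

theorem two_mul_triangle (y : ℤ) : 2 * triangle y = y * (y - 1) :=
  Int.two_mul_ediv_two_of_even (Int.even_mul_pred_self y)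

theorem triangle_add_one (y : ℤ) : triangle (y + 1) = triangle y + y := by
  have h1 := two_mul_triangle y
  have h2 := two_mul_triangle (y + 1)
  linarith

theorem qPochZ_reflect {a q : ℂ} (hq : ‖q‖ < 1) (hq0 : q ≠ 0) (ha : a ≠ 0)
    (h : ∀ n : ℤ, a * q ^ n ≠ 1) (y : ℤ) :
    qPochZ (q / a) q y * ((-a) ^ y * q ^ (-triangle (y + 1)) * qPochInf a q) =
      qPochInf (a * q ^ (-y)) q := by
  have h' : ∀ n : ℤ, q / a * q ^ n ≠ 1 := fun n e => h (-n - 1) <| by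
    rw [zpow_sub₀ hq0, zpow_neg, zpow_one]
    field_simp at e ⊢
    exact e.symm
  have step : ∀ y : ℤ, qPochZ (q / a) q (y + 1) *
      ((-a) ^ (y + 1) * q ^ (-triangle (y + 1 + 1)) * qPochInf a q) =
      (1 - a * q ^ (-(y + 1))) * (qPochZ (q / a) q y *
        ((-a) ^ y * q ^ (-triangle (y + 1)) * qPochInf a q)) := fun y => by
    rw [qPochZ_add_one h', triangle_add_one (y + 1), zpow_add_one₀ (neg_ne_zero.2 ha), neg_add,
      zpow_add₀ hq0, zpow_neg _ (y + 1), zpow_add_one₀ hq0]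
    field_simp
    ring
  have step' : ∀ y : ℤ, qPochInf (a * q ^ (-(y + 1))) q =
      (1 - a * q ^ (-(y + 1))) * qPochInf (a * q ^ (-y)) q := fun y => by
    rw [qPochInf_step hq (a * q ^ (-(y + 1))), mul_left_comm q, ← zpow_one_add₀ hq0]
    congr 4
    ring
  induction y using Int.induction_on with
  | zero => simp [qPochZ, qPoch, triangle]
  | succ n ih => rw [step, step', ih]
  | pred n ih =>
    have hs := step (-n - 1)
    have hs' := step' (-n - 1)
    rw [sub_add_cancel] at hs hs'
    rw [ih, hs'] at hs
    rw [sub_add_cancel]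
    exact (mul_left_cancel₀ (sub_ne_zero.2 (h _).symm) hs).symm

theorem qPoch_eq_descFac {q : ℂ} (hq0 : q ≠ 0) (n : ℕ) :
    qPoch q q n = (-1) ^ n * q ^ triangle ((n : ℤ) + 1) * descFac q n := by
  induction n with
  | zero => simp [qPoch, triangle, descFac]
  | succ n ih =>
    rw [qPoch_succ, ih, descFac, descFac, Finset.prod_range_succ, Nat.cast_succ,
      triangle_add_one ((n : ℤ) + 1), zpow_add₀ hq0, ← neg_add', zpow_neg, zpow_add_one₀ hq0,
      zpow_natCast]
    field_simp
    ring

theorem det_zpow_nu {Z : Fin 3 → ℂ} (h0 : ∀ i, Z i ≠ 0) (a b : ℕ) :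
    Matrix.det (Matrix.of fun i j : Fin 3 => Z i ^ (nu a b i - nu a b j)) =
      ∑ j, ∑ l, permSign j l * ((Z 0 / Z j) ^ (a + 1) * (Z l / Z 2) ^ (b + 1)) := by
  have z0 := h0 0
  have z1 := h0 1
  have z2 := h0 2
  have e01 : nu a b 0 - nu a b 1 = ((a + 1 : ℕ) : ℤ) := by simp [nu]; ring
  have e12 : nu a b 1 - nu a b 2 = ((b + 1 : ℕ) : ℤ) := by simp [nu]
  have e02 : nu a b 0 - nu a b 2 = ((a + 1 + (b + 1) : ℕ) : ℤ) := by simp [nu]; ring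
  rw [Matrix.det_fin_three]
  simp only [Matrix.of_apply, sub_self, zpow_zero, e01, e12, e02, ← neg_sub (nu a b 0) (nu a b 1),
    ← neg_sub (nu a b 1) (nu a b 2), ← neg_sub (nu a b 0) (nu a b 2), zpow_neg, zpow_natCast]
  simp [Fin.sum_univ_three, permSign, div_pow]
  field_simp
  ring

theorem det_mul_prod_zpow {q x₁ x₂ x₃ : ℂ} (hq0 : q ≠ 0) (h : Generic q x₁ x₂ x₃) (a b n m : ℕ) :
    Matrix.det (Matrix.of fun i j : Fin 3 =>
        pt q x₁ x₂ x₃ n m i ^ (nu a b i - nu a b j)) *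
      q ^ (-(nu a b 0 * n) - nu a b 1 * ((m : ℤ) - n)) =
      q ^ (-(n : ℤ) - m) * altSum x₁ x₃ a b (pt q x₁ x₂ x₃ n m) := by
  have h0 := pt_ne_zero hq0 h n m
  have z0 := h0 0
  have z1 := h0 1
  have z2 := h0 2
  have h1 := h.ne₁
  have h3 := h.ne₃
  have p0 : q ^ (-(n : ℤ)) = x₁ / pt q x₁ x₂ x₃ n m 0 := by
    simp [pt]; field_simp
  have p2 : q ^ (-(m : ℤ)) = pt q x₁ x₂ x₃ n m 2 / x₃ := by
    simp [pt]; field_simp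
  have e : q ^ (-(nu a b 0 * n) - nu a b 1 * ((m : ℤ) - n)) =
      (q ^ (-(n : ℤ))) ^ (a + 1) * (q ^ (-(m : ℤ))) ^ (b + 1) := by
    rw [← zpow_natCast, ← zpow_natCast, ← zpow_mul, ← zpow_mul, ← zpow_add₀ hq0]
    congr 1
    simp [nu]
    ring
  rw [det_zpow_nu h0, e, sub_eq_add_neg, zpow_add₀ hq0, p0, p2, altSum]
  generalize pt q x₁ x₂ x₃ n m = Z at *
  simp [Fin.sum_univ_three, permSign, div_pow]
  field_simp
  ring

theorem prod_zpow_eq_weight {q x₁ x₂ x₃ : ℂ} (hq0 : q ≠ 0) (h : Generic q x₁ x₂ x₃)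
    (k n m : ℕ) :
    x₁ ^ ((k : ℤ) * n) * x₂ ^ ((k : ℤ) * ((m : ℤ) - n)) * x₃ ^ ((k : ℤ) * (-m)) *
      (q ^ ((k : ℤ) * triangle n) * q ^ ((k : ℤ) * triangle ((m : ℤ) - n)) *
        q ^ ((k : ℤ) * triangle (-m))) = weight q x₁ x₂ x₃ n m ^ k := by
  have e : (n : ℤ) ^ 2 - n * m + (m : ℤ) ^ 2 = triangle n + triangle ((m : ℤ) - n) +
      triangle (-m) := by
    have h1 := two_mul_triangle n
    have h2 := two_mul_triangle ((m : ℤ) - n)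
    have h3 := two_mul_triangle (-m)
    linarith
  have h1 := h.ne₁
  have h2 := h.ne₂
  have h3 := h.ne₃
  simp only [mul_comm (k : ℤ), zpow_mul, zpow_natCast]
  rw [← mul_pow, ← mul_pow, ← mul_pow, ← mul_pow, ← mul_pow, weight, e, zpow_add₀ hq0,
    zpow_add₀ hq0, zpow_sub₀ h2, zpow_neg, zpow_natCast, zpow_natCast, zpow_natCast, div_pow, div_pow]
  congr 1
  field_simp

theorem prod_qPochZ {q x₁ x₂ x₃ : ℂ} (hq : ‖q‖ < 1) (hq0 : q ≠ 0) (h : Generic q x₁ x₂ x₃)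
    (n m : ℕ) :
    weight q x₁ x₂ x₃ n m *
      (qPochZ (x₁ / x₃) q n / qPochZ (q * x₁ / x₁) q n *
        (qPochZ (x₂ / x₃) q ((m : ℤ) - n) / qPochZ (q * x₂ / x₁) q ((m : ℤ) - n)) *
        (qPochZ (x₃ / x₃) q (-m) / qPochZ (q * x₃ / x₁) q (-m))) =
      qPochInf (x₁ / x₂) q * qPochInf (x₁ / x₃) q * qPochInf (x₂ / x₃) q *
        (qPochInf (x₁ / x₃) q / (descFac q n * descFac q m *
          (qPochInf (x₁ / x₂ * q ^ ((n : ℤ) - m)) q * qPochInf (x₁ / x₃ * q ^ (m : ℤ)) q *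
            qPochInf (x₁ / x₃ * q ^ (n : ℤ)) q *
            qPochInf (x₂ / x₃ * q ^ ((m : ℤ) - n)) q))) := by
  have h1 := h.ne₁
  have h2 := h.ne₂
  have h3 := h.ne₃
  have g12 := div_mul_zpow_ne_one hq0 h2 h.gen₁₂
  have g13 := div_mul_zpow_ne_one hq0 h3 h.gen₁₃
  have g23 := div_mul_zpow_ne_one hq0 h3 h.gen₂₃
  have ne : ∀ {c : ℂ} (_ : ∀ n : ℤ, c * q ^ n ≠ 1) (i : ℤ), qPochInf (c * q ^ i) q ≠ 0 :=
    fun hc i => qPochInf_ne_zero hq fun j => by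
      rw [mul_assoc, ← zpow_natCast, ← zpow_add₀ hq0]; exact hc _
  have ne' : ∀ {c : ℂ} (_ : ∀ n : ℤ, c * q ^ n ≠ 1), qPochInf c q ≠ 0 := fun hc => by
    simpa using ne hc 0
  have dn := descFac_ne_zero hq hq0 n
  have dm := descFac_ne_zero hq hq0 m
  have a1 : qPochZ (x₁ / x₃) q n = qPochInf (x₁ / x₃) q / qPochInf (x₁ / x₃ * q ^ (n : ℤ)) q :=
    eq_div_of_mul_eq (ne g13 _) (qPochZ_mul_qPochInf hq hq0 g13 n)
  have a2 : qPochZ (x₂ / x₃) q ((m : ℤ) - n) =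
      qPochInf (x₂ / x₃) q / qPochInf (x₂ / x₃ * q ^ ((m : ℤ) - n)) q :=
    eq_div_of_mul_eq (ne g23 _) (qPochZ_mul_qPochInf hq hq0 g23 _)
  have a3 : qPochZ (x₃ / x₃) q (-m) = (descFac q m)⁻¹ := by
    rw [div_self h3, qPochZ_neg_natCast, descFac]
    simp only [one_mul]
  have b1 : qPochZ (q * x₁ / x₁) q n = (-1) ^ n * q ^ triangle ((n : ℤ) + 1) * descFac q n := by
    rw [mul_div_cancel_right₀ _ h1, qPochZ_natCast, qPoch_eq_descFac hq0]
  have b2 := qPochZ_reflect hq hq0 (div_ne_zero h1 h2) g12 ((m : ℤ) - n)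
  have b3 := qPochZ_reflect hq hq0 (div_ne_zero h1 h3) g13 (-(m : ℤ))
  rw [div_div_eq_mul_div, neg_sub] at b2
  rw [div_div_eq_mul_div, neg_neg] at b3
  have n12 := ne g12 ((n : ℤ) - m)
  have n13 := ne g13 m
  have n13' := ne g13 n
  have n23 := ne g23 ((m : ℤ) - n)
  have r12 : qPochZ (q * x₂ / x₁) q ((m : ℤ) - n) ≠ 0 := left_ne_zero_of_mul (b2.symm ▸ n12)
  have r13 : qPochZ (q * x₃ / x₁) q (-(m : ℤ)) ≠ 0 := left_ne_zero_of_mul (b3.symm ▸ n13)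
  have e : (n : ℤ) ^ 2 - n * m + (m : ℤ) ^ 2 = triangle ((n : ℤ) + 1) +
      triangle ((m : ℤ) - n + 1) + triangle (-(m : ℤ) + 1) := by
    have h1 := two_mul_triangle ((n : ℤ) + 1)
    have h2 := two_mul_triangle ((m : ℤ) - n + 1)
    have h3 := two_mul_triangle (-(m : ℤ) + 1)
    linarith
  have ew : weight q x₁ x₂ x₃ n m * ((-(x₁ / x₂)) ^ ((m : ℤ) - n) *
      q ^ (-triangle ((m : ℤ) - n + 1))) * ((-(x₁ / x₃)) ^ (-(m : ℤ)) *
      q ^ (-triangle (-(m : ℤ) + 1))) = (-1) ^ n * q ^ triangle ((n : ℤ) + 1) := by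
    have s : ((-1 : ℂ) ^ n) * (-1) ^ n = 1 := by rw [← mul_pow]; simp
    rw [weight, e, zpow_add₀ hq0, zpow_add₀ hq0, zpow_neg q, zpow_neg q,
      zpow_sub₀ (neg_ne_zero.2 (div_ne_zero h1 h2)), zpow_neg, zpow_natCast, zpow_natCast,
      zpow_natCast, neg_pow (x₁ / x₂), neg_pow (x₁ / x₂), neg_pow (x₁ / x₃)]
    simp only [div_pow]
    field_simp
    linear_combination -s
  rw [a1, a2, a3, b1, ← ew, ← b2, ← b3]
  have hw : weight q x₁ x₂ x₃ n m ≠ 0 := by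
    unfold weight
    exact mul_ne_zero (mul_ne_zero (pow_ne_zero _ (div_ne_zero h1 h2))
      (pow_ne_zero _ (div_ne_zero h2 h3))) (zpow_ne_zero _ hq0)
  have m12 := ne' g12
  have m13 := ne' g13
  have v12 := zpow_ne_zero ((m : ℤ) - n) (neg_ne_zero.2 (div_ne_zero h1 h2))
  have v13 := zpow_ne_zero (-(m : ℤ)) (neg_ne_zero.2 (div_ne_zero h1 h3))
  have t2 := zpow_ne_zero (-triangle ((m : ℤ) - n + 1)) hq0
  have t3 := zpow_ne_zero (-triangle (-(m : ℤ) + 1)) hq0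
  generalize (-(x₁ / x₂)) ^ ((m : ℤ) - n) = V12 at *
  generalize (-(x₁ / x₃)) ^ (-(m : ℤ)) = V13 at *
  generalize q ^ (-triangle ((m : ℤ) - n + 1)) = T2 at *
  generalize q ^ (-triangle (-(m : ℤ) + 1)) = T3 at *
  generalize weight q x₁ x₂ x₃ n m = w at *
  generalize qPochInf (x₁ / x₃ * q ^ (n : ℤ)) q = Q1 at *
  generalize qPochInf (x₂ / x₃ * q ^ ((m : ℤ) - n)) q = Q2 at *
  generalize qPochInf (x₁ / x₃) q = P13 at *
  generalize qPochInf (x₁ / x₂) q = P12 at *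
  generalize qPochInf (x₂ / x₃) q = P23 at *
  generalize qPochZ (q * x₂ / x₁) q ((m : ℤ) - n) = R2 at *
  generalize qPochZ (q * x₃ / x₁) q (-(m : ℤ)) = R3 at *
  clear b1 b2 b3 a1 a2 a3 ew
  field_simp

/-- Pairs of natural numbers parametrize the cone `Q₊`. -/
def qplusEquiv : ℕ × ℕ ≃ Qplus where
  toFun p := ⟨![(p.1 : ℤ), (p.2 : ℤ) - p.1, -(p.2 : ℤ)], by simp⟩
  invFun y := ((y.1 0).toNat, (y.1 0 + y.1 1).toNat)
  left_inv p := by simp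
  right_inv y := by
    obtain ⟨y, h1, h2, h3⟩ := y
    refine Subtype.ext (funext fun i => ?_)
    fin_cases i <;> simp <;> omega

theorem latticeTerm_eq {q : ℂ} (hq : ‖q‖ < 1) (hq0 : q ≠ 0) {x : Fin 3 → ℂ}
    (h : Generic q (x 0) (x 1) (x 2)) (k a b : ℕ) (p : ℕ × ℕ) :
    Matrix.det (Matrix.of fun i j : Fin 3 =>
        (x i * q ^ (qplusEquiv p).1 i) ^ (nu a b i - nu a b j)) /
        (qPochInf (x 0 / x 1) q * qPochInf (x 0 / x 2) q * qPochInf (x 1 / x 2) q) *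
      ∏ i : Fin 3,
        (x i ^ (((k : ℤ) + 2) * (qplusEquiv p).1 i) *
          q ^ (((k : ℤ) + 2) * ((qplusEquiv p).1 i * ((qplusEquiv p).1 i - 1) / 2) -
            nu a b i * (qplusEquiv p).1 i) *
          qPochZ (x i / x 2) q ((qplusEquiv p).1 i) /
            qPochZ (q * x i / x 0) q ((qplusEquiv p).1 i)) =
      latticeTerm q (x 0) (x 1) (x 2) k a b p := by
  obtain ⟨n, m⟩ := p
  have y0 : (qplusEquiv (n, m)).1 0 = (n : ℤ) := rfl
  have y1 : (qplusEquiv (n, m)).1 1 = (m : ℤ) - n := rfl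
  have y2 : (qplusEquiv (n, m)).1 2 = -(m : ℤ) := rfl
  have ez : ∀ i, x i * q ^ (qplusEquiv (n, m)).1 i = pt q (x 0) (x 1) (x 2) n m i := by
    intro i
    fin_cases i <;> rfl
  have g12 := div_mul_zpow_ne_one hq0 h.ne₂ h.gen₁₂
  have g13 := div_mul_zpow_ne_one hq0 h.ne₃ h.gen₁₃
  have g23 := div_mul_zpow_ne_one hq0 h.ne₃ h.gen₂₃
  have ne : ∀ {c : ℂ} (_ : ∀ n : ℤ, c * q ^ n ≠ 1), qPochInf c q ≠ 0 := fun hc =>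
    qPochInf_ne_zero hq fun j => by rw [← zpow_natCast]; exact hc _
  have hP := mul_ne_zero (mul_ne_zero (ne g12) (ne g13)) (ne g23)
  have hd := det_mul_prod_zpow hq0 h a b n m
  have hw := prod_zpow_eq_weight hq0 h (k + 2) n m
  have hp := prod_qPochZ hq hq0 h n m
  have hs : q ^ (-(nu a b 0 * n) - nu a b 1 * ((m : ℤ) - n)) =
      (q ^ (nu a b 0 * (n : ℤ)))⁻¹ * (q ^ (nu a b 1 * ((m : ℤ) - n)))⁻¹ := by
    rw [sub_eq_add_neg, zpow_add₀ hq0, zpow_neg, zpow_neg]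
  have n2 : nu a b 2 = 0 := rfl
  rw [hs] at hd
  rw [pow_succ _ (k + 1), Nat.cast_add, Nat.cast_two] at hw
  simp only [triangle] at hw
  simp only [ez]
  simp only [Fin.prod_univ_three, y0, y1, y2, zpow_sub₀ hq0, n2, zero_mul, zpow_zero, div_one]
  rw [latticeTerm, div_mul_eq_mul_div, div_eq_iff hP]
  set X := x 0 ^ (((k : ℤ) + 2) * n) * x 1 ^ (((k : ℤ) + 2) * ((m : ℤ) - n)) *
    x 2 ^ (((k : ℤ) + 2) * -(m : ℤ)) * (q ^ (((k : ℤ) + 2) * ((n : ℤ) * (n - 1) / 2)) *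
      q ^ (((k : ℤ) + 2) * (((m : ℤ) - n) * ((m : ℤ) - n - 1) / 2)) *
      q ^ (((k : ℤ) + 2) * (-(m : ℤ) * (-(m : ℤ) - 1) / 2)))
  set R := qPochZ (x 0 / x 2) q n / qPochZ (q * x 0 / x 0) q n *
    (qPochZ (x 1 / x 2) q ((m : ℤ) - n) / qPochZ (q * x 1 / x 0) q ((m : ℤ) - n)) *
    (qPochZ (x 2 / x 2) q (-m) / qPochZ (q * x 2 / x 0) q (-m))
  set E := q ^ (-(n : ℤ) - m) * altSum (x 0) (x 2) a b (pt q (x 0) (x 1) (x 2) n m)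
  set w := weight q (x 0) (x 1) (x 2) n m
  linear_combination X * R * hd + E * R * hw + E * w ^ (k + 1) * hp

end Bosonic

/-- Rogers–Selberg-type identity for the characters of the principal subspaces of
`A₂⁽¹⁾` (Theorem 1.4 of the paper), for generic `x₁, x₂, x₃` and `0 < |q| < 1`. -/
theorem principal_subspace_character
    (k a b : ℕ) (ha : a ≤ k) (hb : b ≤ k)
    (q : ℂ) (hq : ‖q‖ < 1) (hq0 : q ≠ 0)
    (x : Fin 3 → ℂ) (hx : ∀ i, x i ≠ 0)
    (hgen : ∀ i j : Fin 3, i ≠ j → ∀ n : ℤ, x i / x j ≠ q ^ n) :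
    (∑' p : Decr k × Decr k,
      (1 - (if a = 0 ∨ b = 0 then (0 : ℂ) else
          x 0 / x 2 * q ^ ((nth p.1.1 a : ℤ) + (nth p.2.1 b : ℤ) - 1))) *
        ∏ i ∈ Finset.Icc 1 k,
          ((x 0 / x 1) ^ nth p.1.1 i * (x 1 / x 2) ^ nth p.2.1 i *
            q ^ ((nth p.1.1 i : ℤ) ^ 2 - (nth p.1.1 i : ℤ) * (nth p.2.1 i : ℤ) +
                (nth p.2.1 i : ℤ) ^ 2 -
                (if i ≤ a then (nth p.1.1 i : ℤ) else 0) -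
                (if i ≤ b then (nth p.2.1 i : ℤ) else 0)) *
            qFacInv q ((nth p.1.1 i : ℤ) - (nth p.1.1 (i + 1) : ℤ)) *
            qFacInv q ((nth p.2.1 i : ℤ) - (nth p.2.1 (i + 1) : ℤ))))
    = ∑' y : Qplus,
        Matrix.det (Matrix.of fun i j : Fin 3 =>
            (x i * q ^ y.1 i) ^ (nu a b i - nu a b j)) /
          (qPochInf (x 0 / x 1) q * qPochInf (x 0 / x 2) q * qPochInf (x 1 / x 2) q) *
        ∏ i : Fin 3,
          (x i ^ (((k : ℤ) + 2) * y.1 i) *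
            q ^ (((k : ℤ) + 2) * (y.1 i * (y.1 i - 1) / 2) - nu a b i * y.1 i) *
            qPochZ (x i / x 2) q (y.1 i) / qPochZ (q * x i / x 0) q (y.1 i)) := by
  have gen : ∀ i j : Fin 3, i ≠ j → ∀ n : ℤ, x i ≠ x j * q ^ n := fun i j hij n e =>
    hgen i j hij n (by rw [e, mul_div_cancel_left₀ _ (hx j)])
  have h : Generic q (x 0) (x 1) (x 2) :=
    ⟨hx 0, hx 1, hx 2, gen 0 1 (by decide), gen 1 2 (by decide), gen 0 2 (by decide)⟩
  rw [← qplusEquiv.tsum_eq]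
  refine Eq.trans ?_ ((fermionicSum_eq hq hq0 h ha hb).trans
    (tsum_congr fun p => (latticeTerm_eq hq hq0 h k a b p).symm))
  exact tsum_decr (fun p => (1 - (if a = 0 ∨ b = 0 then (0 : ℂ) else
      x 0 / x 2 * q ^ ((nth p.1 a : ℤ) + (nth p.2 b : ℤ) - 1))) *
      levelProd q (x 0 / x 1) (x 1 / x 2) k a b p)
    fun p hp => levelProd_eq_zero _ _ _ (right_ne_zero_of_mul hp)

end Stmt3
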